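/- Let χ be a non-principal Dirichlet character modulo q with χ² non-principal, and assume GRH for χ, χχ₋₄, χ² and χ²χ₋₄. Then there is a constant C = C(q) such that for all X ≥ 2, (1/X) ∫_X^{2X} |Σ_{n ≤ x, n ∈ S} χ(n)|² dx ≤ C·X/(log X)³. -/

import Mathlib

open Complex Filter
open scoped Classical

noncomputable section

/-- `n` is a sum of two squares. -/
def IsSum2Sq (n : ℕ) : Prop := ∃ a b : ℕ, n = a ^ 2 + b ^ 2

/-- The Dirichlet L-function `L(s,χ)` (junk value `0` if the modulus is `0`). -/
noncomputable def LVal {N : ℕ} (χ : DirichletCharacter ℂ N) (s : ℂ) : ℂ :=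
  if h : N = 0 then 0 else
    haveI : NeZero N := ⟨h⟩
    DirichletCharacter.LFunction χ s

/-- GRH for `L(s,χ)`: all zeros with `0 < Re s < 1` have real part `1/2`. -/
def GRH {N : ℕ} (χ : DirichletCharacter ℂ N) : Prop :=
  ∀ s : ℂ, 0 < s.re → s.re < 1 → LVal χ s = 0 → s.re = 1 / 2

/-- The unique non-principal Dirichlet character modulo 4. -/
noncomputable def chiNeg4 : DirichletCharacter ℂ 4 := ZMod.χ₄.ringHomComp (Int.castRingHom ℂ)

/-- The product `χ ⋅ χ₋₄`, as a Dirichlet character modulo `4q`. -/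
noncomputable def mulChiNeg4 {q : ℕ} (χ : DirichletCharacter ℂ q) : DirichletCharacter ℂ (4 * q) :=
  DirichletCharacter.changeLevel (dvd_mul_left q 4) χ *
    DirichletCharacter.changeLevel (dvd_mul_right 4 q) chiNeg4

/-- `S(x;q,a)`, the number of sums of two squares `n ≤ x` with `n ≡ a (mod q)`. -/
noncomputable def Scount (q a : ℕ) (x : ℝ) : ℕ :=
  ((Finset.Icc 1 ⌊x⌋₊).filter (fun m => IsSum2Sq m ∧ (m : ZMod q) = (a : ZMod q))).card

/-- The sequence `n ↦ 1_S(n) χ(n)`. -/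
noncomputable def STwist {q : ℕ} (χ : DirichletCharacter ℂ q) (n : ℕ) : ℂ :=
  if IsSum2Sq n then χ (n : ZMod q) else 0

/-- `∑_{n ≤ x, n ∈ S} χ(n)`. -/
noncomputable def SSum {q : ℕ} (χ : DirichletCharacter ℂ q) (x : ℝ) : ℂ :=
  ∑ n ∈ Finset.Icc 1 ⌊x⌋₊, STwist χ n

/-- A set of positive integers has natural density one. -/
def HasDensityOne (P : ℕ → Prop) : Prop :=
  Tendsto (fun n : ℕ => (((Finset.Icc 1 n).filter P).card : ℝ) / n) atTop (nhds 1)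

/-- The integral of `f` over the truncated Hankel contour around `ρ`, with horizontal extent
`c` and radius `r`; the two horizontal segments are taken as boundary values from below
(lower segment, traversed rightwards, `arg(s-ρ) = -π`) and from above (upper segment,
traversed leftwards, `arg(s-ρ) = π`), and the circle `|s-ρ| = r` is traversed
anticlockwise. -/
noncomputable def hankelIntegral (f : ℂ → ℂ) (ρ : ℂ) (c r : ℝ) : ℂ :=
  limUnder (nhdsWithin (0 : ℝ) (Set.Ioi 0)) (fun ε =>
    ((∫ σ in (ρ.re - c)..(ρ.re - r), f (σ + (ρ.im - ε) * I))
      + ∫ θ in (-Real.pi)..Real.pi, f (ρ + r * Complex.exp (θ * I)) * (I * r * Complex.exp (θ * I)))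
      - ∫ σ in (ρ.re - c)..(ρ.re - r), f (σ + (ρ.im + ε) * I))

/-- The integral `∫ g(s) |ds|` of a nonnegative density `g` over the truncated Hankel
contour around `ρ` (horizontal extent `c`, radius `r`), horizontal segments again taken
as boundary values from below resp. above. -/
noncomputable def hankelAbsIntegral (g : ℂ → ℝ) (ρ : ℂ) (c r : ℝ) : ℝ :=
  limUnder (nhdsWithin (0 : ℝ) (Set.Ioi 0)) (fun ε =>
    (∫ σ in (ρ.re - c)..(ρ.re - r), g (σ + (ρ.im - ε) * I))
      + (∫ θ in (-Real.pi)..Real.pi, g (ρ + r * Complex.exp (θ * I)) * r)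
      + ∫ σ in (ρ.re - c)..(ρ.re - r), g (σ + (ρ.im + ε) * I))

/-- The constant `C_q` of the paper. -/
noncomputable def Cconst (q : ℕ) : ℝ :=
  (2 * Real.pi ^ (-(1 / 4 : ℝ)) / Real.Gamma (1 / 4)) *
    (∏' p : Nat.Primes, if (p : ℕ) % 4 = 3 then (1 - (p : ℝ) ^ (-(2:ℝ))) ^ (-(1 / 4 : ℝ)) else 1) *
    ∏ p ∈ q.primeFactors.filter (fun p => p % 4 = 3), (1 - 1 / (p : ℝ)) ^ ((1 : ℝ) / 2)

section Plancherel
open MeasureTheory FourierTransform SchwartzMap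
open scoped ContDiff ENNReal

/-- Plancherel's theorem for functions in `L¹ ∩ L²`. -/
theorem lintegral_enorm_fourier_sq {f : ℝ → ℂ} (h1 : Integrable f) (h2 : MemLp f 2) :
    ∫⁻ ξ, ‖𝓕 f ξ‖ₑ ^ 2 = ∫⁻ x, ‖f x‖ₑ ^ 2 := by
  set F := h2.toLp f with hF
  have hcont : Continuous (𝓕 f) :=
    VectorFourier.fourierIntegral_continuous Real.continuous_fourierChar
      (L := innerₗ ℝ) continuous_inner h1
  have hae : ∀ᵐ x, (𝓕 F : Lp ℂ 2 (volume : Measure ℝ)) x = 𝓕 f x := by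
    apply ae_eq_of_integral_contDiff_smul_eq
    · exact (Lp.memLp _).locallyIntegrable (by norm_num)
    · exact hcont.locallyIntegrable
    · intro g g_smooth g_cpt
      have hg₁ : HasCompactSupport (Complex.ofRealCLM ∘ g) := g_cpt.comp_left rfl
      have hg₂ : ContDiff ℝ ∞ (Complex.ofRealCLM ∘ g) := by fun_prop
      set φ : 𝓢(ℝ, ℂ) := hg₁.toSchwartzMap hg₂ with hφ
      have e1 : ∫ x, g x • (𝓕 F : Lp ℂ 2 (volume : Measure ℝ)) x =
          ((𝓕 F : Lp ℂ 2 (volume : Measure ℝ)) : 𝓢'(ℝ, ℂ)) φ := by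
        rw [Lp.toTemperedDistribution_apply]; simp [φ]
      rw [e1, ← Lp.fourier_toTemperedDistribution_eq, TemperedDistribution.fourier_apply,
        Lp.toTemperedDistribution_apply]
      have e2 : ∫ x, (𝓕 φ) x • F x = ∫ x, (𝓕 φ) x • f x := by
        apply integral_congr_ae
        filter_upwards [h2.coeFn_toLp] with x hx
        rw [hx]
      rw [e2]
      have := VectorFourier.integral_bilin_fourierIntegral_eq_flip
        (ContinuousLinearMap.mul ℂ ℂ) (L := innerₗ ℝ) (f := φ) (g := f)
        Real.continuous_fourierChar continuous_inner (φ.integrable (μ := volume)) h1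
      rw [flip_innerₗ] at this
      simp only [ContinuousLinearMap.mul_apply'] at this
      refine Eq.trans ?_ (this.trans ?_)
      · rfl
      · apply integral_congr_ae
        refine Eventually.of_forall fun x => ?_
        show (ContinuousLinearMap.mul ℂ ℂ _ _ : ℂ) = _
        rw [ContinuousLinearMap.mul_apply']; beta_reduce; rw [Complex.real_smul]; rfl
  have key : eLpNorm (𝓕 f) 2 volume = eLpNorm f 2 volume := by
    rw [← eLpNorm_congr_ae hae, ← eLpNorm_congr_ae h2.coeFn_toLp]
    have := Lp.norm_fourier_eq F
    rw [Lp.norm_def, Lp.norm_def] at this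
    exact (ENNReal.toReal_eq_toReal_iff' (Lp.eLpNorm_ne_top _) (Lp.eLpNorm_ne_top _)).1 this
  rw [eLpNorm_eq_lintegral_rpow_enorm_toReal (by norm_num) (by norm_num),
    eLpNorm_eq_lintegral_rpow_enorm_toReal (by norm_num) (by norm_num)] at key
  simp only [ENNReal.toReal_ofNat, one_div] at key
  have := congrArg (fun z : ℝ≥0∞ => z ^ (2:ℝ)) key
  simp only [← ENNReal.rpow_mul] at this
  norm_num at this
  exact this

/-- Plancherel's theorem in the normalisation `∫ f(x) e^{-itx} dx`. -/
theorem lintegral_enorm_integral_exp_sq {f : ℝ → ℂ} (h1 : Integrable f) (h2 : MemLp f 2) :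
    ∫⁻ t : ℝ, ‖∫ x : ℝ, f x * cexp (-(t * x * I))‖ₑ ^ 2
      = ENNReal.ofReal (2 * Real.pi) * ∫⁻ x, ‖f x‖ₑ ^ 2 := by
  rw [← lintegral_enorm_fourier_sq h1 h2]
  have e : ∀ ξ : ℝ, 𝓕 f ξ = ∫ x : ℝ, f x * cexp (-(((2 * Real.pi * ξ : ℝ) : ℂ) * x * I)) := by
    intro ξ
    rw [Real.fourier_real_eq_integral_exp_smul]
    congr 1; ext x
    rw [smul_eq_mul, mul_comm]; congr 2; push_cast; ring
  simp_rw [e]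
  have := Measure.map_addHaar_smul (volume : Measure ℝ) (r := 2 * Real.pi) (by positivity)
  have h3 := (Homeomorph.smulOfNeZero (α := ℝ) (2 * Real.pi) (by positivity)).toMeasurableEquiv.measurableEmbedding.lintegral_map
    (fun t : ℝ => ‖∫ x : ℝ, f x * cexp (-(t * x * I))‖ₑ ^ 2) (μ := volume)
  have h4 : (⇑(Homeomorph.smulOfNeZero (α := ℝ) (2 * Real.pi) (by positivity)).toMeasurableEquiv)
      = fun x : ℝ => (2 * Real.pi) • x := rfl
  rw [h4] at h3
  rw [this] at h3
  simp only [smul_eq_mul] at h3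
  rw [← h3, lintegral_smul_measure, smul_eq_mul, ← mul_assoc, ← ENNReal.ofReal_mul (by positivity)]
  have : 2 * Real.pi * |((2 * Real.pi) ^ Module.finrank ℝ ℝ)⁻¹| = 1 := by
    rw [abs_of_pos (by positivity)]; simp; field_simp
  rw [this]; simp

end Plancherel

section LocalLemma
open Metric ComplexConjugate

/-- The Blaschke factor of the disc of radius `R` vanishing at `ρ`. -/
def blaschke (R : ℝ) (ρ z : ℂ) : ℂ := R * (z - ρ) / (R ^ 2 - conj ρ * z)

theorem norm_sq_sub_conj_mul_of_norm_eq {R : ℝ} {ρ z : ℂ} (hz : ‖z‖ = R) :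
    ‖(R : ℂ) ^ 2 - conj ρ * z‖ = R * ‖z - ρ‖ := by
  have : (R : ℂ) ^ 2 - conj ρ * z = z * conj (z - ρ) := by
    rw [map_sub, mul_sub, mul_conj, normSq_eq_norm_sq, hz]; push_cast; ring
  rw [this, norm_mul, hz, RCLike.norm_conj]

theorem sq_sub_le_norm_sq_sub_conj_mul {R r s : ℝ} {ρ z : ℂ} (hr : ‖ρ‖ ≤ r) (hz : ‖z‖ ≤ s) :
    R ^ 2 - r * s ≤ ‖(R : ℂ) ^ 2 - conj ρ * z‖ := by
  have h1 : ‖(R : ℂ) ^ 2‖ - ‖conj ρ * z‖ ≤ ‖(R : ℂ) ^ 2 - conj ρ * z‖ := norm_sub_norm_le _ _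
  have h2 : ‖(R : ℂ) ^ 2‖ = R ^ 2 := by
    rw [norm_pow, Complex.norm_real, Real.norm_eq_abs, sq_abs]
  have h3 : ‖conj ρ * z‖ ≤ r * s := by
    rw [norm_mul, RCLike.norm_conj]
    exact mul_le_mul hr hz (norm_nonneg _) ((norm_nonneg _).trans hr)
  linarith

theorem norm_le_of_sphere {g : ℂ → ℂ} (hg : Differentiable ℂ g) {R M : ℝ} (hR : 0 < R)
    (hM : ∀ z, ‖z‖ = R → ‖g z‖ ≤ M) {z : ℂ} (hz : ‖z‖ ≤ R) : ‖g z‖ ≤ M := by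
  refine norm_le_of_forall_mem_frontier_norm_le (U := ball (0 : ℂ) R) isBounded_ball
    hg.diffContOnCl (fun w hw => ?_) ?_
  · rw [frontier_ball _ hR.ne'] at hw
    exact hM w (by simpa using hw)
  · rw [closure_ball _ hR.ne']; simpa using hz

/-- Removing the zeros of an entire function in a disc by Blaschke factors. -/
theorem exists_blaschke_factorization {R r m M : ℝ} (hr : 0 < r) (hrR : r < R) (hm : 0 < m)
    (N : ℕ) : ∀ g : ℂ → ℂ, Differentiable ℂ g → (∀ z, ‖z‖ = R → ‖g z‖ ≤ M) → ∀ k : ℕ,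
      m * (R / r) ^ k ≤ ‖g 0‖ → M < m * (R / r) ^ (k + N) →
    ∃ (n : ℕ) (ρ : Fin n → ℂ) (h : ℂ → ℂ), m * (R / r) ^ (k + n) ≤ M ∧ Differentiable ℂ h ∧
      (∀ z, ‖z‖ ≤ r → h z ≠ 0) ∧ (∀ z, ‖z‖ = R → ‖h z‖ ≤ M) ∧ m ≤ ‖h 0‖ ∧
      (∀ i, ‖ρ i‖ ≤ r ∧ g (ρ i) = 0) ∧
      ∀ z, ‖z‖ ≤ R → g z = h z * ∏ i, blaschke R (ρ i) z := by
  have hR : 0 < R := hr.trans hrR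
  have hq : 1 < R / r := (one_lt_div hr).2 hrR
  induction N with
  | zero =>
    intro g hg hM k h0 hk
    exact absurd ((h0.trans (norm_le_of_sphere hg hR hM (by simpa using hR.le)))) (by simpa using hk)
  | succ N ih =>
    intro g hg hM k h0 hk
    have hgM : m * (R / r) ^ k ≤ M :=
      h0.trans (norm_le_of_sphere hg hR hM (by simpa using hR.le))
    by_cases hz : ∃ ρ, ‖ρ‖ ≤ r ∧ g ρ = 0
    · obtain ⟨ρ, hρ, hgρ⟩ := hz
      have hρ0 : ρ ≠ 0 := by
        rintro rfl
        rw [hgρ, norm_zero] at h0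
        have : 0 < m * (R / r) ^ k := by positivity
        linarith
      set g1 : ℂ → ℂ := fun z => dslope g ρ z * ((R ^ 2 - conj ρ * z) / R) with hg1
      have hds : Differentiable ℂ (dslope g ρ) := by
        rw [← differentiableOn_univ, differentiableOn_dslope univ_mem]
        exact hg.differentiableOn
      have hg1d : Differentiable ℂ g1 := by
        apply hds.mul; fun_prop
      have hslope : ∀ z, (z - ρ) * dslope g ρ z = g z := by
        intro z
        have := sub_smul_dslope g ρ z
        rw [hgρ, sub_zero, smul_eq_mul] at this
        exact this
      have hRc : (R : ℂ) ≠ 0 := by exact_mod_cast hR.ne'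
      have hfac : ∀ z, ‖z‖ ≤ R → g z = g1 z * blaschke R ρ z := by
        intro z hz
        have hne : (R : ℂ) ^ 2 - conj ρ * z ≠ 0 := by
          have := sq_sub_le_norm_sq_sub_conj_mul (R := R) hρ hz
          rw [← norm_pos_iff]
          nlinarith
        rw [hg1, blaschke, ← hslope z]
        have e : ((R : ℂ) ^ 2 - conj ρ * z) / R * (R * (z - ρ) / (R ^ 2 - conj ρ * z)) = z - ρ := by
          generalize (R : ℂ) ^ 2 - conj ρ * z = D at hne
          field_simp
        rw [mul_assoc, e, mul_comm]
      have hM1 : ∀ z, ‖z‖ = R → ‖g1 z‖ ≤ M := by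
        intro z hz
        have hb : ‖blaschke R ρ z‖ = 1 := by
          have hzρ : 0 < ‖z - ρ‖ := by
            rw [norm_pos_iff, sub_ne_zero]
            rintro rfl
            linarith
          rw [blaschke, norm_div, norm_sq_sub_conj_mul_of_norm_eq hz, norm_mul,
            Complex.norm_real, Real.norm_eq_abs, abs_of_pos hR]
          exact div_self (by positivity)
        have := hM z hz
        rwa [hfac z hz.le, norm_mul, hb, mul_one] at this
      have h01 : m * (R / r) ^ (k + 1) ≤ ‖g1 0‖ := by
        have e := hfac 0 (by simpa using hR.le)
        have hb : ‖blaschke R ρ 0‖ ≤ r / R := by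
          rw [blaschke]
          simp only [zero_sub, mul_zero, sub_zero, norm_div, norm_mul, norm_neg, norm_pow,
            Complex.norm_real, Real.norm_eq_abs, abs_of_pos hR]
          rw [sq, mul_div_mul_left _ _ hR.ne']
          gcongr
        have h2 : ‖g 0‖ ≤ ‖g1 0‖ * (r / R) := by
          rw [e, norm_mul]; gcongr
        have h3 : m * (R / r) ^ (k + 1) = (m * (R / r) ^ k) * (R / r) := by ring
        rw [h3]
        calc (m * (R / r) ^ k) * (R / r) ≤ (‖g1 0‖ * (r / R)) * (R / r) := by
              exact mul_le_mul_of_nonneg_right (h0.trans h2) (by positivity)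
          _ = ‖g1 0‖ := by field_simp
      obtain ⟨n, σ, h, a1, a2, a3, a4, a5, a6, a7⟩ :=
        ih g1 hg1d hM1 (k + 1) h01 (by rwa [add_assoc, add_comm 1 N])
      refine ⟨n + 1, Fin.cons ρ σ, h, by rwa [add_comm n 1, ← add_assoc], a2, a3, a4, a5, ?_, ?_⟩
      · intro i
        refine Fin.cases ?_ (fun i => ?_) i
        · exact ⟨hρ, hgρ⟩
        · refine ⟨(a6 i).1, ?_⟩
          simp only [Fin.cons_succ]
          rw [hfac _ ((a6 i).1.trans hrR.le), (a6 i).2, zero_mul]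
      · intro z hz
        rw [hfac z hz, a7 z hz, Fin.prod_univ_succ]
        simp only [Fin.cons_zero, Fin.cons_succ]
        ring
    · push Not at hz
      refine ⟨0, Fin.elim0, g, by simpa using hgM, hg, hz, hM, ?_, fun i => i.elim0, ?_⟩
      · refine le_trans ?_ h0
        exact le_mul_of_one_le_right hm.le (one_le_pow₀ hq.le)
      · intro z _; simp

/-- Bounds for the logarithmic derivative of a zero-free function in a disc. -/
theorem exists_logDeriv_bound {r' r r1 : ℝ} (h1 : 0 < r1) (h12 : r1 < r') (h23 : r' < r) :
    ∃ C : ℝ, 0 < C ∧ ∀ (h : ℂ → ℂ) (m M : ℝ), Differentiable ℂ h → (∀ z, ‖z‖ ≤ r → h z ≠ 0) →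
      (∀ z, ‖z‖ ≤ r → ‖h z‖ ≤ M) → 0 < m → m ≤ ‖h 0‖ → 
      DifferentiableOn ℂ (logDeriv h) (ball 0 r) ∧
      ∀ z, ‖z‖ ≤ r1 → ‖logDeriv h z‖ ≤ C * (Real.log (M / m) + 1) ∧
        ‖deriv (logDeriv h) z‖ ≤ C * (Real.log (M / m) + 1) := by
  have hr' : 0 < r' := h1.trans h12
  have hr : 0 < r := hr'.trans h23
  set d := (r' - r1) / 2 with hd
  have hdpos : 0 < d := by rw [hd]; linarith
  set B := 2 * r' / (r - r') with hB
  have hBpos : 0 < B := div_pos (by linarith) (by linarith)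
  refine ⟨B / d + (B / d) / d, by positivity, ?_⟩
  intro h m M hh hne hM hm hm0
  have hmM : m ≤ M := hm0.trans (hM 0 (by simpa using hr.le))
  have hMpos : 0 < M := hm.trans_le hmM
  have hlog : 0 ≤ Real.log (M / m) := Real.log_nonneg ((one_le_div hm).2 hmM)
  set A := Real.log (M / m) + 1 with hA
  have hApos : 0 < A := by linarith
  have hdl : DifferentiableOn ℂ (logDeriv h) (ball 0 r) := by
    intro z hz
    have hz' : ‖z‖ ≤ r := by simpa using (le_of_lt (by simpa using hz : ‖z‖ < r))
    have e : logDeriv h = fun z => deriv h z / h z := rfl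
    rw [e]
    exact ((hh.deriv z).div (hh z) (hne z hz')).differentiableWithinAt
  refine ⟨hdl, ?_⟩
  obtain ⟨f, hf0, hf⟩ := hdl.isExactOn_ball.with_val_at 0 0
  have hfd : DifferentiableOn ℂ f (ball 0 r) :=
    fun z hz => (hf z hz).differentiableAt.differentiableWithinAt
  have hexp : ∀ z ∈ ball (0 : ℂ) r, h z = h 0 * cexp (f z) := by
    intro z hz
    have hconst : ∀ w ∈ ball (0 : ℂ) r, HasDerivAt (fun w => h w * cexp (-f w)) 0 w := by
      intro w hw
      have hw' : ‖w‖ ≤ r := le_of_lt (by simpa using hw)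
      have := (hh w).hasDerivAt.mul (hf w hw).neg.cexp
      refine this.congr_deriv ?_
      have h8 := hne w hw'
      have h9 : logDeriv h w * h w = deriv h w := by
        rw [logDeriv_apply]; field_simp
      rw [← h9]; ring
    have := (convex_ball (0 : ℂ) r).is_const_of_fderivWithin_eq_zero (𝕜 := ℂ)
      (f := fun w => h w * cexp (-f w))
      (fun w hw => (hconst w hw).differentiableAt.differentiableWithinAt)
      (fun w hw => by
        rw [fderivWithin_of_isOpen isOpen_ball hw]
        ext; simp [(hconst w hw).deriv]) hz (mem_ball_self hr)
    simp only [hf0, neg_zero, Complex.exp_zero, mul_one] at this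
    rw [← this, mul_assoc, ← Complex.exp_add]; simp
  have hre : Set.MapsTo f (ball 0 r) {z | z.re ≤ A} := by
    intro z hz
    have hz' : ‖z‖ ≤ r := le_of_lt (by simpa using hz)
    have h3 : ‖h z‖ = ‖h 0‖ * Real.exp (f z).re := by
      rw [hexp z hz, norm_mul, Complex.norm_exp]
    have h4 : m * Real.exp (f z).re ≤ M := by
      refine le_trans ?_ (hM z hz')
      rw [h3]; gcongr
    have h5 : Real.exp (f z).re ≤ M / m := by rw [le_div_iff₀ hm]; linarith
    have h6 := Real.log_le_log (Real.exp_pos _) h5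
    rw [Real.log_exp] at h6
    show (f z).re ≤ A
    linarith
  have hbc : ∀ z, ‖z‖ ≤ r' → ‖f z‖ ≤ B * A := by
    intro z hz
    have := borelCaratheodory_zero hApos hfd hre hr (z := z)
      (by simpa using hz.trans_lt h23) hf0
    refine this.trans ?_
    rw [hB, div_mul_eq_mul_div]
    have : 0 < r - r' := by linarith
    have h7 : 2 * A * ‖z‖ ≤ 2 * r' * A := by nlinarith
    have h8 : r - r' ≤ r - ‖z‖ := by linarith
    exact div_le_div₀ (by positivity) h7 this h8
  have hder : ∀ z, ‖z‖ ≤ r1 + d → ‖logDeriv h z‖ ≤ B * A / d := by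
    intro z hz
    have hzb : z ∈ ball (0 : ℂ) r := by rw [mem_ball_zero_iff]; rw [hd] at hz; linarith
    rw [← (hf z hzb).deriv]
    have hsub : closedBall z d ⊆ ball 0 r := by
      intro w hw
      rw [mem_closedBall, dist_eq] at hw
      rw [mem_ball_zero_iff]
      have := norm_le_norm_add_norm_sub' w z
      rw [hd] at *; linarith
    refine norm_deriv_le_of_forall_mem_sphere_norm_le hdpos ?_ ?_
    · exact (hfd.mono hsub).diffContOnCl_ball (subset_refl _)
    · intro w hw
      apply hbc
      rw [mem_sphere, dist_eq] at hw
      have := norm_le_norm_add_norm_sub' w z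
      rw [hd] at *; linarith
  intro z hz
  constructor
  · refine (hder z (by linarith)).trans ?_
    have h10 : 0 < B * A / d / d := by positivity
    have e : (B / d + B / d / d) * A = B * A / d + B * A / d / d := by ring
    linarith
  · have hsub : closedBall z d ⊆ ball 0 r := by
      intro w hw
      rw [mem_closedBall, dist_eq] at hw
      rw [mem_ball_zero_iff]
      have := norm_le_norm_add_norm_sub' w z
      rw [hd] at *; linarith
    have h9 : ‖deriv (logDeriv h) z‖ ≤ (B * A / d) / d := by
      refine norm_deriv_le_of_forall_mem_sphere_norm_le hdpos ?_ ?_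
      · exact (hdl.mono hsub).diffContOnCl_ball (subset_refl _)
      · intro w hw
        apply hder
        rw [mem_sphere, dist_eq] at hw
        have := norm_le_norm_add_norm_sub' w z
        linarith
    refine h9.trans ?_
    have h10 : 0 < B * A / d := by positivity
    have e : (B / d + B / d / d) * A = B * A / d + B * A / d / d := by ring
    linarith

end LocalLemma

section LocalLemma
open Metric ComplexConjugate

theorem logDeriv_blaschke {R : ℝ} {ρ z : ℂ} (hR : R ≠ 0) (h1 : z ≠ ρ)
    (h2 : (R : ℂ) ^ 2 - conj ρ * z ≠ 0) :
    DifferentiableAt ℂ (blaschke R ρ) z ∧ blaschke R ρ z ≠ 0 ∧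
    logDeriv (blaschke R ρ) z = 1 / (z - ρ) + conj ρ / (R ^ 2 - conj ρ * z) := by
  have hR' : (R : ℂ) ≠ 0 := by exact_mod_cast hR
  have h1' : z - ρ ≠ 0 := sub_ne_zero.2 h1
  have d1 : HasDerivAt (fun z : ℂ => (R : ℂ) * (z - ρ)) (R * 1) z :=
    ((hasDerivAt_id z).sub_const ρ).const_mul _
  have d2 : HasDerivAt (fun z : ℂ => (R : ℂ) ^ 2 - conj ρ * z) (-(conj ρ * 1)) z :=
    ((hasDerivAt_id z).const_mul _).const_sub _
  have d := d1.div d2 h2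
  have hne : blaschke R ρ z ≠ 0 := div_ne_zero (mul_ne_zero hR' h1') h2
  refine ⟨d.differentiableAt, hne, ?_⟩
  have e : deriv (blaschke R ρ) z = _ := d.deriv
  rw [logDeriv_apply, e, blaschke]
  generalize hD : (R : ℂ) ^ 2 - conj ρ * z = D at *
  have : conj ρ * (z - ρ) = conj ρ * z - conj ρ * ρ := by ring
  field_simp
  ring

theorem norm_le_mul_sub_of_zero {g : ℂ → ℂ} (hg : Differentiable ℂ g) {R r M : ℝ} (hr : 0 ≤ r)
    (hrR : r < R) (hM : ∀ z, ‖z‖ ≤ R → ‖g z‖ ≤ M) {ρ z : ℂ} (hρ : ‖ρ‖ ≤ r) (h0 : g ρ = 0)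
    (hz : ‖z‖ ≤ R) : ‖g z‖ ≤ M / (R - r) * ‖z - ρ‖ := by
  have hds : Differentiable ℂ (dslope g ρ) := by
    rw [← differentiableOn_univ, differentiableOn_dslope univ_mem]
    exact hg.differentiableOn
  have hslope : ∀ z, (z - ρ) * dslope g ρ z = g z := by
    intro z
    have := sub_smul_dslope g ρ z
    rw [h0, sub_zero, smul_eq_mul] at this
    exact this
  have hb : ‖dslope g ρ z‖ ≤ M / (R - r) := by
    refine norm_le_of_sphere hds (hr.trans_lt hrR) (fun w hw => ?_) hz
    have h1 : R - r ≤ ‖w - ρ‖ := by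
      have := norm_sub_norm_le w ρ
      linarith
    have h2 : ‖w - ρ‖ * ‖dslope g ρ w‖ ≤ M := by
      rw [← norm_mul, hslope]; exact hM w hw.le
    rw [le_div_iff₀ (by linarith)]
    nlinarith [norm_nonneg (dslope g ρ w)]
  rw [← hslope z, norm_mul, mul_comm]
  gcongr

/-- Local partial fraction expansion of the logarithmic derivative of an entire function. -/
theorem exists_local_partial_fraction : ∃ C : ℝ, 0 < C ∧ ∀ (g : ℂ → ℂ) (c : ℂ) (m M : ℝ),
    Differentiable ℂ g → (∀ z, ‖z - c‖ ≤ 9 / 5 → ‖g z‖ ≤ M) → 0 < m → m ≤ ‖g c‖ →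
    ∃ (n : ℕ) (ρ : Fin n → ℂ) (h : ℂ → ℂ), (n : ℝ) ≤ C * (Real.log (M / m) + 1) ∧
      (∀ i, g (ρ i) = 0) ∧
      (∀ i z, ‖z - c‖ ≤ 8 / 5 → ‖g z‖ ≤ C * M * ‖z - ρ i‖) ∧
      (∀ z, ‖z - c‖ ≤ 8 / 5 → DifferentiableAt ℂ h z ∧ ‖h z‖ ≤ C * (Real.log (M / m) + 1) ∧
        ‖deriv h z‖ ≤ C * (Real.log (M / m) + 1)) ∧
      ∀ z, ‖z - c‖ ≤ 8 / 5 → g z ≠ 0 → logDeriv g z = ∑ i, 1 / (z - ρ i) + h z := by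
  obtain ⟨C₁, hC₁, hlog⟩ := exists_logDeriv_bound (r1 := 8 / 5) (r' := 33 / 20) (r := 17 / 10)
    (by norm_num) (by norm_num) (by norm_num)
  set b : ℝ := Real.log (18 / 17) with hb
  have hbpos : 0 < b := Real.log_pos (by norm_num)
  refine ⟨C₁ + 1 / b * 16 + 10, by positivity, ?_⟩
  intro g c m M hg hM hm hmc
  have hmM : m ≤ M := hmc.trans (hM c (by rw [sub_self, norm_zero]; norm_num))
  have hMpos : 0 < M := hm.trans_le hmM
  have hlogn : 0 ≤ Real.log (M / m) := Real.log_nonneg ((one_le_div hm).2 hmM)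
  set g0 : ℂ → ℂ := fun z => g (c + z) with hg0
  have hg0d : Differentiable ℂ g0 := by
    exact hg.comp (by fun_prop)
  have hM0 : ∀ z, ‖z‖ ≤ 9 / 5 → ‖g0 z‖ ≤ M := fun z hz => hM _ (by simpa using hz)
  have h00 : m ≤ ‖g0 0‖ := by simpa [hg0] using hmc
  obtain ⟨N, hN⟩ := pow_unbounded_of_one_lt (M / m) (y := (9 / 5 : ℝ) / (17 / 10)) (by norm_num)
  obtain ⟨n, ρ, h, a1, a2, a3, a4, a5, a6, a7⟩ :=
    exists_blaschke_factorization (R := 9 / 5) (r := 17 / 10) (m := m) (M := M) (by norm_num)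
      (by norm_num) hm N g0 hg0d (fun z hz => hM0 z hz.le) 0 (by simpa using h00)
      (by rw [zero_add, mul_comm]; exact (div_lt_iff₀ hm).1 hN)
  have hn : (n : ℝ) ≤ 1 / b * Real.log (M / m) := by
    have h1 : ((18 : ℝ) / 17) ^ n ≤ M / m := by
      rw [le_div_iff₀ hm, mul_comm]
      have e : ((9 / 5 : ℝ) / (17 / 10)) = 18 / 17 := by norm_num
      rw [e, zero_add] at a1
      exact a1
    have h2 := Real.log_le_log (by positivity) h1
    rw [Real.log_pow] at h2
    rw [one_div, inv_mul_eq_div, le_div_iff₀ hbpos]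
    exact h2
  obtain ⟨b1, b2⟩ := hlog h m M a2 a3
    (fun z hz => norm_le_of_sphere a2 (by norm_num) a4 (hz.trans (by norm_num))) hm a5
  have hden : ∀ i z, ‖z‖ ≤ 17 / 10 → (1 / 3 : ℝ) ≤ ‖((9 / 5 : ℝ) : ℂ) ^ 2 - conj (ρ i) * z‖ := by
    intro i z hz
    refine le_trans (by norm_num) (sq_sub_le_norm_sq_sub_conj_mul (a6 i).1 hz)
  have hden' : ∀ i z, ‖z‖ ≤ 8 / 5 → (13 / 25 : ℝ) ≤ ‖((9 / 5 : ℝ) : ℂ) ^ 2 - conj (ρ i) * z‖ := by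
    intro i z hz
    refine le_trans (by norm_num) (sq_sub_le_norm_sq_sub_conj_mul (a6 i).1 hz)
  have hne : ∀ i z, ‖z‖ ≤ 17 / 10 → ((9 / 5 : ℝ) : ℂ) ^ 2 - conj (ρ i) * z ≠ 0 := by
    intro i z hz
    rw [← norm_pos_iff]
    linarith [hden i z hz]
  set e : Fin n → ℂ → ℂ := fun i z => conj (ρ i) / (((9 / 5 : ℝ) : ℂ) ^ 2 - conj (ρ i) * z) with he
  have hed : ∀ i z, ‖z‖ ≤ 17 / 10 → HasDerivAt (e i)
      (conj (ρ i) ^ 2 / (((9 / 5 : ℝ) : ℂ) ^ 2 - conj (ρ i) * z) ^ 2) z := by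
    intro i z hz
    have d2 : HasDerivAt (fun z : ℂ => ((9 / 5 : ℝ) : ℂ) ^ 2 - conj (ρ i) * z)
      (-(conj (ρ i) * 1)) z := ((hasDerivAt_id z).const_mul _).const_sub _
    refine ((hasDerivAt_const z (conj (ρ i))).div d2 (hne i z hz)).congr_deriv ?_
    ring
  have hρc : ∀ i, ‖conj (ρ i)‖ ≤ 17 / 10 := fun i => by rw [RCLike.norm_conj]; exact (a6 i).1
  have he1 : ∀ i z, ‖z‖ ≤ 8 / 5 → ‖conj (ρ i) / (((9 / 5 : ℝ) : ℂ) ^ 2 - conj (ρ i) * z)‖ ≤ 4 := by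
    intro i z hz
    have h1 := hden' i z hz
    rw [norm_div, div_le_iff₀ (by linarith)]
    linarith [hρc i]
  set H : ℂ → ℂ := fun z => logDeriv h z + ∑ i, e i z with hH
  have hHd : ∀ z, ‖z‖ ≤ 8 / 5 → HasDerivAt H (deriv (logDeriv h) z +
      ∑ i, conj (ρ i) ^ 2 / (((9 / 5 : ℝ) : ℂ) ^ 2 - conj (ρ i) * z) ^ 2) z := by
    intro z hz
    refine HasDerivAt.add ?_ ?_
    · refine (b1.differentiableAt (isOpen_ball.mem_nhds ?_)).hasDerivAt
      rw [mem_ball_zero_iff]; linarith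
    · exact HasDerivAt.fun_sum fun i _ => hed i z (by linarith)
  have hcard : ∀ (w : Fin n → ℂ) (B : ℝ), (∀ i, ‖w i‖ ≤ B) → ‖∑ i, w i‖ ≤ n * B := by
    intro w B hw
    refine (norm_sum_le_of_le _ (fun i _ => hw i)).trans ?_
    simp
  have hH1 : ∀ z, ‖z‖ ≤ 8 / 5 → DifferentiableAt ℂ H z ∧
      ‖H z‖ ≤ (C₁ + 1 / b * 16 + 10) * (Real.log (M / m) + 1) ∧
        ‖deriv H z‖ ≤ (C₁ + 1 / b * 16 + 10) * (Real.log (M / m) + 1) := by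
    intro z hz
    have hb' : 0 < 1 / b := by positivity
    have t : C₁ * (Real.log (M / m) + 1) + n * 16 ≤
        (C₁ + 1 / b * 16 + 10) * (Real.log (M / m) + 1) := by nlinarith
    refine ⟨(hHd z hz).differentiableAt, ?_, ?_⟩
    · refine le_trans ?_ t
      refine (norm_add_le _ _).trans (add_le_add (b2 z hz).1 ?_)
      exact hcard _ _ fun i => (he1 i z hz).trans (by norm_num)
    · rw [(hHd z hz).deriv]
      refine le_trans ?_ t
      refine (norm_add_le _ _).trans (add_le_add (b2 z hz).2 ?_)
      refine hcard _ _ fun i => ?_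
      rw [← div_pow, norm_pow]
      have := he1 i z hz
      have h0 := norm_nonneg (conj (ρ i) / (((9 / 5 : ℝ) : ℂ) ^ 2 - conj (ρ i) * z))
      nlinarith
  have hlogD : ∀ z, ‖z‖ ≤ 8 / 5 → g0 z ≠ 0 → logDeriv g0 z = ∑ i, 1 / (z - ρ i) + H z := by
    intro z hz hgz
    have hev : g0 =ᶠ[nhds z] fun z => h z * ∏ i, blaschke (9 / 5) (ρ i) z := by
      have : ball (0 : ℂ) (9 / 5) ∈ nhds z := isOpen_ball.mem_nhds (by
        rw [mem_ball_zero_iff]; linarith)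
      filter_upwards [this] with w hw
      rw [mem_ball_zero_iff] at hw
      exact a7 w hw.le
    have hzρ : ∀ i, z ≠ ρ i := by
      rintro i rfl
      exact hgz (a6 i).2
    have hbl := fun i => logDeriv_blaschke (R := 9 / 5) (by norm_num) (hzρ i) (hne i z (by linarith))
    have e1 : logDeriv g0 z = logDeriv (fun z => h z * ∏ i, blaschke (9 / 5) (ρ i) z) z := by
      rw [logDeriv_apply, logDeriv_apply, hev.deriv_eq, hev.self_of_nhds]
    rw [e1, logDeriv_mul z (a3 z (by linarith)) (Finset.prod_ne_zero_iff.2 fun i _ => (hbl i).2.1)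
      (a2 z) (DifferentiableAt.fun_finsetProd fun i _ => (hbl i).1), logDeriv_prod]
    · rw [Finset.sum_congr rfl fun i _ => (hbl i).2.2, Finset.sum_add_distrib, hH]
      simp only [he]
      ring
    · intro i _; exact (hbl i).2.1
    · intro i _; exact (hbl i).1
  have hb' : 0 < 1 / b := by positivity
  refine ⟨n, fun i => c + ρ i, fun z => H (z - c), ?_, fun i => (a6 i).2, ?_, ?_, ?_⟩
  · nlinarith
  · intro i z hz
    have := norm_le_mul_sub_of_zero hg0d (R := 9 / 5) (r := 17 / 10) (by norm_num) (by norm_num) hM0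
      (z := z - c) (a6 i).1 (a6 i).2 (by linarith)
    simp only [hg0, add_sub_cancel] at this
    rw [sub_sub] at this
    refine this.trans ?_
    refine mul_le_mul_of_nonneg_right ?_ (norm_nonneg _)
    have h1 : 0 ≤ (C₁ + 1 / b * 16) * M := by positivity
    have h2 : M / (9 / 5 - 17 / 10) = 10 * M := by ring
    rw [h2]
    linarith
  · intro z hz
    obtain ⟨t1, t2, t3⟩ := hH1 (z - c) hz
    refine ⟨?_, t2, ?_⟩
    · exact DifferentiableAt.comp z (f := fun z => z - c) t1 (by fun_prop)
    · rwa [deriv_comp_sub_const]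
  · intro z hz hgz
    have hgz' : g0 (z - c) ≠ 0 := by simpa [hg0] using hgz
    have := hlogD (z - c) hz hgz'
    rw [logDeriv_apply] at this
    simp only [hg0, deriv_comp_const_add, add_sub_cancel] at this
    rw [logDeriv_apply, this]
    simp only [sub_sub]

end LocalLemma

section Tauberian
open MeasureTheory

/-- Shifting the contour of an integral along vertical lines. -/
theorem integral_vertical_eq {f : ℂ → ℂ} {σ₁ σ₂ C : ℝ} (h12 : σ₁ ≤ σ₂)
    (hf : DifferentiableOn ℂ f {s | σ₁ ≤ s.re ∧ s.re ≤ σ₂})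
    (hb : ∀ s : ℂ, σ₁ ≤ s.re → s.re ≤ σ₂ → ‖f s‖ ≤ C * (1 + s.im ^ 2)⁻¹) :
    (∫ y : ℝ, f (σ₁ + y * I)) = ∫ y : ℝ, f (σ₂ + y * I) := by
  have hint : ∀ σ, σ₁ ≤ σ → σ ≤ σ₂ → Integrable fun y : ℝ => f (σ + y * I) := by
    intro σ h1 h2
    refine Integrable.mono' (integrable_inv_one_add_sq.const_mul C) ?_ ?_
    · refine Continuous.aestronglyMeasurable ?_
      rw [← continuousOn_univ]
      refine hf.continuousOn.comp (by fun_prop) fun y _ => ?_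
      simp [h1, h2]
    · refine ae_of_all _ fun y => ?_
      simpa using hb (σ + y * I) (by simpa using h1) (by simpa using h2)
  have hrect : ∀ T : ℝ, 0 < T → (∫ x in σ₁..σ₂, f (x + (-T : ℝ) * I)) - (∫ x in σ₁..σ₂, f (x + T * I)) +
      I * (∫ y in (-T)..T, f (σ₂ + y * I)) - I * ∫ y in (-T)..T, f (σ₁ + y * I) = 0 := by
    intro T hT
    have := Complex.integral_boundary_rect_eq_zero_of_differentiableOn f (σ₁ + (-T : ℝ) * I)
      (σ₂ + T * I) (hf.mono ?_)
    · simpa using this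
    · intro s hs
      have h1 := hs.1
      simp [Set.uIcc_of_le h12] at h1
      exact h1
  have hT : Tendsto (fun T : ℝ => -T) atTop atBot := tendsto_neg_atTop_atBot
  have l1 := intervalIntegral_tendsto_integral (hint σ₁ le_rfl h12) hT tendsto_id
  have l2 := intervalIntegral_tendsto_integral (hint σ₂ h12 le_rfl) hT tendsto_id
  have hz : Tendsto (fun T : ℝ => C * (1 + T ^ 2)⁻¹ * |σ₂ - σ₁|) atTop (nhds 0) := by
    have : Tendsto (fun T : ℝ => (1 + T ^ 2)⁻¹) atTop (nhds 0) := by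
      refine tendsto_inv_atTop_zero.comp (tendsto_atTop_add_const_left _ _ (tendsto_pow_atTop two_ne_zero))
    simpa using (this.const_mul C).mul_const |σ₂ - σ₁|
  have hhor : ∀ T : ℝ, ‖∫ x in σ₁..σ₂, f (x + T * I)‖ ≤ C * (1 + T ^ 2)⁻¹ * |σ₂ - σ₁| := by
    intro T
    refine intervalIntegral.norm_integral_le_of_norm_le_const fun x hx => ?_
    rw [Set.uIoc_of_le h12] at hx
    simpa using hb (x + T * I) (by simpa using hx.1.le) (by simpa using hx.2)
  have z1 : Tendsto (fun T : ℝ => ∫ x in σ₁..σ₂, f (x + T * I)) atTop (nhds 0) :=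
    squeeze_zero_norm hhor hz
  have z2 : Tendsto (fun T : ℝ => ∫ x in σ₁..σ₂, f (x + (-T : ℝ) * I)) atTop (nhds 0) :=
    squeeze_zero_norm (fun T => by simpa using hhor (-T)) hz
  have lim := ((z2.sub z1).add (l2.const_mul I)).sub (l1.const_mul I)
  have hev : (fun T : ℝ => (∫ x in σ₁..σ₂, f (x + (-T : ℝ) * I)) - (∫ x in σ₁..σ₂, f (x + T * I)) +
      I * (∫ y in (-T)..(id T), f (σ₂ + y * I)) - I * ∫ y in (-T)..(id T), f (σ₁ + y * I))
      =ᶠ[atTop] fun _ => 0 := by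
    filter_upwards [eventually_gt_atTop 0] with T hT
    exact hrect T hT
  have := tendsto_nhds_unique (lim.congr' hev) tendsto_const_nhds
  have h3 : I * ((∫ y : ℝ, f (σ₂ + y * I)) - ∫ y : ℝ, f (σ₁ + y * I)) = 0 := by
    rw [← this]; ring
  rcases mul_eq_zero.1 h3 with h | h
  · exact absurd h I_ne_zero
  · exact (sub_eq_zero.1 h).symm

/-- A Gaussian dominates any polynomial. -/
theorem exists_pow_mul_gaussian_le (k : ℕ) (t : ℝ) :
    ∃ C : ℝ, 0 < C ∧ ∀ y : ℝ, (1 + |y|) ^ k * Real.exp (-(t - y) ^ 2 / 2) ≤ C * (1 + y ^ 2)⁻¹ := by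
  refine ⟨(k + 2).factorial * Real.exp (2 + t ^ 2 / 2), by positivity, fun y => ?_⟩
  have h1 := Real.pow_div_factorial_le_exp (1 + |y|) (by positivity) (k + 2)
  rw [div_le_iff₀ (by positivity)] at h1
  have h2 : 1 + y ^ 2 ≤ (1 + |y|) ^ 2 := by
    nlinarith [abs_nonneg y, sq_abs y]
  rw [← div_eq_mul_inv, le_div_iff₀ (by positivity)]
  have h3 : -(t - y) ^ 2 / 2 + (1 + |y|) ≤ 2 + t ^ 2 / 2 := by
    nlinarith [sq_nonneg (2 * t - y), sq_nonneg (|y| - 2), sq_abs y]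
  calc (1 + |y|) ^ k * Real.exp (-(t - y) ^ 2 / 2) * (1 + y ^ 2)
      ≤ (1 + |y|) ^ k * Real.exp (-(t - y) ^ 2 / 2) * (1 + |y|) ^ 2 := by gcongr
    _ = Real.exp (-(t - y) ^ 2 / 2) * (1 + |y|) ^ (k + 2) := by ring
    _ ≤ Real.exp (-(t - y) ^ 2 / 2) * (Real.exp (1 + |y|) * (k + 2).factorial) := by gcongr
    _ = (k + 2).factorial * Real.exp (-(t - y) ^ 2 / 2 + (1 + |y|)) := by rw [Real.exp_add (-(t - y) ^ 2 / 2)]; ring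
    _ ≤ _ := by gcongr

/-- The Laplace transform of the Gaussian window centred at `U`. -/
def gaussLaplace (U : ℝ) (z : ℂ) : ℂ := (2 * Real.pi : ℝ) ^ (1 / 2 : ℂ) * cexp (-z * U + z ^ 2 / 2)

theorem integral_gaussLaplace (U u : ℝ) (z : ℂ) :
    ∫ y : ℝ, gaussLaplace U (z - y * I) * cexp (-(y * I) * u) =
      (2 * Real.pi) * cexp (-(u - U) ^ 2 / 2 - z * u) := by
  have h := integral_cexp_quadratic (b := -(1 / 2)) (by norm_num) ((U - z - u) * I)
    (-z * U + z ^ 2 / 2)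
  have e : ∀ y : ℝ, gaussLaplace U (z - y * I) * cexp (-(y * I) * u) =
      (2 * Real.pi : ℝ) ^ (1 / 2 : ℂ) *
        cexp (-(1 / 2) * y ^ 2 + (U - z - u) * I * y + (-z * U + z ^ 2 / 2)) := by
    intro y
    rw [gaussLaplace, mul_assoc, ← Complex.exp_add]
    congr 2
    linear_combination ((y : ℂ) ^ 2 / 2) * I_sq
  simp_rw [e]
  rw [integral_const_mul, h, ← mul_assoc]
  congr 1
  · rw [show (Real.pi : ℂ) / - -(1 / 2) = ((2 * Real.pi : ℝ) : ℂ) by push_cast; ring, ← Complex.cpow_add _ _ (by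
      exact_mod_cast (by positivity : (2 * Real.pi) ≠ 0))]
    norm_num
  · congr 1
    linear_combination ((U - z - u) ^ 2 / 2) * I_sq

theorem norm_gaussLaplace (U : ℝ) (z : ℂ) : ‖gaussLaplace U z‖ =
    (2 * Real.pi) ^ (1 / 2 : ℝ) * Real.exp (-z.re * U + z.re ^ 2 / 2) * Real.exp (-z.im ^ 2 / 2) := by
  rw [gaussLaplace, norm_mul, mul_assoc, ← Real.exp_add, Complex.norm_exp]
  congr 1
  · have := Complex.norm_cpow_eq_rpow_re_of_pos (x := 2 * Real.pi) (by positivity) (1 / 2)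
    rw [this]; norm_num
  · congr 1
    simp [sq]
    ring

end Tauberian

section Tauberian
open MeasureTheory
open scoped ENNReal

theorem lintegral_mul_sq_le {α : Type*} [MeasurableSpace α] {μ : Measure α} {f g : α → ℝ≥0∞}
    (hf : AEMeasurable f μ) (hg : AEMeasurable g μ) :
    (∫⁻ x, f x * g x ∂μ) ^ 2 ≤ (∫⁻ x, f x ^ 2 ∂μ) * ∫⁻ x, g x ^ 2 ∂μ := by
  have h := ENNReal.lintegral_mul_le_Lp_mul_Lq μ Real.HolderConjugate.two_two hf hg
  simp only [Pi.mul_apply, ENNReal.rpow_ofNat] at h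
  calc (∫⁻ x, f x * g x ∂μ) ^ 2
      ≤ ((∫⁻ x, f x ^ 2 ∂μ) ^ (1 / 2 : ℝ) * (∫⁻ x, g x ^ 2 ∂μ) ^ (1 / 2 : ℝ)) ^ 2 := by gcongr
    _ = _ := by
      rw [mul_pow, ← ENNReal.rpow_natCast, ← ENNReal.rpow_natCast, ← ENNReal.rpow_mul,
        ← ENNReal.rpow_mul]
      norm_num

theorem lintegral_gaussian_ne_top {b : ℝ} (hb : 0 < b) :
    ∫⁻ z : ℝ, ENNReal.ofReal (Real.exp (-b * z ^ 2)) ≠ ⊤ :=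
  (integrable_exp_neg_mul_sq hb).lintegral_lt_top.ne

theorem exp_neg_sq_le_lintegral (x : ℝ) : ENNReal.ofReal (Real.exp (-x ^ 2 / 2)) ≤
    ∫⁻ z : ℝ, 2 * ((Set.Icc (x - 1 / 2) (x + 1 / 2)).indicator 1 z *
      ENNReal.ofReal (Real.exp (-(1 / 4) * z ^ 2))) := by
  have h1 : ∫⁻ z : ℝ in Set.Icc (x - 1 / 2) (x + 1 / 2), ENNReal.ofReal (Real.exp (-x ^ 2 / 2)) =
      ENNReal.ofReal (Real.exp (-x ^ 2 / 2)) := by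
    rw [setLIntegral_const, Real.volume_Icc]
    norm_num
  rw [← h1, ← lintegral_indicator measurableSet_Icc]
  refine lintegral_mono fun z => ?_
  by_cases hz : z ∈ Set.Icc (x - 1 / 2) (x + 1 / 2)
  · rw [Set.indicator_of_mem hz, Set.indicator_of_mem hz, Pi.one_apply, one_mul,
      ← ENNReal.ofReal_ofNat 2, ← ENNReal.ofReal_mul (by norm_num)]
    refine ENNReal.ofReal_le_ofReal ?_
    have h2 : (2 : ℝ) ≥ Real.exp (1 / 8) := by
      have h3 : Real.exp (1 / 8) ≤ Real.exp (1 / 2) := Real.exp_le_exp.2 (by norm_num)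
      have h4 : Real.exp (1 / 2) ^ 2 = Real.exp 1 := by
        rw [← Real.exp_nat_mul]; norm_num
      nlinarith [Real.exp_one_lt_d9, Real.exp_pos (1 / 2)]
    calc Real.exp (-x ^ 2 / 2) ≤ Real.exp (1 / 8 + -(1 / 4) * z ^ 2) := by
          refine Real.exp_le_exp.2 ?_
          have h5 : |z - x| ≤ 1 / 2 := abs_le.2 ⟨by linarith [hz.1], by linarith [hz.2]⟩
          have h6 : (z - x) ^ 2 ≤ 1 / 4 := by
            rw [← sq_abs]; nlinarith [abs_nonneg (z - x)]
          nlinarith [sq_nonneg (x - (z - x))]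
      _ = Real.exp (1 / 8) * Real.exp (-(1 / 4) * z ^ 2) := Real.exp_add _ _
      _ ≤ _ := by gcongr
  · rw [Set.indicator_of_notMem hz]; exact zero_le

/-- Convolution with a Gaussian, measured in `L²`, is controlled by unit-scale averages. -/
theorem lintegral_gaussian_conv_sq_le {g : ℝ → ℝ≥0∞} (hg : Measurable g) :
    ∫⁻ t : ℝ, (∫⁻ y, ENNReal.ofReal (Real.exp (-(t - y) ^ 2 / 2)) * g y) ^ 2 ≤
      4 * (∫⁻ z : ℝ, ENNReal.ofReal (Real.exp (-(1 / 4) * z ^ 2))) ^ 2 *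
      ∫⁻ τ, (∫⁻ y in Set.Icc (τ - 1 / 2) (τ + 1 / 2), g y) ^ 2 := by
  set w : ℝ → ℝ≥0∞ := fun z => ENNReal.ofReal (Real.exp (-(1 / 4) * z ^ 2)) with hw
  set v : ℝ → ℝ≥0∞ := fun z => ENNReal.ofReal (Real.exp (-(1 / 8) * z ^ 2)) with hv
  have hwv : ∀ z, v z ^ 2 = w z := by
    intro z
    rw [hw, hv]
    simp only
    rw [← ENNReal.ofReal_pow (Real.exp_pos _).le, ← Real.exp_nat_mul]
    congr 2; push_cast; ring
  have hwm : Measurable w := by fun_prop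
  have hvm : Measurable v := by fun_prop
  set D : ℝ → ℝ≥0∞ := fun τ => ∫⁻ y in Set.Icc (τ - 1 / 2) (τ + 1 / 2), g y with hD
  have hind : Measurable fun p : ℝ × ℝ =>
      (Set.Icc (p.1 - 1 / 2) (p.1 + 1 / 2)).indicator (1 : ℝ → ℝ≥0∞) p.2 := by
    have : MeasurableSet ({p : ℝ × ℝ | p.1 - 1 / 2 ≤ p.2} ∩ {p : ℝ × ℝ | p.2 ≤ p.1 + 1 / 2}) :=
      (measurableSet_le (by fun_prop) (by fun_prop)).inter
        (measurableSet_le (by fun_prop) (by fun_prop))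
    exact Measurable.indicator (f := (1 : ℝ × ℝ → ℝ≥0∞)) measurable_one this
  have hD' : ∀ τ, D τ = ∫⁻ y, (Set.Icc (τ - 1 / 2) (τ + 1 / 2)).indicator 1 y * g y := by
    intro τ
    rw [hD]
    simp only
    rw [← lintegral_indicator measurableSet_Icc]
    refine lintegral_congr fun y => ?_
    by_cases hy : y ∈ Set.Icc (τ - 1 / 2) (τ + 1 / 2)
    · rw [Set.indicator_of_mem hy, Set.indicator_of_mem hy]; simp
    · rw [Set.indicator_of_notMem hy, Set.indicator_of_notMem hy]; simp
  have hDm : Measurable D := by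
    have : D = fun τ => ∫⁻ y, (Set.Icc (τ - 1 / 2) (τ + 1 / 2)).indicator 1 y * g y := funext hD'
    rw [this]
    exact Measurable.lintegral_prod_right' (f := fun p : ℝ × ℝ =>
      (Set.Icc (p.1 - 1 / 2) (p.1 + 1 / 2)).indicator (1 : ℝ → ℝ≥0∞) p.2 * g p.2)
      (hind.mul (hg.comp measurable_snd))
  have h1 : ∀ t : ℝ, ∫⁻ y, ENNReal.ofReal (Real.exp (-(t - y) ^ 2 / 2)) * g y ≤
      2 * ∫⁻ z, w z * D (t - z) := by
    intro t
    calc ∫⁻ y, ENNReal.ofReal (Real.exp (-(t - y) ^ 2 / 2)) * g y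
        ≤ ∫⁻ y, (∫⁻ z : ℝ, 2 * ((Set.Icc (t - y - 1 / 2) (t - y + 1 / 2)).indicator 1 z *
            w z)) * g y := by
          refine lintegral_mono fun y => ?_
          exact mul_le_mul_left (exp_neg_sq_le_lintegral (t - y)) _
      _ = ∫⁻ y, ∫⁻ z : ℝ, 2 * ((Set.Icc (t - y - 1 / 2) (t - y + 1 / 2)).indicator 1 z *
            w z) * g y := by
          refine lintegral_congr fun y => ?_
          rw [lintegral_mul_const]
          refine ((Measurable.indicator measurable_one measurableSet_Icc).mul hwm).const_mul 2
      _ = ∫⁻ z, ∫⁻ y : ℝ, 2 * ((Set.Icc (t - y - 1 / 2) (t - y + 1 / 2)).indicator 1 z *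
            w z) * g y := by
          refine lintegral_lintegral_swap (Measurable.aemeasurable ?_)
          have := hind.comp (f := fun p : ℝ × ℝ => (t - p.1, p.2)) (by fun_prop)
          exact ((this.mul (hwm.comp measurable_snd)).const_mul 2).mul (hg.comp measurable_fst)
      _ = ∫⁻ z, 2 * (w z * D (t - z)) := by
          refine lintegral_congr fun z => ?_
          rw [hD', ← lintegral_const_mul, ← lintegral_const_mul]
          · refine lintegral_congr fun y => ?_
            have : (Set.Icc (t - y - 1 / 2) (t - y + 1 / 2)).indicator (1 : ℝ → ℝ≥0∞) z =
                (Set.Icc (t - z - 1 / 2) (t - z + 1 / 2)).indicator 1 y := by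
              simp only [Set.indicator_apply, Set.mem_Icc]
              refine if_congr ⟨fun h => ⟨?_, ?_⟩, fun h => ⟨?_, ?_⟩⟩ rfl rfl <;> linarith [h.1, h.2]
            rw [this]; ring
          · exact (((Measurable.indicator measurable_one measurableSet_Icc).mul hg).const_mul _)
          · exact (((Measurable.indicator measurable_one measurableSet_Icc).mul hg))
      _ = _ := by
          rw [lintegral_const_mul]
          exact hwm.mul (hDm.comp (by fun_prop))
  have h2 : ∀ t : ℝ, (∫⁻ z, w z * D (t - z)) ^ 2 ≤ (∫⁻ z, w z) * ∫⁻ z, w z * D (t - z) ^ 2 := by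
    intro t
    have := lintegral_mul_sq_le (μ := volume) hvm.aemeasurable
      ((hvm.mul (hDm.comp (f := fun z => t - z) (by fun_prop))).aemeasurable)
    simp only [Pi.mul_apply, Function.comp, mul_pow, ← mul_assoc, ← sq, hwv] at this
    exact this
  calc ∫⁻ t : ℝ, (∫⁻ y, ENNReal.ofReal (Real.exp (-(t - y) ^ 2 / 2)) * g y) ^ 2
      ≤ ∫⁻ t : ℝ, 4 * ((∫⁻ z, w z) * ∫⁻ z, w z * D (t - z) ^ 2) := by
        refine lintegral_mono fun t => ?_
        calc _ ≤ (2 * ∫⁻ z, w z * D (t - z)) ^ 2 := by gcongr; exact h1 t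
          _ = 4 * (∫⁻ z, w z * D (t - z)) ^ 2 := by rw [mul_pow]; norm_num
          _ ≤ _ := by gcongr; exact h2 t
    _ = 4 * ((∫⁻ z, w z) * ∫⁻ t : ℝ, ∫⁻ z, w z * D (t - z) ^ 2) := by
        have hm : Measurable fun t : ℝ => ∫⁻ z, w z * D (t - z) ^ 2 := by
          refine Measurable.lintegral_prod_right' (f := fun p : ℝ × ℝ => w p.2 * D (p.1 - p.2) ^ 2) ?_
          exact (hwm.comp measurable_snd).mul
            ((hDm.comp (f := fun p : ℝ × ℝ => p.1 - p.2) (by fun_prop)).pow_const 2)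
        rw [lintegral_const_mul _ (hm.const_mul _), lintegral_const_mul _ hm]
    _ = 4 * ((∫⁻ z, w z) * ∫⁻ z, w z * ∫⁻ t : ℝ, D t ^ 2) := by
        rw [lintegral_lintegral_swap]
        · congr 2
          refine lintegral_congr fun z => ?_
          rw [lintegral_const_mul]
          · rw [lintegral_sub_right_eq_self (fun t => D t ^ 2)]
          · exact (hDm.comp (f := fun t => t - z) (by fun_prop)).pow_const 2
        · exact ((hwm.comp measurable_snd).mul
            ((hDm.comp (f := fun p : ℝ × ℝ => p.1 - p.2) (by fun_prop)).pow_const 2)).aemeasurable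
    _ = _ := by
        rw [lintegral_mul_const _ hwm]; ring

end Tauberian

section Tauberian
open MeasureTheory
open scoped ENNReal

theorem continuous_gaussLaplace (U : ℝ) : Continuous (gaussLaplace U) := by
  unfold gaussLaplace; fun_prop

theorem integral_gaussLaplace_mul {b : ℝ → ℂ} (hb : Integrable fun u : ℝ => b u * cexp (-2 * u))
    {H : ℂ → ℂ} (hH : ∀ y : ℝ, H ((2 : ℝ) + y * I) = ∫ u : ℝ, b u * cexp (-((2 : ℝ) + y * I) * u))
    (U : ℝ) (s : ℂ) :
    ∫ y : ℝ, gaussLaplace U (s - ((2 : ℝ) + y * I)) * H ((2 : ℝ) + y * I) =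
      (2 * Real.pi) * ∫ u : ℝ, b u * cexp (-(u - U) ^ 2 / 2 - s * u) := by
  have hgl : Integrable fun y : ℝ => gaussLaplace U (s - 2 - y * I) := by
    obtain ⟨C, hC, h⟩ := exists_pow_mul_gaussian_le 0 s.im
    refine Integrable.mono' ((integrable_inv_one_add_sq.const_mul C).const_mul
      ((2 * Real.pi) ^ (1 / 2 : ℝ) * Real.exp (-(s.re - 2) * U + (s.re - 2) ^ 2 / 2)))
      ((continuous_gaussLaplace U).comp (by fun_prop)).aestronglyMeasurable ?_
    refine ae_of_all _ fun y => ?_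
    rw [norm_gaussLaplace]
    simp only [sub_re, sub_im, mul_re, mul_im, I_re, I_im, ofReal_re, ofReal_im, re_ofNat,
      im_ofNat, mul_zero, mul_one, sub_zero, add_zero]
    have := h y
    rw [pow_zero, one_mul] at this
    gcongr
  have e1 : ∀ y : ℝ, gaussLaplace U (s - ((2 : ℝ) + y * I)) * H ((2 : ℝ) + y * I) =
      ∫ u : ℝ, gaussLaplace U (s - 2 - y * I) * (b u * cexp (-2 * u)) * cexp (-(y * I) * u) := by
    intro y
    rw [hH, ← integral_const_mul]
    refine integral_congr_ae (ae_of_all _ fun u => ?_)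
    have : cexp (-((2 : ℝ) + y * I) * u) = cexp (-2 * u) * cexp (-(y * I) * u) := by
      rw [← Complex.exp_add]; congr 1; push_cast; ring
    simp only [this]
    push_cast
    rw [sub_sub]; ring
  simp_rw [e1]
  rw [integral_integral_swap, ← integral_const_mul]
  · refine integral_congr_ae (ae_of_all _ fun u => ?_)
    have e2 : ∀ y : ℝ, gaussLaplace U (s - 2 - y * I) * (b u * cexp (-2 * u)) * cexp (-(y * I) * u)
        = (b u * cexp (-2 * u)) * (gaussLaplace U (s - 2 - y * I) * cexp (-(y * I) * u)) := by
      intro y; ring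
    simp only [e2]
    rw [integral_const_mul, integral_gaussLaplace]
    have e3 : cexp (-(u - U) ^ 2 / 2 - s * u) =
      cexp (-2 * u) * cexp (-(u - U) ^ 2 / 2 - (s - 2) * u) := by
      rw [← Complex.exp_add]; congr 1; ring
    rw [e3]; ring
  · have := hgl.mul_prod hb
    refine (this.bdd_mul (f := fun p : ℝ × ℝ => cexp (-(p.1 * I) * p.2)) (c := 1) ?_ ?_).congr ?_
    · exact Continuous.aestronglyMeasurable (by fun_prop)
    · refine ae_of_all _ fun p => ?_
      rw [Complex.norm_exp]; simp
    · refine ae_of_all _ fun p => ?_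
      simp only [Function.uncurry]; ring

/-- An `L²` Tauberian estimate: the size of `a` near `U` is controlled by the Laplace transform of
`u² a(u)` at distance `1 / U` from the critical line. -/
theorem exists_tauberian : ∃ K : ℝ≥0∞, K ≠ ⊤ ∧ ∀ (a : ℝ → ℂ) (H : ℂ → ℂ) (C₀ : ℝ), Measurable a →
    (∀ u, ‖a u‖ ≤ C₀ * Real.exp u) → (∀ u < 0, a u = 0) →
    DifferentiableOn ℂ H {s | 1 / 2 < s.re} →
    (∀ s : ℂ, 1 < s.re → H s = ∫ u : ℝ, (u ^ 2 * a u) * cexp (-s * u)) →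
    (∀ σ : ℝ, 1 / 2 < σ → ∃ (C : ℝ) (k : ℕ), ∀ s : ℂ, σ ≤ s.re → s.re ≤ 2 →
      ‖H s‖ ≤ C * (1 + |s.im|) ^ k) →
    ∀ U : ℝ, 2 ≤ U → ∫⁻ u in Set.Icc U (U + 1), ENNReal.ofReal (U ^ 4) *
        (ENNReal.ofReal (Real.exp (-u)) * ‖a u‖ₑ ^ 2) ≤
      K * ∫⁻ τ : ℝ, (∫⁻ y in Set.Icc (τ - 1 / 2) (τ + 1 / 2),
        ‖H ((1 / 2 + 1 / U : ℝ) + y * I)‖ₑ) ^ 2 := by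
  refine ⟨ENNReal.ofReal (Real.exp 5) *
    (4 * (∫⁻ z : ℝ, ENNReal.ofReal (Real.exp (-(1 / 4) * z ^ 2))) ^ 2), ?_, ?_⟩
  · exact ENNReal.mul_ne_top ENNReal.ofReal_ne_top
      (ENNReal.mul_ne_top (by norm_num) (ENNReal.pow_ne_top (lintegral_gaussian_ne_top (by norm_num))))
  intro a H C₀ ham hab ha0 hHd hHe hgrow U hU
  set σ : ℝ := 1 / 2 + 1 / U with hσ
  have hUpos : 0 < U := by linarith
  have hσ1 : 1 / 2 < σ := by rw [hσ]; linarith [one_div_pos.2 hUpos]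
  have hσ2 : σ ≤ 1 := by
    have : 1 / U ≤ 1 / 2 := one_div_le_one_div_of_le (by norm_num) hU
    rw [hσ]; linarith
  have hC₀ : 0 ≤ C₀ := by
    have := (norm_nonneg _).trans (hab 0)
    simpa using this
  set b : ℝ → ℂ := fun u => u ^ 2 * a u with hb
  have hbm : Measurable b := by rw [hb]; fun_prop
  have hbb : ∀ u, ‖b u‖ ≤ 8 * C₀ * Real.exp (3 / 2 * u) := by
    intro u
    rcases lt_or_ge u 0 with h | h
    · rw [hb]; simp only [ha0 u h, mul_zero, norm_zero]; positivity
    · rw [hb]; simp only [norm_mul, norm_pow, Complex.norm_real, Real.norm_eq_abs, sq_abs]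
      have h1 := Real.pow_div_factorial_le_exp (u / 2) (by positivity) 2
      have h2 : u ^ 2 ≤ 8 * Real.exp (u / 2) := by
        simp only [Nat.factorial] at h1
        push_cast at h1
        linarith
      calc u ^ 2 * ‖a u‖ ≤ 8 * Real.exp (u / 2) * (C₀ * Real.exp u) := by
            gcongr; exact hab u
        _ = 8 * C₀ * (Real.exp (u / 2) * Real.exp u) := by ring
        _ = _ := by rw [← Real.exp_add]; ring_nf
  have hb0 : ∀ u < 0, b u = 0 := fun u hu => by rw [hb]; simp only [ha0 u hu, mul_zero]
  have hbint : Integrable fun u : ℝ => b u * cexp (-2 * u) := by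
    have hi : IntegrableOn (fun u : ℝ => 8 * C₀ * Real.exp (-(1 / 2) * u)) (Set.Ici 0) := by
      rw [integrableOn_Ici_iff_integrableOn_Ioi]
      exact (exp_neg_integrableOn_Ioi 0 (by norm_num)).const_mul _
    refine Integrable.mono' (hi.integrable_indicator measurableSet_Ici)
      (by fun_prop) (ae_of_all _ fun u => ?_)
    rcases lt_or_ge u 0 with h | h
    · rw [hb0 u h, zero_mul, norm_zero, Set.indicator_of_notMem (by simpa using h)]
    · rw [Set.indicator_of_mem (by simpa using h), norm_mul, Complex.norm_exp]
      have : (-2 * (u : ℂ)).re = -2 * u := by simp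
      rw [this]
      calc ‖b u‖ * Real.exp (-2 * u) ≤ 8 * C₀ * Real.exp (3 / 2 * u) * Real.exp (-2 * u) := by
            gcongr; exact hbb u
        _ = _ := by rw [mul_assoc, ← Real.exp_add]; ring_nf
  set f : ℝ → ℂ := fun u => b u * cexp (-(u - U) ^ 2 / 2 - σ * u) with hf
  have hfm : Measurable f := by rw [hf]; fun_prop
  have hfb : ∃ C, ∀ u, ‖f u‖ ≤ C * (1 + u ^ 2)⁻¹ := by
    obtain ⟨C, hC, h⟩ := exists_pow_mul_gaussian_le 0 (U + 3 / 2)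
    refine ⟨8 * C₀ * Real.exp (2 * (U + 3 / 2)^2) * C, fun u => ?_⟩
    rcases lt_or_ge u 0 with h0 | h0
    · rw [hf]; simp only [hb0 u h0, zero_mul, norm_zero]; positivity
    · have e : (-((u : ℂ) - U) ^ 2 / 2 - σ * u).re = -(u - U) ^ 2 / 2 - σ * u := by
        rw [show (-((u : ℂ) - U) ^ 2 / 2 - σ * u) = ((-(u - U) ^ 2 / 2 - σ * u : ℝ) : ℂ) by
          push_cast; ring, ofReal_re]
      have h1 := h u
      rw [pow_zero, one_mul] at h1
      rw [hf]; simp only [norm_mul, Complex.norm_exp, e]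
      calc ‖b u‖ * Real.exp (-(u - U) ^ 2 / 2 - σ * u)
          ≤ 8 * C₀ * Real.exp (3 / 2 * u) * Real.exp (-(u - U) ^ 2 / 2 - σ * u) := by
            gcongr; exact hbb u
        _ = 8 * C₀ * Real.exp (3 / 2 * u + (-(u - U) ^ 2 / 2 - σ * u)) := by
            rw [mul_assoc, ← Real.exp_add]
        _ ≤ 8 * C₀ * Real.exp (2 * (U + 3 / 2) ^ 2 + -((U + 3 / 2) - u) ^ 2 / 2) := by
            refine mul_le_mul_of_nonneg_left (Real.exp_le_exp.2 ?_) (by positivity)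
            nlinarith [mul_nonneg h0 (sub_nonneg.2 hσ1.le), sq_nonneg (U + 3 / 2), sq_nonneg U]
        _ = 8 * C₀ * Real.exp (2 * (U + 3 / 2) ^ 2) * Real.exp (-((U + 3 / 2) - u) ^ 2 / 2) := by
            rw [Real.exp_add]; ring
        _ ≤ 8 * C₀ * Real.exp (2 * (U + 3 / 2) ^ 2) * (C * (1 + u ^ 2)⁻¹) := by gcongr
        _ = _ := by ring
  obtain ⟨Cf, hCf⟩ := hfb
  have hCf0 : 0 ≤ Cf := by simpa using (norm_nonneg _).trans (hCf 0)
  have hf1 : Integrable f :=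
    Integrable.mono' (integrable_inv_one_add_sq.const_mul Cf) hfm.aestronglyMeasurable
      (ae_of_all _ hCf)
  have hf2 : MemLp f 2 := by
    rw [memLp_two_iff_integrable_sq_norm hfm.aestronglyMeasurable]
    refine Integrable.mono' (integrable_inv_one_add_sq.const_mul (Cf ^ 2))
      (by fun_prop) (ae_of_all _ fun u => ?_)
    rw [Real.norm_of_nonneg (by positivity)]
    have h1 : (1 + u ^ 2)⁻¹ ≤ 1 := inv_le_one_of_one_le₀ (by nlinarith)
    calc ‖f u‖ ^ 2 ≤ (Cf * (1 + u ^ 2)⁻¹) ^ 2 := by gcongr; exact hCf u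
      _ = Cf ^ 2 * ((1 + u ^ 2)⁻¹ * (1 + u ^ 2)⁻¹) := by ring
      _ ≤ Cf ^ 2 * ((1 + u ^ 2)⁻¹ * 1) := by gcongr
      _ = _ := by ring
  have hrep : ∀ t : ℝ, ‖∫ u : ℝ, f u * cexp (-(t * u * I))‖ₑ ≤
      ∫⁻ y, ENNReal.ofReal (Real.exp (-(t - y) ^ 2 / 2)) * ‖H ((σ : ℝ) + y * I)‖ₑ := by
    intro t
    set s : ℂ := σ + t * I with hs
    have h1 := integral_gaussLaplace_mul hbint (H := H) (fun y => hHe _ (by simp)) U s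
    obtain ⟨C, k, hCk⟩ := hgrow σ hσ1
    obtain ⟨C', hC', hg⟩ := exists_pow_mul_gaussian_le k t
    have hC : 0 ≤ C := by
      have := (norm_nonneg _).trans (hCk σ (by simp) (by simp; linarith))
      simpa using this
    have h2 := integral_vertical_eq (σ₁ := σ) (σ₂ := 2)
      (f := fun w => gaussLaplace U (s - w) * H w)
      (C := (2 * Real.pi) ^ (1 / 2 : ℝ) * Real.exp (2 * U + 2) * C * C') (by linarith) ?_ ?_
    · have h3 : ∫ u : ℝ, f u * cexp (-(t * u * I)) =
          ∫ u : ℝ, b u * cexp (-(u - U) ^ 2 / 2 - s * u) := by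
        refine integral_congr_ae (ae_of_all _ fun u => ?_)
        simp only [hf]
        rw [mul_assoc, ← Complex.exp_add]
        congr 2
        rw [hs]; ring
      have h4 : ‖(2 * Real.pi : ℂ)‖ₑ * ‖∫ u : ℝ, f u * cexp (-(t * u * I))‖ₑ =
          ‖∫ y : ℝ, gaussLaplace U (s - (σ + y * I)) * H (σ + y * I)‖ₑ := by
        rw [h2, h1, h3, ← enorm_mul]
      have h5 : ∀ y : ℝ, ‖gaussLaplace U (s - (σ + y * I)) * H (σ + y * I)‖ₑ =
          ENNReal.ofReal ((2 * Real.pi) ^ (1 / 2 : ℝ)) *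
          (ENNReal.ofReal (Real.exp (-(t - y) ^ 2 / 2)) * ‖H ((σ : ℝ) + y * I)‖ₑ) := by
        intro y
        rw [enorm_mul, ← ofReal_norm, norm_gaussLaplace, ← mul_assoc,
          ← ENNReal.ofReal_mul (by positivity)]
        simp [hs]
      have h6 : ENNReal.ofReal ((2 * Real.pi) ^ (1 / 2 : ℝ)) ≤ ‖(2 * Real.pi : ℂ)‖ₑ := by
        have : ‖(2 * Real.pi : ℂ)‖ = 2 * Real.pi := by
          simp [abs_of_pos Real.pi_pos]
        rw [← ofReal_norm, this]
        refine ENNReal.ofReal_le_ofReal ?_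
        have h7 : 1 ≤ 2 * Real.pi := by linarith [Real.pi_gt_three]
        calc (2 * Real.pi) ^ (1 / 2 : ℝ) ≤ (2 * Real.pi) ^ (1 : ℝ) :=
              Real.rpow_le_rpow_of_exponent_le h7 (by norm_num)
          _ = _ := Real.rpow_one _
      have h8 : ENNReal.ofReal ((2 * Real.pi) ^ (1 / 2 : ℝ)) *
          ‖∫ u : ℝ, f u * cexp (-(t * u * I))‖ₑ ≤ ENNReal.ofReal ((2 * Real.pi) ^ (1 / 2 : ℝ)) *
          ∫⁻ y, ENNReal.ofReal (Real.exp (-(t - y) ^ 2 / 2)) * ‖H ((σ : ℝ) + y * I)‖ₑ := by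
        calc _ ≤ ‖(2 * Real.pi : ℂ)‖ₑ * ‖∫ u : ℝ, f u * cexp (-(t * u * I))‖ₑ := by gcongr
          _ = _ := h4
          _ ≤ ∫⁻ y : ℝ, ‖gaussLaplace U (s - (σ + y * I)) * H (σ + y * I)‖ₑ :=
              enorm_integral_le_lintegral_enorm _
          _ = _ := by
              simp_rw [h5]
              rw [lintegral_const_mul' _ _ ENNReal.ofReal_ne_top]
      refine (ENNReal.mul_le_mul_iff_right ?_ ENNReal.ofReal_ne_top).1 h8
      exact (ENNReal.ofReal_pos.2 (by positivity)).ne'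
    · refine DifferentiableOn.mul ?_ (hHd.mono fun w hw => lt_of_lt_of_le hσ1 hw.1)
      unfold gaussLaplace
      fun_prop
    · intro w hw1 hw2
      rw [norm_mul, norm_gaussLaplace]
      have e1 : (s - w).re = σ - w.re := by simp [hs]
      have e2 : (s - w).im = t - w.im := by simp [hs]
      rw [e1, e2]
      calc (2 * Real.pi) ^ (1 / 2 : ℝ) * Real.exp (-(σ - w.re) * U + (σ - w.re) ^ 2 / 2) *
            Real.exp (-(t - w.im) ^ 2 / 2) * ‖H w‖
          ≤ (2 * Real.pi) ^ (1 / 2 : ℝ) * Real.exp (2 * U + 2) *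
            Real.exp (-(t - w.im) ^ 2 / 2) * (C * (1 + |w.im|) ^ k) := by
            gcongr
            · nlinarith
            · nlinarith
            · exact hCk w hw1 hw2
        _ = (2 * Real.pi) ^ (1 / 2 : ℝ) * Real.exp (2 * U + 2) * C *
            ((1 + |w.im|) ^ k * Real.exp (-(t - w.im) ^ 2 / 2)) := by ring
        _ ≤ (2 * Real.pi) ^ (1 / 2 : ℝ) * Real.exp (2 * U + 2) * C * (C' * (1 + w.im ^ 2)⁻¹) := by
            exact mul_le_mul_of_nonneg_left (hg _) (by positivity)
        _ = _ := by ring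
  have hHm : Measurable fun y : ℝ => ‖H ((σ : ℝ) + y * I)‖ₑ := by
    refine Continuous.measurable ?_
    refine Continuous.enorm ?_
    rw [← continuousOn_univ]
    exact hHd.continuousOn.comp (by fun_prop) fun y _ => by simpa using hσ1
  have hpl := lintegral_enorm_integral_exp_sq hf1 hf2
  have hmain : ∫⁻ u, ‖f u‖ₑ ^ 2 ≤ 4 * (∫⁻ z : ℝ, ENNReal.ofReal (Real.exp (-(1 / 4) * z ^ 2))) ^ 2 *
      ∫⁻ τ : ℝ, (∫⁻ y in Set.Icc (τ - 1 / 2) (τ + 1 / 2), ‖H ((σ : ℝ) + y * I)‖ₑ) ^ 2 := by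
    calc ∫⁻ u, ‖f u‖ₑ ^ 2 ≤ ENNReal.ofReal (2 * Real.pi) * ∫⁻ u, ‖f u‖ₑ ^ 2 := by
          refine le_mul_of_one_le_left' ?_
          rw [← ENNReal.ofReal_one]
          exact ENNReal.ofReal_le_ofReal (by linarith [Real.pi_gt_three])
      _ = _ := hpl.symm
      _ ≤ ∫⁻ t : ℝ, (∫⁻ y, ENNReal.ofReal (Real.exp (-(t - y) ^ 2 / 2)) *
            ‖H ((σ : ℝ) + y * I)‖ₑ) ^ 2 := by
          refine lintegral_mono fun t => ?_
          have := hrep t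
          gcongr
      _ ≤ _ := lintegral_gaussian_conv_sq_le hHm
  rw [mul_assoc]
  refine le_trans ?_ (mul_le_mul_right hmain _)
  rw [← lintegral_const_mul _ (hfm.enorm.pow_const 2)]
  refine (setLIntegral_mono' measurableSet_Icc fun u hu => ?_).trans (setLIntegral_le_lintegral _ _)
  have hu0 : 0 < u := by linarith [hu.1]
  have e : (-((u : ℂ) - U) ^ 2 / 2 - σ * u).re = -(u - U) ^ 2 / 2 - σ * u := by
    rw [show (-((u : ℂ) - U) ^ 2 / 2 - σ * u) = ((-(u - U) ^ 2 / 2 - σ * u : ℝ) : ℂ) by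
      push_cast; ring, ofReal_re]
  have hfn : ‖f u‖ = u ^ 2 * ‖a u‖ * Real.exp (-(u - U) ^ 2 / 2 - σ * u) := by
    rw [hf, hb]
    simp only [norm_mul, Complex.norm_exp, e, norm_pow, Complex.norm_real, Real.norm_eq_abs, sq_abs]
  rw [← ofReal_norm, ← ofReal_norm, ← ENNReal.ofReal_pow (norm_nonneg _),
    ← ENNReal.ofReal_pow (norm_nonneg _), ← ENNReal.ofReal_mul (by positivity),
    ← ENNReal.ofReal_mul (by positivity), ← ENNReal.ofReal_mul (by positivity)]
  refine ENNReal.ofReal_le_ofReal ?_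
  rw [hfn]
  have h1 : Real.exp (-u) ≤ Real.exp 5 * Real.exp (-(u - U) ^ 2 / 2 - σ * u) ^ 2 := by
    rw [← Real.exp_nat_mul, ← Real.exp_add]
    refine Real.exp_le_exp.2 ?_
    have h2 : 1 / U * u ≤ 2 := by
      rw [one_div, inv_mul_le_iff₀ hUpos]; linarith [hu.2]
    have h3 : (u - U) ^ 2 ≤ 1 := by
      have := hu.1; have := hu.2; nlinarith
    push_cast
    rw [hσ]
    linarith
  calc U ^ 4 * (Real.exp (-u) * ‖a u‖ ^ 2)
      ≤ u ^ 4 * (Real.exp 5 * Real.exp (-(u - U) ^ 2 / 2 - σ * u) ^ 2 * ‖a u‖ ^ 2) := by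
        have := hu.1
        gcongr
    _ = _ := by ring

end Tauberian

section Tauberian
open MeasureTheory

theorem integrable_mul_cexp_of_le {b : ℝ → ℂ} {C κ : ℝ} (hb : Measurable b)
    (hle : ∀ u, ‖b u‖ ≤ C * Real.exp (κ * u)) (h0 : ∀ u < 0, b u = 0) {s : ℂ} (hs : κ < s.re) :
    Integrable fun u : ℝ => b u * cexp (-s * u) := by
  have hi : IntegrableOn (fun u : ℝ => C * Real.exp (-(s.re - κ) * u)) (Set.Ici 0) := by
    rw [integrableOn_Ici_iff_integrableOn_Ioi]
    exact (exp_neg_integrableOn_Ioi 0 (by linarith)).const_mul _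
  refine Integrable.mono' (hi.integrable_indicator measurableSet_Ici)
    (by fun_prop) (ae_of_all _ fun u => ?_)
  rcases lt_or_ge u 0 with h | h
  · rw [h0 u h, zero_mul, norm_zero, Set.indicator_of_notMem (by simpa using h)]
  · rw [Set.indicator_of_mem (by simpa using h), norm_mul, Complex.norm_exp]
    have : (-s * (u : ℂ)).re = -s.re * u := by simp
    rw [this]
    calc ‖b u‖ * Real.exp (-s.re * u) ≤ C * Real.exp (κ * u) * Real.exp (-s.re * u) := by
          gcongr; exact hle u
      _ = _ := by rw [mul_assoc, ← Real.exp_add]; ring_nf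

theorem norm_mul_le_exp_of_le {b : ℝ → ℂ} {C κ κ' : ℝ} (hκ : κ < κ')
    (hle : ∀ u, ‖b u‖ ≤ C * Real.exp (κ * u)) (h0 : ∀ u < 0, b u = 0) (u : ℝ) :
    ‖(-(u : ℂ)) * b u‖ ≤ C / (κ' - κ) * Real.exp (κ' * u) := by
  have hC : 0 ≤ C := by simpa using (norm_nonneg _).trans (hle 0)
  have hd : 0 < κ' - κ := by linarith
  rcases lt_or_ge u 0 with h | h
  · rw [h0 u h, mul_zero, norm_zero]; positivity
  · have h1 : (κ' - κ) * u ≤ Real.exp ((κ' - κ) * u) := by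
      linarith [Real.add_one_le_exp ((κ' - κ) * u)]
    have h2 : u ≤ Real.exp ((κ' - κ) * u) / (κ' - κ) := by
      rw [le_div_iff₀ hd]; linarith
    rw [norm_mul, norm_neg, Complex.norm_real, Real.norm_eq_abs, abs_of_nonneg h]
    calc u * ‖b u‖ ≤ Real.exp ((κ' - κ) * u) / (κ' - κ) * (C * Real.exp (κ * u)) := by
          gcongr; exact hle u
      _ = C / (κ' - κ) * (Real.exp ((κ' - κ) * u) * Real.exp (κ * u)) := by ring
      _ = _ := by rw [← Real.exp_add]; ring_nf

/-- Differentiation of a Laplace transform. -/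
theorem hasDerivAt_laplace {b : ℝ → ℂ} {C κ : ℝ} (hb : Measurable b)
    (hle : ∀ u, ‖b u‖ ≤ C * Real.exp (κ * u)) (h0 : ∀ u < 0, b u = 0) {s : ℂ} (hs : κ < s.re) :
    HasDerivAt (fun s : ℂ => ∫ u : ℝ, b u * cexp (-s * u))
      (∫ u : ℝ, (-(u : ℂ)) * b u * cexp (-s * u)) s := by
  set κ₁ := κ + (s.re - κ) / 3 with hκ₁
  set κ₂ := κ + 2 * (s.re - κ) / 3 with hκ₂
  have hle' := norm_mul_le_exp_of_le (κ' := κ₁) (by linarith) hle h0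
  have h0' : ∀ u : ℝ, u < 0 → (-(u : ℂ)) * b u = 0 := fun u hu => by rw [h0 u hu, mul_zero]
  have hm' : Measurable fun u : ℝ => (-(u : ℂ)) * b u := by fun_prop
  have hbd := integrable_mul_cexp_of_le hm' hle' h0' (s := κ₂) (by simp; linarith)
  refine (hasDerivAt_integral_of_dominated_loc_of_deriv_le (𝕜 := ℂ)
    (F := fun s u => b u * cexp (-s * u)) (F' := fun s u => (-(u : ℂ)) * b u * cexp (-s * u))
    (s := {z : ℂ | κ₂ < z.re}) (x₀ := s) (bound := fun u : ℝ => ‖(-(u : ℂ)) * b u * cexp (-κ₂ * u)‖)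
    ?_ ?_ ?_ ?_ ?_ hbd.norm ?_).2
  · exact (isOpen_lt continuous_const continuous_re).mem_nhds (by simp; linarith)
  · exact Eventually.of_forall fun z => by fun_prop
  · exact integrable_mul_cexp_of_le hb hle h0 hs
  · fun_prop
  · refine ae_of_all _ fun u z hz => ?_
    rcases lt_or_ge u 0 with h | h
    · rw [h0' u h]; simp
    · rw [norm_mul, norm_mul _ (cexp _), Complex.norm_exp, Complex.norm_exp]
      refine mul_le_mul_of_nonneg_left (Real.exp_le_exp.2 ?_) (norm_nonneg _)
      have : κ₂ < z.re := hz
      simp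
      nlinarith
  · refine ae_of_all _ fun u z _ => ?_
    have h1 : HasDerivAt (fun z : ℂ => -z * (u : ℂ)) (-1 * (u : ℂ)) z :=
      (hasDerivAt_id z).neg.mul_const _
    exact (h1.cexp.const_mul (b u)).congr_deriv (by ring)

end Tauberian

section LaplaceDirichlet
open MeasureTheory

/-- The summatory function `∑_{n ≤ e^u} c n`. -/
def expSum (c : ℕ → ℂ) (u : ℝ) : ℂ := ∑ n ∈ Finset.Icc 1 ⌊Real.exp u⌋₊, c n

theorem measurable_expSum (c : ℕ → ℂ) : Measurable (expSum c) :=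
  (measurable_from_nat (f := fun m => ∑ n ∈ Finset.Icc 1 m, c n)).comp
    (Nat.measurable_floor.comp Real.measurable_exp)

theorem expSum_of_neg (c : ℕ → ℂ) {u : ℝ} (hu : u < 0) : expSum c u = 0 := by
  have : ⌊Real.exp u⌋₊ = 0 := Nat.floor_eq_zero.2 (by simpa using hu)
  simp [expSum, this]

theorem norm_sum_Icc_le {c : ℕ → ℂ} (hc : ∀ n, ‖c n‖ ≤ 1) (m : ℕ) :
    ‖∑ n ∈ Finset.Icc 1 m, c n‖ ≤ m := by
  refine (norm_sum_le _ _).trans ((Finset.sum_le_sum fun n _ => hc n).trans ?_)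
  simp

theorem norm_expSum_le {c : ℕ → ℂ} (hc : ∀ n, ‖c n‖ ≤ 1) (u : ℝ) :
    ‖expSum c u‖ ≤ Real.exp u :=
  (norm_sum_Icc_le hc _).trans (Nat.floor_le (Real.exp_pos u).le)

theorem LSeries_eq_mul_laplace {c : ℕ → ℂ} (hc : ∀ n, ‖c n‖ ≤ 1) {s : ℂ} (hs : 1 < s.re) :
    LSeries c s = s * ∫ u : ℝ, expSum c u * cexp (-s * u) := by
  have hS : LSeriesSummable c s := LSeriesSummable_of_bounded_of_one_lt_re (m := 1)
    (fun n _ => hc n) hs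
  have hO : (fun n : ℕ ↦ ∑ k ∈ Finset.Icc 1 n, c k) =O[atTop] fun n ↦ (n : ℝ) ^ (1 : ℝ) := by
    refine Asymptotics.IsBigO.of_bound 1 (Eventually.of_forall fun n => ?_)
    simpa using norm_sum_Icc_le hc n
  rw [LSeries_eq_mul_integral c zero_le_one hs hS hO]
  congr 1
  have h1 := integral_comp_exp_Ioi
    (fun t : ℝ => (∑ k ∈ Finset.Icc 1 ⌊t⌋₊, c k) * (t : ℂ) ^ (-(s + 1))) 0
  rw [Real.exp_zero] at h1
  rw [← h1, ← setIntegral_eq_integral_of_forall_compl_eq_zero (s := Set.Ici (0 : ℝ))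
    (f := fun u : ℝ => expSum c u * cexp (-s * u)), integral_Ici_eq_integral_Ioi]
  · refine setIntegral_congr_fun measurableSet_Ioi fun u _ => ?_
    have : ((Real.exp u : ℝ) : ℂ) ^ (-(s + 1)) = cexp (-(s + 1) * u) := by
      rw [Complex.cpow_def_of_ne_zero (by exact_mod_cast (Real.exp_pos u).ne'),
        ← Complex.ofReal_log (Real.exp_pos u).le, Real.log_exp, mul_comm]
    simp only [expSum, this, Complex.real_smul]
    rw [mul_left_comm, Complex.ofReal_exp, ← Complex.exp_add]
    congr 2
    ring
  · intro u hu
    rw [expSum_of_neg c (by simpa using hu), zero_mul]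

end LaplaceDirichlet

section CharacterSums
variable {N : ℕ} [NeZero N]

theorem sum_range_eq_zero_of_ne_one {ψ : DirichletCharacter ℂ N} (hψ : ψ ≠ 1) :
    ∑ n ∈ Finset.range N, ψ n = 0 := by
  rw [← MulChar.sum_eq_zero_of_ne_one hψ]
  refine Finset.sum_bij (fun n _ => (n : ZMod N)) (fun _ _ => Finset.mem_univ _) ?_ ?_
    (fun _ _ => rfl)
  · intro a ha b hb h
    rw [ZMod.natCast_eq_natCast_iff'] at h
    rwa [Nat.mod_eq_of_lt (Finset.mem_range.1 ha), Nat.mod_eq_of_lt (Finset.mem_range.1 hb)] at h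
  · intro b _
    exact ⟨b.val, Finset.mem_range.2 (ZMod.val_lt b), ZMod.natCast_zmod_val b⟩

theorem norm_sum_range_character_le {ψ : DirichletCharacter ℂ N} (hψ : ψ ≠ 1) (m : ℕ) :
    ‖∑ n ∈ Finset.range m, ψ n‖ ≤ N := by
  have key : ∀ k r : ℕ, ∑ n ∈ Finset.range (N * k + r), ψ n = ∑ n ∈ Finset.range r, ψ n := by
    intro k r
    induction k with
    | zero => simp
    | succ k ih =>
      rw [show N * (k + 1) + r = N + (N * k + r) by ring, Finset.sum_range_add,
        sum_range_eq_zero_of_ne_one hψ, zero_add, ← ih]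
      refine Finset.sum_congr rfl fun n _ => ?_
      simp
  rw [← Nat.div_add_mod m N, key]
  refine (norm_sum_le _ _).trans ((Finset.sum_le_sum fun n _ => ψ.norm_le_one _).trans ?_)
  simpa using (Nat.mod_lt m (NeZero.pos N)).le

theorem norm_expSum_character_le {ψ : DirichletCharacter ℂ N} (hψ : ψ ≠ 1) (u : ℝ) :
    ‖expSum (fun n => ψ n) u‖ ≤ N + 1 := by
  have h : expSum (fun n => ψ n) u = ∑ n ∈ Finset.range (⌊Real.exp u⌋₊ + 1), ψ n - ψ 0 := by
    rw [expSum, ← Finset.sum_sdiff (s₁ := Finset.Icc 1 ⌊Real.exp u⌋₊)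
      (s₂ := Finset.range (⌊Real.exp u⌋₊ + 1))]
    · rw [show Finset.range (⌊Real.exp u⌋₊ + 1) \ Finset.Icc 1 ⌊Real.exp u⌋₊ = {0} by
        ext n; simp; omega]
      simp
    · intro n; simp
  rw [h]
  refine (norm_sub_le _ _).trans (add_le_add (norm_sum_range_character_le hψ _) (ψ.norm_le_one _))

theorem LFunction_eq_mul_laplace {ψ : DirichletCharacter ℂ N} (hψ : ψ ≠ 1) {s : ℂ}
    (hs : 0 < s.re) :
    ψ.LFunction s = s * ∫ u : ℝ, expSum (fun n => ψ n) u * cexp (-s * u) := by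
  have hb := measurable_expSum (fun n => ψ n)
  have hle : ∀ u, ‖expSum (fun n => ψ n) u‖ ≤ (N + 1 : ℝ) * Real.exp (0 * u) := fun u => by
    simpa using norm_expSum_character_le hψ u
  have h0 : ∀ u < 0, expSum (fun n => ψ n) u = 0 := fun u hu => expSum_of_neg _ hu
  have ho : IsOpen {z : ℂ | 0 < z.re} := isOpen_lt continuous_const continuous_re
  have hpc : IsPreconnected {z : ℂ | 0 < z.re} := (convex_halfSpace_re_gt 0).isPreconnected
  have hA : AnalyticOnNhd ℂ (fun s => ψ.LFunction s) {z : ℂ | 0 < z.re} :=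
    (DirichletCharacter.differentiable_LFunction hψ).differentiableOn.analyticOnNhd ho
  have hB : AnalyticOnNhd ℂ (fun s => s * ∫ u : ℝ, expSum (fun n => ψ n) u * cexp (-s * u))
      {z : ℂ | 0 < z.re} := by
    refine DifferentiableOn.analyticOnNhd (fun z hz => ?_) ho
    exact (differentiableAt_id.mul
      (hasDerivAt_laplace hb hle h0 hz).differentiableAt).differentiableWithinAt
  refine hA.eqOn_of_preconnected_of_eventuallyEq hB hpc (z₀ := 2) (by simp) ?_ hs
  filter_upwards [(isOpen_lt continuous_const continuous_re).mem_nhds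
    (show (1 : ℝ) < (2 : ℂ).re by norm_num)] with z hz
  rw [DirichletCharacter.LFunction_eq_LSeries ψ hz,
    LSeries_eq_mul_laplace (fun n => ψ.norm_le_one _) hz]

theorem norm_LFunction_le {ψ : DirichletCharacter ℂ N} (hψ : ψ ≠ 1) {s : ℂ} (hs : 0 < s.re) :
    ‖ψ.LFunction s‖ ≤ (N + 1) * ‖s‖ / s.re := by
  rw [LFunction_eq_mul_laplace hψ hs, norm_mul]
  have h1 : ‖∫ u : ℝ, expSum (fun n => ψ n) u * cexp (-s * u)‖ ≤
      ∫ u in Set.Ioi (0 : ℝ), (N + 1 : ℝ) * Real.exp (-s.re * u) := by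
    rw [← MeasureTheory.setIntegral_eq_integral_of_forall_compl_eq_zero (s := Set.Ici (0 : ℝ)),
      MeasureTheory.integral_Ici_eq_integral_Ioi]
    · refine MeasureTheory.norm_integral_le_of_norm_le
        ((exp_neg_integrableOn_Ioi 0 hs).const_mul _) (MeasureTheory.ae_of_all _ fun u => ?_)
      rw [norm_mul, Complex.norm_exp]
      have : (-s * (u : ℂ)).re = -s.re * u := by simp
      rw [this]
      exact mul_le_mul_of_nonneg_right (norm_expSum_character_le hψ u) (Real.exp_pos _).le
    · intro u hu
      rw [expSum_of_neg _ (by simpa using hu), zero_mul]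
  rw [MeasureTheory.integral_const_mul, integral_exp_mul_Ioi (by linarith)] at h1
  refine (mul_le_mul_of_nonneg_left h1 (norm_nonneg s)).trans (le_of_eq ?_)
  simp
  field_simp

end CharacterSums

section MeanSquare
open MeasureTheory
open scoped ENNReal
variable {N : ℕ} [NeZero N]

theorem lintegral_Ioi_exp_neg_le {κ a : ℝ} (hκ : 0 < κ) {C : ℝ} (hC : 0 ≤ C) :
    ∫⁻ u in Set.Ioi a, ENNReal.ofReal (C * Real.exp (-κ * u)) =
      ENNReal.ofReal (C * (Real.exp (-κ * a) / κ)) := by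
  rw [← ofReal_integral_eq_lintegral_ofReal ((exp_neg_integrableOn_Ioi a hκ).const_mul C)
    (ae_of_all _ fun u => by positivity), integral_const_mul, integral_exp_mul_Ioi (by linarith)]
  congr 2
  rw [neg_div_neg_eq]

theorem norm_expSum_sub_le {c : ℕ → ℂ} (hc : ∀ n, ‖c n‖ ≤ 1) {u v U : ℝ} (hv : 0 ≤ v)
    (hv1 : v ≤ 1) (hu : u ≤ U) :
    ‖expSum c (u + v) - expSum c u‖ ≤ ∑ n ∈ Finset.Icc 1 ⌊Real.exp (U + 1)⌋₊,
      (Set.Icc (Real.log n - v) (Real.log n)).indicator (fun _ => (1 : ℝ)) u := by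
  have hle : ⌊Real.exp u⌋₊ ≤ ⌊Real.exp (u + v)⌋₊ :=
    Nat.floor_mono (Real.exp_le_exp.2 (by linarith))
  have hdiff : expSum c (u + v) - expSum c u =
      ∑ n ∈ Finset.Ioc ⌊Real.exp u⌋₊ ⌊Real.exp (u + v)⌋₊, c n := by
    rw [expSum, expSum, sub_eq_iff_eq_add']
    have h1 := Finset.sum_Ioc_consecutive c (Nat.zero_le ⌊Real.exp u⌋₊) hle
    rwa [← Finset.Icc_add_one_left_eq_Ioc, ← Finset.Icc_add_one_left_eq_Ioc 0, eq_comm] at h1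
  rw [hdiff]
  refine (norm_sum_le _ _).trans ?_
  have hsub : Finset.Ioc ⌊Real.exp u⌋₊ ⌊Real.exp (u + v)⌋₊ ⊆
      Finset.Icc 1 ⌊Real.exp (U + 1)⌋₊ := by
    intro n hn
    rw [Finset.mem_Ioc] at hn
    rw [Finset.mem_Icc]
    exact ⟨by omega, hn.2.trans (Nat.floor_mono (Real.exp_le_exp.2 (by linarith)))⟩
  refine (Finset.sum_le_sum fun n hn => ?_).trans
    (Finset.sum_le_sum_of_subset_of_nonneg hsub fun n _ _ =>
      Set.indicator_nonneg (fun _ _ => zero_le_one) _)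
  rw [Finset.mem_Ioc] at hn
  have hn0 : (0 : ℝ) < n := by exact_mod_cast (by omega : 0 < n)
  rw [Set.indicator_of_mem]
  · exact hc n
  · have h1 : Real.exp u < n := Nat.lt_of_floor_lt hn.1
    have h2 : (n : ℝ) ≤ Real.exp (u + v) := (Nat.le_floor_iff (Real.exp_pos _).le).1 hn.2
    have h3 := Real.log_le_log (Real.exp_pos u) h1.le
    have h4 := Real.log_le_log hn0 h2
    rw [Real.log_exp] at h3 h4
    exact ⟨by linarith, h3⟩

theorem exists_lintegral_expSum_sub_le {c : ℕ → ℂ} (hc : ∀ n, ‖c n‖ ≤ 1) {B : ℝ}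
    (hB : ∀ u, ‖expSum c u‖ ≤ B) : ∃ C : ℝ, 0 ≤ C ∧ ∀ v : ℝ, 0 < v → v ≤ 1 →
      ∫⁻ u : ℝ, ‖(expSum c (u + v) - expSum c u) * Real.exp (-(1 / 10) * u)‖ₑ ^ 2 ≤
        ENNReal.ofReal (C * v ^ (1 / 10 : ℝ)) := by
  have hB0 : 0 ≤ B := (norm_nonneg _).trans (hB 0)
  refine ⟨18 * B + 20 * B ^ 2, by positivity, fun v hv hv1 => ?_⟩
  set U : ℝ := -(1 / 2) * Real.log v with hU
  have hlog : Real.log v ≤ 0 := Real.log_nonpos hv.le hv1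
  set M := ⌊Real.exp (U + 1)⌋₊ with hM
  have hpt : ∀ u : ℝ, ‖(expSum c (u + v) - expSum c u) * Real.exp (-(1 / 10) * u)‖ₑ ^ 2 ≤
      ∑ n ∈ Finset.Icc 1 M, (Set.Icc (Real.log n - v) (Real.log n)).indicator
        (fun _ => ENNReal.ofReal (6 * B)) u +
      (Set.Ioi U).indicator (fun u => ENNReal.ofReal (4 * B ^ 2 * Real.exp (-(1 / 5) * u))) u := by
    intro u
    have hd2 : ‖expSum c (u + v) - expSum c u‖ ≤ 2 * B :=
      (norm_sub_le _ _).trans (by linarith [hB u, hB (u + v)])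
    have he : ‖(expSum c (u + v) - expSum c u) * Real.exp (-(1 / 10) * u)‖ ^ 2 =
        ‖expSum c (u + v) - expSum c u‖ ^ 2 * Real.exp (-(1 / 5) * u) := by
      rw [norm_mul, mul_pow, Complex.norm_real, Real.norm_eq_abs, abs_of_pos (Real.exp_pos _),
        ← Real.exp_nat_mul]
      congr 2
      push_cast; ring
    rw [← ofReal_norm, ← ENNReal.ofReal_pow (norm_nonneg _), he]
    rcases lt_or_ge U u with h | h
    · refine le_add_left ?_
      rw [Set.indicator_of_mem (by exact h)]
      refine ENNReal.ofReal_le_ofReal (mul_le_mul_of_nonneg_right ?_ (Real.exp_pos _).le)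
      calc _ ≤ (2 * B) ^ 2 := pow_le_pow_left₀ (norm_nonneg _) hd2 2
        _ = _ := by ring
    · refine le_add_right ?_
      rcases lt_or_ge u (-1) with h1 | h1
      · rw [expSum_of_neg c (by linarith), expSum_of_neg c (by linarith)]
        simp
      have hsum := norm_expSum_sub_le hc hv.le hv1 h
      have h3 : Real.exp (-(1 / 5) * u) ≤ 3 :=
        (Real.exp_le_exp.2 (by linarith)).trans Real.exp_one_lt_three.le
      have hsn : ∀ n ∈ Finset.Icc 1 M, 0 ≤ (Set.Icc (Real.log n - v) (Real.log n)).indicator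
          (fun _ => 6 * B) u := fun n _ => Set.indicator_nonneg (fun _ _ => by positivity) _
      have : ∑ n ∈ Finset.Icc 1 M, (Set.Icc (Real.log n - v) (Real.log n)).indicator
          (fun _ => ENNReal.ofReal (6 * B)) u = ENNReal.ofReal (∑ n ∈ Finset.Icc 1 M,
          (Set.Icc (Real.log n - v) (Real.log n)).indicator (fun _ => 6 * B) u) := by
        rw [ENNReal.ofReal_sum_of_nonneg hsn]
        refine Finset.sum_congr rfl fun n _ => ?_
        by_cases hm : u ∈ Set.Icc (Real.log n - v) (Real.log n) <;> simp only [hm,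
          Set.indicator_of_mem, Set.indicator_of_notMem, not_false_eq_true, ENNReal.ofReal_zero]
      rw [this]
      refine ENNReal.ofReal_le_ofReal ?_
      have hrw : ∑ n ∈ Finset.Icc 1 M, (Set.Icc (Real.log n - v) (Real.log n)).indicator
          (fun _ => 6 * B) u = 6 * B * ∑ n ∈ Finset.Icc 1 M,
          (Set.Icc (Real.log n - v) (Real.log n)).indicator (fun _ => (1 : ℝ)) u := by
        rw [Finset.mul_sum]
        refine Finset.sum_congr rfl fun n _ => ?_
        simp [Set.indicator_apply]
      rw [hrw]
      set Q := ∑ n ∈ Finset.Icc 1 M,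
          (Set.Icc (Real.log n - v) (Real.log n)).indicator (fun _ => (1 : ℝ)) u
      calc ‖expSum c (u + v) - expSum c u‖ ^ 2 * Real.exp (-(1 / 5) * u)
          ≤ (2 * B * Q) * 3 := by
            refine mul_le_mul ?_ h3 (Real.exp_pos _).le
              (mul_nonneg (by positivity) ((norm_nonneg _).trans hsum))
            rw [sq]
            exact mul_le_mul hd2 hsum (norm_nonneg _) (by positivity)
        _ = _ := by ring
  refine (lintegral_mono hpt).trans ?_
  rw [lintegral_add_left (by fun_prop (disch := measurability)),
    lintegral_finsetSum _ (fun n _ => measurable_const.indicator measurableSet_Icc),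
    lintegral_indicator measurableSet_Ioi, lintegral_Ioi_exp_neg_le (by norm_num) (by positivity)]
  have h1 : ∀ n ∈ Finset.Icc 1 M, ∫⁻ u : ℝ, (Set.Icc (Real.log n - v) (Real.log n)).indicator
      (fun _ => ENNReal.ofReal (6 * B)) u = ENNReal.ofReal (6 * B * v) := by
    intro n _
    rw [lintegral_indicator measurableSet_Icc, setLIntegral_const, Real.volume_Icc,
      ← ENNReal.ofReal_mul (by positivity)]
    congr 1; ring
  rw [Finset.sum_congr rfl h1, Finset.sum_const, Nat.card_Icc, nsmul_eq_mul, Nat.add_sub_cancel,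
    ← ENNReal.ofReal_natCast, ← ENNReal.ofReal_mul (by positivity),
    ← ENNReal.ofReal_add (by positivity) (by positivity)]
  refine ENNReal.ofReal_le_ofReal ?_
  have hMle : (M : ℝ) ≤ 3 * v ^ (-(1 / 2) : ℝ) := by
    refine (Nat.floor_le (Real.exp_pos _).le).trans ?_
    rw [Real.exp_add, Real.rpow_def_of_pos hv, hU, mul_comm (Real.log v), mul_comm (3 : ℝ)]
    exact mul_le_mul_of_nonneg_left Real.exp_one_lt_three.le (Real.exp_pos _).le
  have hE : Real.exp (-(1 / 5) * U) = v ^ (1 / 10 : ℝ) := by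
    rw [Real.rpow_def_of_pos hv, hU]; congr 1; ring
  have hvv : v * v ^ (-(1 / 2) : ℝ) ≤ v ^ (1 / 10 : ℝ) := by
    rw [← Real.rpow_one_add' hv.le (by norm_num)]
    exact Real.rpow_le_rpow_of_exponent_ge hv hv1 (by norm_num)
  rw [hE]
  calc (M : ℝ) * (6 * B * v) + 4 * B ^ 2 * (v ^ (1 / 10 : ℝ) / (1 / 5))
      ≤ 3 * v ^ (-(1 / 2) : ℝ) * (6 * B * v) + 4 * B ^ 2 * (v ^ (1 / 10 : ℝ) / (1 / 5)) := by
        have := mul_le_mul_of_nonneg_right hMle (show 0 ≤ 6 * B * v by positivity)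
        linarith
    _ = 18 * B * (v * v ^ (-(1 / 2) : ℝ)) + 20 * B ^ 2 * v ^ (1 / 10 : ℝ) := by ring
    _ ≤ 18 * B * v ^ (1 / 10 : ℝ) + 20 * B ^ 2 * v ^ (1 / 10 : ℝ) := by
        have := mul_le_mul_of_nonneg_left hvv (show 0 ≤ 18 * B by positivity)
        linarith
    _ = _ := by ring

end MeanSquare

section MeanSquareWeighted
open MeasureTheory
open scoped ENNReal

/-- The Laplace transform of the summatory function. -/
def laplaceSum (c : ℕ → ℂ) (s : ℂ) : ℂ := ∫ u : ℝ, expSum c u * cexp (-s * u)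

theorem integrable_laplaceSum {c : ℕ → ℂ} {B : ℝ} (hB : ∀ u, ‖expSum c u‖ ≤ B) {s : ℂ}
    (hs : 0 < s.re) : Integrable fun u : ℝ => expSum c u * cexp (-s * u) :=
  integrable_mul_cexp_of_le (measurable_expSum c) (C := B) (κ := 0)
    (fun u => by simpa using hB u) (fun u hu => expSum_of_neg c hu) hs

theorem integral_expSum_shift (c : ℕ → ℂ) (s : ℂ) (v : ℝ) :
    ∫ u : ℝ, expSum c (u + v) * cexp (-s * u) = cexp (s * v) * laplaceSum c s := by
  have h := integral_add_right_eq_self (μ := volume)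
    (fun u : ℝ => expSum c u * cexp (-s * (u - v : ℝ))) v
  simp only [add_sub_cancel_right] at h
  rw [h, laplaceSum, ← integral_const_mul]
  refine integral_congr_ae (ae_of_all _ fun u => ?_)
  simp only
  rw [mul_left_comm, ← Complex.exp_add]
  congr 2
  push_cast; ring

theorem integrable_expSum_shift {c : ℕ → ℂ} {B : ℝ} (hB : ∀ u, ‖expSum c u‖ ≤ B) {s : ℂ}
    (hs : 0 < s.re) (v : ℝ) : Integrable fun u : ℝ => expSum c (u + v) * cexp (-s * u) := by
  have h := ((integrable_laplaceSum hB hs).comp_add_right v).const_mul (cexp (s * v))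
  refine h.congr (ae_of_all _ fun u => ?_)
  simp only
  rw [mul_left_comm, ← Complex.exp_add]
  congr 2
  push_cast; ring

theorem lintegral_laplaceSum_sub_sq {c : ℕ → ℂ} {B : ℝ} (hB : ∀ u, ‖expSum c u‖ ≤ B)
    {σ : ℝ} (hσ : 0 < σ) {v : ℝ} (hv : 0 ≤ v) :
    ∫⁻ t : ℝ, ‖(cexp ((σ + t * I) * v) - 1) * laplaceSum c (σ + t * I)‖ₑ ^ 2 =
      ENNReal.ofReal (2 * Real.pi) *
        ∫⁻ u : ℝ, ‖(expSum c (u + v) - expSum c u) * Real.exp (-σ * u)‖ₑ ^ 2 := by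
  set f : ℝ → ℂ := fun u => (expSum c (u + v) - expSum c u) * Real.exp (-σ * u) with hf
  have hsplit : ∀ (s : ℂ) (u : ℝ), (expSum c (u + v) - expSum c u) * cexp (-s * u) =
      expSum c (u + v) * cexp (-s * u) - expSum c u * cexp (-s * u) := fun s u => sub_mul _ _ _
  have hint : ∀ s : ℂ, 0 < s.re →
      Integrable fun u : ℝ => (expSum c (u + v) - expSum c u) * cexp (-s * u) := fun s hs => by
    simp only [hsplit]
    exact (integrable_expSum_shift hB hs v).sub (integrable_laplaceSum hB hs)
  have hf1 : Integrable f := by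
    refine (hint σ (by simpa using hσ)).congr (ae_of_all _ fun u => ?_)
    simp [hf, Complex.ofReal_exp]
  have hbd : ∀ u, ‖f u‖ ≤ 2 * B * Real.exp (σ * v) := by
    intro u
    have hB0 : 0 ≤ B := (norm_nonneg _).trans (hB 0)
    rcases lt_or_ge u (-v) with h | h
    · rw [hf]; simp only
      rw [expSum_of_neg c (by linarith), expSum_of_neg c (by linarith)]
      simp; positivity
    · rw [hf]; simp only
      rw [norm_mul, Complex.norm_real, Real.norm_eq_abs, abs_of_pos (Real.exp_pos _)]
      refine mul_le_mul ?_ (Real.exp_le_exp.2 (by nlinarith)) (Real.exp_pos _).le (by positivity)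
      exact (norm_sub_le _ _).trans (by linarith [hB u, hB (u + v)])
  have hf2 : MemLp f 2 := by
    rw [memLp_two_iff_integrable_sq_norm hf1.aestronglyMeasurable]
    simp only [sq]
    exact hf1.norm.bdd_mul hf1.norm.aestronglyMeasurable
      (ae_of_all _ fun u => by simpa using hbd u)
  rw [← lintegral_enorm_integral_exp_sq hf1 hf2]
  refine lintegral_congr fun t => ?_
  congr 2
  have h1 : ∀ u : ℝ, f u * cexp (-(t * u * I)) =
      (expSum c (u + v) - expSum c u) * cexp (-(σ + t * I) * u) := by
    intro u
    simp only [hf]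
    rw [mul_assoc, Complex.ofReal_exp, ← Complex.exp_add]
    congr 2
    push_cast; ring
  have hs : 0 < ((σ : ℂ) + t * I).re := by simpa using hσ
  simp only [h1, hsplit]
  rw [integral_sub (integrable_expSum_shift hB hs v) (integrable_laplaceSum hB hs),
    integral_expSum_shift, ← laplaceSum]
  ring

theorem le_norm_exp_sub_one {w : ℂ} (h1 : 1 / 4 ≤ ‖w‖) (h2 : ‖w‖ ≤ 1 / 2) :
    3 / 16 ≤ ‖cexp w - 1‖ := by
  have h := Complex.norm_exp_sub_one_sub_id_le (h2.trans (by norm_num))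
  have h3 : ‖w‖ ≤ ‖cexp w - 1‖ + ‖cexp w - 1 - w‖ := by
    calc ‖w‖ = ‖(cexp w - 1) - (cexp w - 1 - w)‖ := by congr 1; ring
      _ ≤ _ := norm_sub_le _ _
  nlinarith

/-- A dyadic expansion bounding `‖s‖ ^ (1 / 20)` by the symbols of difference operators. -/
theorem ofReal_rpow_mul_le_tsum (s P : ℂ) :
    ENNReal.ofReal (‖s‖ ^ (1 / 20 : ℝ)) * ‖P‖ₑ ^ 2 ≤ ‖P‖ₑ ^ 2 + ∑' k : ℕ,
      ENNReal.ofReal (32 * ((2 : ℝ) ^ (1 / 20 : ℝ)) ^ k) *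
        ‖(cexp (s * ((1 / 2 : ℝ) ^ k : ℝ)) - 1) * P‖ₑ ^ 2 := by
  rcases le_or_gt ‖s‖ 1 with h | h
  · refine le_add_right ?_
    calc _ ≤ 1 * ‖P‖ₑ ^ 2 := by
          refine mul_le_mul_left ?_ _
          rw [← ENNReal.ofReal_one]
          exact ENNReal.ofReal_le_ofReal (Real.rpow_le_one (norm_nonneg _) h (by norm_num))
      _ = _ := one_mul _
  · refine le_add_left ?_
    obtain ⟨n, hn1, hn2⟩ := exists_nat_pow_near h.le one_lt_two
    refine le_trans ?_ (ENNReal.le_tsum (n + 2))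
    have hw : ‖s * ((1 / 2 : ℝ) ^ (n + 2) : ℝ)‖ = ‖s‖ / 2 ^ n / 4 := by
      rw [norm_mul, Complex.norm_real, Real.norm_eq_abs, abs_of_pos (by positivity)]
      rw [pow_add, one_div, inv_pow]; ring
    have h2n : (0 : ℝ) < 2 ^ n := by positivity
    have hl := le_norm_exp_sub_one (w := s * ((1 / 2 : ℝ) ^ (n + 2) : ℝ))
      (by rw [hw]; have := (one_le_div h2n).2 hn1; linarith)
      (by
        rw [hw]
        have := (div_le_iff₀ h2n).2 (show ‖s‖ ≤ 2 * 2 ^ n by rw [pow_succ] at hn2; linarith)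
        linarith)
    set E := cexp (s * ((1 / 2 : ℝ) ^ (n + 2) : ℝ)) - 1 with hE
    have hr : ‖s‖ ^ (1 / 20 : ℝ) ≤ ((2 : ℝ) ^ (1 / 20 : ℝ)) ^ (n + 2) := by
      rw [← Real.rpow_natCast, ← Real.rpow_mul (by norm_num), mul_comm, Real.rpow_mul (by norm_num)]
      refine Real.rpow_le_rpow (norm_nonneg _) (hn2.le.trans ?_) (by norm_num)
      rw [Real.rpow_natCast]
      exact pow_le_pow_right₀ (by norm_num) (by omega)
    rw [← ofReal_norm, ← ofReal_norm, ← ENNReal.ofReal_pow (norm_nonneg _),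
      ← ENNReal.ofReal_pow (norm_nonneg _), ← ENNReal.ofReal_mul (by positivity),
      ← ENNReal.ofReal_mul (by positivity), norm_mul]
    refine ENNReal.ofReal_le_ofReal ?_
    set R := ((2 : ℝ) ^ (1 / 20 : ℝ)) ^ (n + 2)
    have hR : 0 ≤ R := by positivity
    have hE2 : 1 ≤ 32 * ‖E‖ ^ 2 := by nlinarith
    calc _ ≤ R * ‖P‖ ^ 2 := mul_le_mul_of_nonneg_right hr (by positivity)
      _ = R * ‖P‖ ^ 2 * 1 := (mul_one _).symm
      _ ≤ R * ‖P‖ ^ 2 * (32 * ‖E‖ ^ 2) := mul_le_mul_of_nonneg_left hE2 (by positivity)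
      _ = _ := by ring

theorem lintegral_rpow_mul_laplaceSum_ne_top {c : ℕ → ℂ} (hc : ∀ n, ‖c n‖ ≤ 1) {B : ℝ}
    (hB : ∀ u, ‖expSum c u‖ ≤ B) :
    ∫⁻ t : ℝ, ENNReal.ofReal (‖(((1 / 10 : ℝ) : ℂ) + t * I)‖ ^ (1 / 20 : ℝ)) *
      ‖laplaceSum c ((1 / 10 : ℝ) + t * I)‖ₑ ^ 2 ≠ ⊤ := by
  have hσ : (0 : ℝ) < 1 / 10 := by norm_num
  obtain ⟨C, hC0, hC⟩ := exists_lintegral_expSum_sub_le hc hB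
  have hcont : Continuous fun t : ℝ => laplaceSum c ((1 / 10 : ℝ) + t * I) := by
    have hd : ∀ s : ℂ, 0 < s.re → ContinuousAt (laplaceSum c) s := fun s hs =>
      (hasDerivAt_laplace (measurable_expSum c) (C := B) (κ := 0)
        (fun u => by simpa using hB u) (fun u hu => expSum_of_neg c hu) hs).continuousAt
    refine continuous_iff_continuousAt.2 fun t => ?_
    exact (hd _ (by simp)).comp (f := fun t : ℝ => (((1 / 10 : ℝ) : ℂ) + t * I)) (by fun_prop)
  have hm : Measurable fun t : ℝ => laplaceSum c ((1 / 10 : ℝ) + t * I) := hcont.measurable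
  have hbound : ∀ v : ℝ, 0 < v → v ≤ 1 →
      ∫⁻ t : ℝ, ‖(cexp ((((1 / 10 : ℝ) : ℂ) + t * I) * v) - 1) *
        laplaceSum c ((1 / 10 : ℝ) + t * I)‖ₑ ^ 2 ≤
      ENNReal.ofReal (2 * Real.pi * C * v ^ (1 / 10 : ℝ)) := by
    intro v hv hv1
    rw [lintegral_laplaceSum_sub_sq hB hσ hv.le, mul_assoc (2 * Real.pi),
      ENNReal.ofReal_mul (p := 2 * Real.pi) (by positivity)]
    exact mul_le_mul_right (hC v hv hv1) _
  have hP : ∫⁻ t : ℝ, ‖laplaceSum c ((1 / 10 : ℝ) + t * I)‖ₑ ^ 2 ≠ ⊤ := by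
    have h1 : ∀ t : ℝ, ‖laplaceSum c ((1 / 10 : ℝ) + t * I)‖ₑ ^ 2 ≤ ENNReal.ofReal 100 *
        ‖(cexp ((((1 / 10 : ℝ) : ℂ) + t * I) * (1 : ℝ)) - 1) *
          laplaceSum c ((1 / 10 : ℝ) + t * I)‖ₑ ^ 2 := by
      intro t
      set P := laplaceSum c ((1 / 10 : ℝ) + t * I)
      set E := cexp ((((1 / 10 : ℝ) : ℂ) + t * I) * (1 : ℝ)) with hE
      have h2 : 1 / 10 ≤ ‖E - 1‖ := by
        have h3 : ‖E‖ = Real.exp (1 / 10) := by rw [hE, Complex.norm_exp]; simp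
        have h4 := norm_sub_norm_le E 1
        have h5 := Real.add_one_le_exp (1 / 10 : ℝ)
        rw [h3, norm_one] at h4
        linarith
      rw [← ofReal_norm, ← ofReal_norm, ← ENNReal.ofReal_pow (norm_nonneg _),
        ← ENNReal.ofReal_pow (norm_nonneg _), ← ENNReal.ofReal_mul (by positivity), norm_mul]
      refine ENNReal.ofReal_le_ofReal ?_
      have h6 : 1 ≤ 100 * ‖E - 1‖ ^ 2 := by nlinarith
      calc ‖P‖ ^ 2 = ‖P‖ ^ 2 * 1 := (mul_one _).symm
        _ ≤ ‖P‖ ^ 2 * (100 * ‖E - 1‖ ^ 2) := mul_le_mul_of_nonneg_left h6 (by positivity)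
        _ = _ := by ring
    refine ne_top_of_le_ne_top ?_ (lintegral_mono h1)
    rw [lintegral_const_mul _ (by fun_prop)]
    exact ENNReal.mul_ne_top ENNReal.ofReal_ne_top
      (ne_top_of_le_ne_top ENNReal.ofReal_ne_top (hbound 1 one_pos le_rfl))
  refine ne_top_of_le_ne_top ?_ (lintegral_mono fun t => ofReal_rpow_mul_le_tsum _ _)
  rw [lintegral_add_left (by fun_prop), lintegral_tsum (fun k => by fun_prop)]
  refine ENNReal.add_ne_top.2 ⟨hP, ?_⟩
  set r : ℝ := (2 : ℝ) ^ (-(1 / 20) : ℝ) with hr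
  have hr1 : r < 1 := Real.rpow_lt_one_of_one_lt_of_neg (by norm_num) (by norm_num)
  have hr0 : 0 ≤ r := by positivity
  have hsum : Summable fun k : ℕ => 64 * Real.pi * C * r ^ k :=
    (summable_geometric_of_lt_one hr0 hr1).mul_left _
  refine ne_top_of_le_ne_top (ENNReal.ofReal_ne_top (r := ∑' k : ℕ, 64 * Real.pi * C * r ^ k)) ?_
  rw [ENNReal.ofReal_tsum_of_nonneg (fun k => by positivity) hsum]
  refine ENNReal.tsum_le_tsum fun k => ?_
  rw [lintegral_const_mul _ (by fun_prop)]
  refine (mul_le_mul_right (hbound _ (by positivity)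
    (pow_le_one₀ (by norm_num) (by norm_num))) _).trans (le_of_eq ?_)
  rw [← ENNReal.ofReal_mul (by positivity)]
  congr 1
  have : ((1 / 2 : ℝ) ^ k) ^ (1 / 10 : ℝ) = (((1 / 2 : ℝ)) ^ (1 / 10 : ℝ)) ^ k := by
    rw [← Real.rpow_natCast, ← Real.rpow_mul (by norm_num), mul_comm, Real.rpow_mul (by norm_num),
      Real.rpow_natCast]
  rw [this]
  have h2 : r = (2 : ℝ) ^ (1 / 20 : ℝ) * (1 / 2 : ℝ) ^ (1 / 10 : ℝ) := by
    rw [one_div (2 : ℝ), Real.inv_rpow (by norm_num), ← Real.rpow_neg (by norm_num),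
      ← Real.rpow_add (by norm_num), hr]
    norm_num
  rw [h2, mul_pow]
  ring

end MeanSquareWeighted

section Poisson
open MeasureTheory FourierTransform
open scoped ENNReal

theorem integrable_exp_neg_mul_abs {x : ℝ} (hx : 0 < x) (b : ℂ) (hb : b.re = 0) :
    Integrable (fun u : ℝ => cexp (-x * |u| + b * u)) ∧
      ∫ u : ℝ, cexp (-x * |u| + b * u) = 2 * x / (x ^ 2 - b ^ 2) := by
  have h1 : (-x + b : ℂ).re < 0 := by simp [hb]; linarith
  have h2 : 0 < (x + b : ℂ).re := by simp [hb]; linarith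
  have e1 : Set.EqOn (fun u : ℝ => cexp (-x * |u| + b * u)) (fun u : ℝ => cexp ((-x + b) * u))
      (Set.Ioi 0) := by
    intro u hu
    simp only [abs_of_pos (show 0 < u from hu)]; congr 1; ring
  have e2 : Set.EqOn (fun u : ℝ => cexp (-x * |u| + b * u)) (fun u : ℝ => cexp ((x + b) * u))
      (Set.Iic 0) := by
    intro u hu
    simp only [abs_of_nonpos (show u ≤ 0 from hu)]; congr 1; push_cast; ring
  have i1 := (integrableOn_exp_mul_complex_Ioi h1 0).congr_fun e1.symm measurableSet_Ioi
  have i2 := (integrableOn_exp_mul_complex_Iic h2 0).congr_fun e2.symm measurableSet_Iic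
  have hi : Integrable (fun u : ℝ => cexp (-x * |u| + b * u)) := by
    rw [← integrableOn_univ, ← Set.Iic_union_Ioi (a := (0 : ℝ))]
    exact i2.union i1
  refine ⟨hi, ?_⟩
  rw [← intervalIntegral.integral_Iic_add_Ioi i2 i1, setIntegral_congr_fun measurableSet_Ioi e1,
    setIntegral_congr_fun measurableSet_Iic e2, integral_exp_mul_complex_Ioi h1,
    integral_exp_mul_complex_Iic h2]
  have n1 : (-x + b : ℂ) ≠ 0 := fun h => by rw [h] at h1; simp at h1
  have n2 : (x + b : ℂ) ≠ 0 := fun h => by rw [h] at h2; simp at h2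
  have n3 : (x ^ 2 - b ^ 2 : ℂ) ≠ 0 := by
    rw [show (x ^ 2 - b ^ 2 : ℂ) = -((-x + b) * (x + b)) by ring]
    exact neg_ne_zero.2 (mul_ne_zero n1 n2)
  have n4 : (x - b : ℂ) ≠ 0 := fun h => n1 (by linear_combination -h)
  simp only [ofReal_zero, mul_zero, Complex.exp_zero]
  rw [eq_div_iff n3]
  field_simp
  ring

theorem integrable_poisson (x : ℝ) (hx : 0 < x) : Integrable fun t : ℝ => (x ^ 2 + t ^ 2)⁻¹ := by
  refine ((integrable_inv_one_add_sq.comp_div hx.ne').const_mul (x ^ 2)⁻¹).congr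
    (ae_of_all _ fun t => ?_)
  simp only
  rw [← mul_inv]
  congr 1
  field_simp

/-- The Poisson kernel has Fourier transform `exp (-x|u|)`. -/
theorem integral_poisson_mul_cexp {x : ℝ} (hx : 0 < x) {u : ℝ} (hu : 0 ≤ u) :
    ∫ t : ℝ, ((x / Real.pi * (x ^ 2 + t ^ 2)⁻¹ : ℝ) : ℂ) * cexp (-(u * t * I)) =
      cexp (-x * u) := by
  set f : ℝ → ℂ := fun u => cexp (-x * |u|) with hf
  have hfi : Integrable f := by
    simpa only [zero_mul, add_zero] using (integrable_exp_neg_mul_abs hx 0 rfl).1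
  have hF : 𝓕 f = fun ξ : ℝ => ((2 * x * (x ^ 2 + (2 * Real.pi * ξ) ^ 2)⁻¹ : ℝ) : ℂ) := by
    funext ξ
    rw [Real.fourier_real_eq_integral_exp_smul]
    have h := (integrable_exp_neg_mul_abs hx (-(2 * Real.pi * ξ * I)) (by simp)).2
    have h3 : ∀ v : ℝ, cexp (((-2 * Real.pi * v * ξ : ℝ) : ℂ) * I) • f v =
        cexp (-x * |v| + -(2 * Real.pi * ξ * I) * v) := by
      intro v
      rw [hf, smul_eq_mul, ← Complex.exp_add]
      congr 1
      push_cast; ring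
    simp only [h3, h]
    push_cast
    rw [div_eq_mul_inv]
    congr 2
    rw [neg_sq, mul_pow _ I, I_sq]
    ring
  have hFi : Integrable (𝓕 f) := by
    rw [hF]
    exact (((integrable_poisson x hx).comp_mul_left' (R := 2 * Real.pi)
      (by positivity)).const_mul (2 * x)).ofReal
  have hinv := Continuous.fourierInv_fourier_eq (by fun_prop : Continuous f) hfi hFi
  have h1 := congrFun hinv u
  rw [Real.fourierInv_eq', hF] at h1
  simp only [hf, abs_of_nonneg hu] at h1
  rw [← h1]
  have h2 := Measure.integral_comp_mul_left (fun t : ℝ =>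
    ((x / Real.pi * (x ^ 2 + t ^ 2)⁻¹ : ℝ) : ℂ) * cexp (-(u * t * I))) (-(2 * Real.pi))
  rw [eq_comm, inv_neg, abs_neg, abs_of_pos (by positivity), inv_smul_eq_iff₀ (by positivity)] at h2
  rw [h2, ← integral_smul]
  refine integral_congr_ae (ae_of_all _ fun ξ => ?_)
  simp only [smul_eq_mul, Complex.real_smul]
  have e1 : -((u : ℂ) * (-(2 * Real.pi) * ξ : ℝ) * I) =
      ((2 * Real.pi * inner ℝ ξ u : ℝ) : ℂ) * I := by
    simp; ring
  rw [e1, mul_comm (cexp _), ← mul_assoc]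
  congr 1
  rw [← Complex.ofReal_mul]
  congr 1
  have : Real.pi ≠ 0 := Real.pi_ne_zero
  have h5 : x ^ 2 + (2 * Real.pi * ξ) ^ 2 ≠ 0 := by positivity
  rw [show (-(2 * Real.pi) * ξ) ^ 2 = (2 * Real.pi * ξ) ^ 2 by ring]
  field_simp

theorem laplaceSum_eq_poisson {c : ℕ → ℂ} {B : ℝ} (hB : ∀ u, ‖expSum c u‖ ≤ B) {x : ℝ}
    (hx : 0 < x) {s : ℂ} (hs : 0 < s.re) :
    laplaceSum c (s + x) = ∫ t : ℝ, ((x / Real.pi * (x ^ 2 + t ^ 2)⁻¹ : ℝ) : ℂ) *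
      laplaceSum c (s + t * I) := by
  have hi := integrable_laplaceSum hB hs
  have hp : Integrable fun t : ℝ => ((x / Real.pi * (x ^ 2 + t ^ 2)⁻¹ : ℝ) : ℂ) :=
    ((integrable_poisson x hx).const_mul _).ofReal
  have hprod : Integrable (Function.uncurry fun (u t : ℝ) => expSum c u * cexp (-s * u) *
      (((x / Real.pi * (x ^ 2 + t ^ 2)⁻¹ : ℝ) : ℂ) * cexp (-(u * t * I)))) := by
    have h1 := hi.mul_prod hp
    refine (h1.bdd_mul (c := 1) (f := fun z : ℝ × ℝ => cexp (-(z.1 * z.2 * I)))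
      (by fun_prop) (ae_of_all _ fun z => ?_)).congr (ae_of_all _ fun z => ?_)
    · rw [Complex.norm_exp]; simp
    · simp only [Function.uncurry]; ring
  have hsw := integral_integral_swap hprod
  calc laplaceSum c (s + x)
      = ∫ u : ℝ, ∫ t : ℝ, expSum c u * cexp (-s * u) *
        (((x / Real.pi * (x ^ 2 + t ^ 2)⁻¹ : ℝ) : ℂ) * cexp (-(u * t * I))) := by
        refine integral_congr_ae (ae_of_all _ fun u => ?_)
        simp only
        rw [integral_const_mul]
        rcases lt_or_ge u 0 with h | h
        · rw [expSum_of_neg c h]; simp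
        · rw [integral_poisson_mul_cexp hx h, mul_assoc, ← Complex.exp_add]
          congr 2; ring
    _ = ∫ t : ℝ, ∫ u : ℝ, expSum c u * cexp (-s * u) *
        (((x / Real.pi * (x ^ 2 + t ^ 2)⁻¹ : ℝ) : ℂ) * cexp (-(u * t * I))) := hsw
    _ = _ := by
        refine integral_congr_ae (ae_of_all _ fun t => ?_)
        simp only
        rw [laplaceSum, ← integral_const_mul]
        refine integral_congr_ae (ae_of_all _ fun u => ?_)
        simp only
        rw [mul_left_comm, mul_assoc (expSum c u), ← Complex.exp_add]
        congr 3
        ring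

end Poisson

section LocalMean
open MeasureTheory
open scoped ENNReal

/-- The local mean square of a Laplace transform on the line `Re s = 1 / 10`. -/
def localMean (c : ℕ → ℂ) (τ : ℝ) : ℝ≥0∞ :=
  ∫⁻ t : ℝ, ENNReal.ofReal ((1 + (t - τ) ^ 2)⁻¹) * ‖laplaceSum c ((1 / 10 : ℝ) + t * I)‖ₑ ^ 2

theorem continuous_laplaceSum_line {c : ℕ → ℂ} {B : ℝ} (hB : ∀ u, ‖expSum c u‖ ≤ B) :
    Continuous fun t : ℝ => laplaceSum c ((1 / 10 : ℝ) + t * I) := by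
  have hd : ∀ s : ℂ, 0 < s.re → ContinuousAt (laplaceSum c) s := fun s hs =>
    (hasDerivAt_laplace (measurable_expSum c) (C := B) (κ := 0)
      (fun u => by simpa using hB u) (fun u hu => expSum_of_neg c hu) hs).continuousAt
  refine continuous_iff_continuousAt.2 fun t => ?_
  exact (hd _ (by simp)).comp (f := fun t : ℝ => (((1 / 10 : ℝ) : ℂ) + t * I)) (by fun_prop)

theorem lintegral_one_add_sub_sq_inv (τ : ℝ) :
    ∫⁻ t : ℝ, ENNReal.ofReal ((1 + (t - τ) ^ 2)⁻¹) = ENNReal.ofReal Real.pi := by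
  rw [lintegral_sub_right_eq_self (fun t : ℝ => ENNReal.ofReal ((1 + t ^ 2)⁻¹)) τ,
    ← ofReal_integral_eq_lintegral_ofReal integrable_inv_one_add_sq
      (ae_of_all _ fun t => by positivity), integral_univ_inv_one_add_sq]

theorem poisson_kernel_le {x y t τ : ℝ} (hx : 1 / 10 ≤ x) (hx4 : x ≤ 4) (hy : |y - τ| ≤ 2) :
    x / Real.pi * (x ^ 2 + (t - y) ^ 2)⁻¹ ≤ 3600 * (1 + (t - τ) ^ 2)⁻¹ := by
  have h1 : x / Real.pi ≤ 4 := by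
    rw [div_le_iff₀ Real.pi_pos]; nlinarith [Real.pi_gt_three]
  have h2 : (1 + (t - τ) ^ 2) ≤ 900 * (x ^ 2 + (t - y) ^ 2) := by
    have := abs_le.1 hy
    nlinarith [sq_nonneg (t - y - (y - τ))]
  have h3 : (x ^ 2 + (t - y) ^ 2)⁻¹ ≤ 900 * (1 + (t - τ) ^ 2)⁻¹ := by
    rw [inv_le_iff_one_le_mul₀ (by positivity), mul_right_comm, ← div_eq_mul_inv,
      le_div_iff₀ (by positivity), one_mul]
    exact h2
  calc _ ≤ 4 * (900 * (1 + (t - τ) ^ 2)⁻¹) :=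
        mul_le_mul h1 h3 (by positivity) (by norm_num)
    _ = _ := by ring

theorem enorm_laplaceSum_sq_le {c : ℕ → ℂ} {B : ℝ} (hB : ∀ u, ‖expSum c u‖ ≤ B) {z : ℂ} {τ : ℝ}
    (h1 : 1 / 5 ≤ z.re) (h2 : z.re ≤ 4) (h3 : |z.im - τ| ≤ 2) :
    ‖laplaceSum c z‖ₑ ^ 2 ≤ ENNReal.ofReal (3600 ^ 2 * Real.pi) * localMean c τ := by
  set x : ℝ := z.re - 1 / 10 with hx
  set P : ℝ → ℂ := fun t => laplaceSum c ((1 / 10 : ℝ) + t * I) with hP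
  have hPm : Measurable P := (continuous_laplaceSum_line hB).measurable
  set k : ℝ → ℝ≥0∞ := fun t => ENNReal.ofReal ((1 + (t - τ) ^ 2)⁻¹) with hk
  have hz : z = (((1 / 10 : ℝ) : ℂ) + z.im * I) + x := by
    apply Complex.ext <;> simp [hx]
  have hstep : ‖laplaceSum c z‖ₑ ≤ ENNReal.ofReal 3600 * ∫⁻ t, k t * ‖P t‖ₑ := by
    rw [hz, laplaceSum_eq_poisson hB (by rw [hx]; linarith) (by simp)]
    have h4 := integral_sub_right_eq_self (μ := volume) (fun t : ℝ =>
      ((x / Real.pi * (x ^ 2 + t ^ 2)⁻¹ : ℝ) : ℂ) *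
        laplaceSum c (((1 / 10 : ℝ) : ℂ) + z.im * I + t * I)) z.im
    rw [← h4, ← lintegral_const_mul _ (by fun_prop)]
    refine (enorm_integral_le_lintegral_enorm _).trans (lintegral_mono fun t => ?_)
    simp only
    have e : ((1 / 10 : ℝ) : ℂ) + z.im * I + ((t - z.im : ℝ) : ℂ) * I =
        (1 / 10 : ℝ) + t * I := by push_cast; ring
    rw [e, enorm_mul, ← mul_assoc]
    refine mul_le_mul_left ?_ _
    rw [hk]
    simp only
    rw [← ENNReal.ofReal_mul (by norm_num), ← ofReal_norm, Complex.norm_real, Real.norm_eq_abs,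
      abs_of_nonneg (mul_nonneg (div_nonneg (by rw [hx]; linarith) Real.pi_pos.le) (by positivity))]
    exact ENNReal.ofReal_le_ofReal (poisson_kernel_le (by rw [hx]; linarith)
      (by rw [hx]; linarith) h3)
  have hcs : (∫⁻ t, k t * ‖P t‖ₑ) ^ 2 ≤ ENNReal.ofReal Real.pi * localMean c τ := by
    have hkr : ∀ t, k t = k t ^ (1 / 2 : ℝ) * k t ^ (1 / 2 : ℝ) := fun t => by
      rw [← ENNReal.rpow_add_of_nonneg _ _ (by norm_num) (by norm_num)]; norm_num
    have hkm : Measurable k := by fun_prop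
    have e1 : ∀ t, k t * ‖P t‖ₑ = k t ^ (1 / 2 : ℝ) * (k t ^ (1 / 2 : ℝ) * ‖P t‖ₑ) := fun t => by
      rw [← mul_assoc, ← hkr]
    simp only [e1]
    refine (lintegral_mul_sq_le (by fun_prop) (by fun_prop)).trans (le_of_eq ?_)
    have e2 : ∀ t, (k t ^ (1 / 2 : ℝ)) ^ 2 = k t := fun t => by rw [sq, ← hkr]
    simp only [mul_pow, e2]
    rw [lintegral_one_add_sub_sq_inv, localMean]
  calc ‖laplaceSum c z‖ₑ ^ 2 ≤ (ENNReal.ofReal 3600 * ∫⁻ t, k t * ‖P t‖ₑ) ^ 2 :=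
        pow_le_pow_left₀ (by positivity) hstep 2
    _ ≤ ENNReal.ofReal 3600 ^ 2 * (ENNReal.ofReal Real.pi * localMean c τ) := by
        rw [mul_pow]; exact mul_le_mul_right hcs _
    _ = _ := by
        rw [ENNReal.ofReal_mul (by positivity), ENNReal.ofReal_pow (by norm_num), mul_assoc]

theorem measurable_localMean {c : ℕ → ℂ} {B : ℝ} (hB : ∀ u, ‖expSum c u‖ ≤ B) :
    Measurable (localMean c) := by
  have hPm := (continuous_laplaceSum_line hB).measurable
  unfold localMean
  refine Measurable.lintegral_prod_right' (f := fun z : ℝ × ℝ =>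
    ENNReal.ofReal ((1 + (z.2 - z.1) ^ 2)⁻¹) * ‖laplaceSum c ((1 / 10 : ℝ) + z.2 * I)‖ₑ ^ 2) ?_
  have : Measurable fun z : ℝ × ℝ => laplaceSum c ((1 / 10 : ℝ) + z.2 * I) :=
    hPm.comp measurable_snd
  fun_prop

theorem lintegral_rpow_mul_kernel_ne_top :
    ∫⁻ w : ℝ, ENNReal.ofReal ((1 + |w|) ^ (1 / 20 : ℝ) * (1 + w ^ 2)⁻¹) ≠ ⊤ := by
  have h : Integrable fun w : ℝ => 2 * (1 + ‖w‖) ^ (-(39 / 20) : ℝ) :=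
    (integrable_one_add_norm (by simp; norm_num)).const_mul 2
  refine ne_top_of_le_ne_top h.lintegral_lt_top.ne (lintegral_mono fun w => ?_)
  refine ENNReal.ofReal_le_ofReal ?_
  have h0 : 0 < 1 + |w| := by positivity
  rw [Real.norm_eq_abs, show (-(39 / 20) : ℝ) = 1 / 20 - 2 by norm_num, Real.rpow_sub h0,
    Real.rpow_two, div_eq_mul_inv (_ ^ (1 / 20 : ℝ)), mul_left_comm]
  refine mul_le_mul_of_nonneg_left ?_ (by positivity)
  rw [inv_le_iff_one_le_mul₀ (by positivity), mul_right_comm, ← div_eq_mul_inv,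
    le_div_iff₀ (by positivity)]
  nlinarith [sq_abs w, sq_nonneg (1 - |w|)]

theorem lintegral_rpow_mul_localMean_ne_top {c : ℕ → ℂ} (hc : ∀ n, ‖c n‖ ≤ 1) {B : ℝ}
    (hB : ∀ u, ‖expSum c u‖ ≤ B) :
    ∫⁻ τ : ℝ, ENNReal.ofReal ((1 + |τ|) ^ (1 / 20 : ℝ)) * localMean c τ ≠ ⊤ := by
  have hPm := (continuous_laplaceSum_line hB).measurable
  set P : ℝ → ℂ := fun t => laplaceSum c ((1 / 10 : ℝ) + t * I) with hP
  set A : ℝ≥0∞ := ∫⁻ w : ℝ, ENNReal.ofReal ((1 + |w|) ^ (1 / 20 : ℝ) * (1 + w ^ 2)⁻¹) with hA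
  have hswap : ∫⁻ τ : ℝ, ENNReal.ofReal ((1 + |τ|) ^ (1 / 20 : ℝ)) * localMean c τ =
      ∫⁻ t : ℝ, ∫⁻ τ : ℝ, ENNReal.ofReal ((1 + |τ|) ^ (1 / 20 : ℝ)) *
        (ENNReal.ofReal ((1 + (t - τ) ^ 2)⁻¹) * ‖P t‖ₑ ^ 2) := by
    rw [lintegral_lintegral_swap]
    · refine lintegral_congr fun τ => ?_
      rw [localMean, lintegral_const_mul _ (by fun_prop)]
    · have : Measurable fun z : ℝ × ℝ => P z.2 := hPm.comp measurable_snd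
      refine Measurable.aemeasurable ?_
      simp only [Function.uncurry_def]
      fun_prop
  rw [hswap]
  have hin : ∀ t : ℝ, ∫⁻ τ : ℝ, ENNReal.ofReal ((1 + |τ|) ^ (1 / 20 : ℝ)) *
      (ENNReal.ofReal ((1 + (t - τ) ^ 2)⁻¹) * ‖P t‖ₑ ^ 2) ≤
      A * (ENNReal.ofReal 20 * (ENNReal.ofReal
        (‖(((1 / 10 : ℝ) : ℂ) + t * I)‖ ^ (1 / 20 : ℝ)) * ‖P t‖ₑ ^ 2)) := by
    intro t
    have hs : 1 + |t| ≤ 11 * ‖(((1 / 10 : ℝ) : ℂ) + t * I)‖ := by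
      have h1 := Complex.abs_re_le_norm (((1 / 10 : ℝ) : ℂ) + t * I)
      have h2 := Complex.abs_im_le_norm (((1 / 10 : ℝ) : ℂ) + t * I)
      have h3 : (((1 / 10 : ℝ) : ℂ) + t * I).re = 1 / 10 := by simp
      have h4 : (((1 / 10 : ℝ) : ℂ) + t * I).im = t := by simp
      rw [h3, abs_of_pos (by norm_num)] at h1
      rw [h4] at h2
      linarith
    have hpt : ∀ τ : ℝ, ENNReal.ofReal ((1 + |τ|) ^ (1 / 20 : ℝ)) *
        (ENNReal.ofReal ((1 + (t - τ) ^ 2)⁻¹) * ‖P t‖ₑ ^ 2) ≤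
        ENNReal.ofReal ((1 + |t - τ|) ^ (1 / 20 : ℝ) * (1 + (t - τ) ^ 2)⁻¹) *
        (ENNReal.ofReal 20 * (ENNReal.ofReal
        (‖(((1 / 10 : ℝ) : ℂ) + t * I)‖ ^ (1 / 20 : ℝ)) * ‖P t‖ₑ ^ 2)) := by
      intro τ
      rw [← mul_assoc, ← mul_assoc, ← mul_assoc]
      refine mul_le_mul_left ?_ _
      rw [← ENNReal.ofReal_mul (by positivity), ← ENNReal.ofReal_mul (by positivity),
        ← ENNReal.ofReal_mul (by positivity)]
      refine ENNReal.ofReal_le_ofReal ?_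
      have h11 : (11 : ℝ) ^ (1 / 20 : ℝ) ≤ 20 :=
        (Real.rpow_le_rpow_of_exponent_le (by norm_num) (show (1 / 20 : ℝ) ≤ 1 by norm_num)).trans
          (by norm_num)
      have h5 : (1 + |τ|) ^ (1 / 20 : ℝ) ≤ (1 + |t - τ|) ^ (1 / 20 : ℝ) *
          (20 * ‖(((1 / 10 : ℝ) : ℂ) + t * I)‖ ^ (1 / 20 : ℝ)) := by
        calc (1 + |τ|) ^ (1 / 20 : ℝ)
            ≤ ((1 + |t - τ|) * (11 * ‖(((1 / 10 : ℝ) : ℂ) + t * I)‖)) ^ (1 / 20 : ℝ) := by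
              refine Real.rpow_le_rpow (by positivity) ?_ (by norm_num)
              have h6 : |τ| ≤ |t| + |t - τ| := by
                have := abs_sub_abs_le_abs_sub τ t
                rw [abs_sub_comm] at this; linarith
              have h7 := mul_le_mul_of_nonneg_left hs (show 0 ≤ 1 + |t - τ| by positivity)
              nlinarith [abs_nonneg t, abs_nonneg (t - τ), mul_nonneg (abs_nonneg t) (abs_nonneg (t - τ))]
          _ = (1 + |t - τ|) ^ (1 / 20 : ℝ) * (11 ^ (1 / 20 : ℝ) *
              ‖(((1 / 10 : ℝ) : ℂ) + t * I)‖ ^ (1 / 20 : ℝ)) := by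
              rw [Real.mul_rpow (by positivity) (by positivity),
                Real.mul_rpow (by positivity) (by positivity)]
          _ ≤ _ := mul_le_mul_of_nonneg_left
              (mul_le_mul_of_nonneg_right h11 (by positivity)) (by positivity)
      calc _ ≤ (1 + |t - τ|) ^ (1 / 20 : ℝ) *
          (20 * ‖(((1 / 10 : ℝ) : ℂ) + t * I)‖ ^ (1 / 20 : ℝ)) * (1 + (t - τ) ^ 2)⁻¹ :=
            mul_le_mul_of_nonneg_right h5 (by positivity)
        _ = _ := by ring
    refine (lintegral_mono hpt).trans (le_of_eq ?_)
    rw [lintegral_mul_const _ (by fun_prop), lintegral_sub_left_eq_self (fun w : ℝ =>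
      ENNReal.ofReal ((1 + |w|) ^ (1 / 20 : ℝ) * (1 + w ^ 2)⁻¹)) t]
  refine ne_top_of_le_ne_top ?_ (lintegral_mono hin)
  rw [lintegral_const_mul _ (by fun_prop), lintegral_const_mul _ (by fun_prop)]
  exact ENNReal.mul_ne_top lintegral_rpow_mul_kernel_ne_top
    (ENNReal.mul_ne_top ENNReal.ofReal_ne_top (lintegral_rpow_mul_laplaceSum_ne_top hc hB))

end LocalMean

section Majorant
open MeasureTheory
open scoped ENNReal

theorem norm_laplaceSum_character_le {N : ℕ} [NeZero N] {ψ : DirichletCharacter ℂ N} (hψ : ψ ≠ 1)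
    {s : ℂ} (hs : 0 < s.re) : ‖laplaceSum (fun n => ψ n) s‖ ≤ (N + 1) / s.re := by
  have hs0 : s ≠ 0 := fun h => by simp [h] at hs
  have h := norm_LFunction_le hψ hs
  rw [LFunction_eq_mul_laplace hψ hs, norm_mul, mul_comm, mul_div_right_comm] at h
  exact le_of_mul_le_mul_right h (norm_pos_iff.2 hs0)

theorem localMean_character_ne_top {N : ℕ} [NeZero N] {ψ : DirichletCharacter ℂ N} (hψ : ψ ≠ 1) :
    ∀ τ, localMean (fun n => ψ n) τ ≤ ENNReal.ofReal (Real.pi * (10 * (N + 1)) ^ 2) := by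
  intro τ
  have h : ∀ t : ℝ, ENNReal.ofReal ((1 + (t - τ) ^ 2)⁻¹) *
      ‖laplaceSum (fun n => ψ n) ((1 / 10 : ℝ) + t * I)‖ₑ ^ 2 ≤
      ENNReal.ofReal ((1 + (t - τ) ^ 2)⁻¹) * ENNReal.ofReal ((10 * (N + 1)) ^ 2) := by
    intro t
    refine mul_le_mul_right ?_ _
    rw [← ofReal_norm, ← ENNReal.ofReal_pow (norm_nonneg _)]
    refine ENNReal.ofReal_le_ofReal (pow_le_pow_left₀ (norm_nonneg _) ?_ 2)
    have h := norm_laplaceSum_character_le hψ (s := (1 / 10 : ℝ) + t * I) (by simp)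
    refine h.trans (le_of_eq ?_)
    have h3 : (((1 / 10 : ℝ) : ℂ) + t * I).re = 1 / 10 := by simp
    rw [h3]; ring
  refine (lintegral_mono h).trans (le_of_eq ?_)
  rw [lintegral_mul_const _ (by fun_prop), lintegral_one_add_sub_sq_inv,
    ENNReal.ofReal_mul Real.pi_pos.le]

/-- A local majorant for the product of two `L`-functions, small in mean. -/
theorem exists_majorant {N₁ N₂ : ℕ} [NeZero N₁] [NeZero N₂] {ψ₁ : DirichletCharacter ℂ N₁}
    {ψ₂ : DirichletCharacter ℂ N₂} (h₁ : ψ₁ ≠ 1) (h₂ : ψ₂ ≠ 1) :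
    ∃ (M : ℝ → ℝ) (C : ℝ), (∀ τ, 0 ≤ M τ ∧ M τ ≤ C * (3 + |τ|) ^ 2) ∧
      (∀ τ : ℝ, ∀ z : ℂ, ‖z - (2 + τ * I)‖ ≤ 9 / 5 →
        ‖ψ₁.LFunction z * ψ₂.LFunction z‖ ≤ M τ) ∧
      ∫⁻ τ : ℝ, ENNReal.ofReal ((3 + |τ|) ^ (1 / 20 - 2 : ℝ) * M τ) ≠ ⊤ := by
  set E₁ := localMean (fun n => ψ₁ n) with hE₁
  set E₂ := localMean (fun n => ψ₂ n) with hE₂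
  set K : ℝ := 3600 ^ 2 * Real.pi with hK
  have hK0 : 0 ≤ K := by positivity
  have b₁ := localMean_character_ne_top h₁
  have b₂ := localMean_character_ne_top h₂
  have f₁ : ∀ τ, E₁ τ ≠ ⊤ := fun τ => ne_top_of_le_ne_top ENNReal.ofReal_ne_top (b₁ τ)
  have f₂ : ∀ τ, E₂ τ ≠ ⊤ := fun τ => ne_top_of_le_ne_top ENNReal.ofReal_ne_top (b₂ τ)
  have key : ∀ (N : ℕ) [NeZero N] (ψ : DirichletCharacter ℂ N), ψ ≠ 1 → ∀ (τ : ℝ) (z : ℂ),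
      ‖z - (2 + τ * I)‖ ≤ 9 / 5 →
      ‖ψ.LFunction z‖ ^ 2 ≤ 4 * K * (3 + |τ|) ^ 2 * (localMean (fun n => ψ n) τ).toReal := by
    intro N _ ψ hψ τ z hz
    have hre := (Complex.abs_re_le_norm _).trans hz
    have him := (Complex.abs_im_le_norm _).trans hz
    simp at hre him
    have hre' := abs_le.1 hre
    have hz1 : 1 / 5 ≤ z.re := by linarith [hre'.1]
    have hz2 : z.re ≤ 4 := by linarith [hre'.2]
    have h := enorm_laplaceSum_sq_le (norm_expSum_character_le hψ) hz1 hz2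
      (him.trans (by norm_num))
    have hf : localMean (fun n => ψ n) τ ≠ ⊤ :=
      ne_top_of_le_ne_top ENNReal.ofReal_ne_top (localMean_character_ne_top hψ τ)
    have h' : ‖laplaceSum (fun n => ψ n) z‖ ^ 2 ≤ K * (localMean (fun n => ψ n) τ).toReal := by
      rw [← ofReal_norm, ← ENNReal.ofReal_pow (norm_nonneg _), ← ENNReal.ofReal_toReal hf,
        ← ENNReal.ofReal_mul hK0, ENNReal.ofReal_le_ofReal_iff (by positivity)] at h
      exact h
    have hn : ‖z‖ ≤ 2 * (3 + |τ|) := by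
      have := norm_add_le (z - (2 + τ * I)) (2 + τ * I)
      rw [sub_add_cancel] at this
      have h2 : ‖(2 + τ * I : ℂ)‖ ≤ 2 + |τ| := by
        refine (norm_add_le _ _).trans ?_
        simp
      linarith [abs_nonneg τ]
    rw [LFunction_eq_mul_laplace hψ (by linarith), norm_mul, mul_pow]
    calc _ ≤ (2 * (3 + |τ|)) ^ 2 * (K * (localMean (fun n => ψ n) τ).toReal) :=
          mul_le_mul (pow_le_pow_left₀ (norm_nonneg _) hn 2) h' (by positivity) (by positivity)
      _ = _ := by ring
  refine ⟨fun τ => 4 * K * (3 + |τ|) ^ 2 * (E₁ τ + E₂ τ).toReal,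
    4 * K * (Real.pi * (10 * (N₁ + 1)) ^ 2 + Real.pi * (10 * (N₂ + 1)) ^ 2),
    fun τ => ⟨by positivity, ?_⟩, ?_, ?_⟩
  · have h3 : (E₁ τ + E₂ τ).toReal ≤
        Real.pi * (10 * (N₁ + 1)) ^ 2 + Real.pi * (10 * (N₂ + 1)) ^ 2 := by
      refine ENNReal.toReal_le_of_le_ofReal (by positivity) ?_
      rw [ENNReal.ofReal_add (by positivity) (by positivity)]
      exact add_le_add (b₁ τ) (b₂ τ)
    calc _ ≤ 4 * K * (3 + |τ|) ^ 2 *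
          (Real.pi * (10 * (N₁ + 1)) ^ 2 + Real.pi * (10 * (N₂ + 1)) ^ 2) :=
          mul_le_mul_of_nonneg_left h3 (by positivity)
      _ = _ := by ring
  · intro τ z hz
    have k₁ := key N₁ ψ₁ h₁ τ z hz
    have k₂ := key N₂ ψ₂ h₂ τ z hz
    change _ ≤ 4 * K * (3 + |τ|) ^ 2 * (E₁ τ + E₂ τ).toReal
    rw [norm_mul, ENNReal.toReal_add (f₁ τ) (f₂ τ), mul_add]
    nlinarith [sq_nonneg (‖ψ₁.LFunction z‖ - ‖ψ₂.LFunction z‖), sq_nonneg ‖ψ₁.LFunction z‖,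
      sq_nonneg ‖ψ₂.LFunction z‖]
  · have hpt : ∀ τ : ℝ, ENNReal.ofReal ((3 + |τ|) ^ (1 / 20 - 2 : ℝ) *
        (4 * K * (3 + |τ|) ^ 2 * (E₁ τ + E₂ τ).toReal)) ≤ ENNReal.ofReal (12 * K) *
        (ENNReal.ofReal ((1 + |τ|) ^ (1 / 20 : ℝ)) * E₁ τ +
          ENNReal.ofReal ((1 + |τ|) ^ (1 / 20 : ℝ)) * E₂ τ) := by
      intro τ
      have h0 : 0 < 3 + |τ| := by positivity
      rw [← mul_add, ← mul_assoc]
      have hE : E₁ τ + E₂ τ = ENNReal.ofReal (E₁ τ + E₂ τ).toReal :=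
        (ENNReal.ofReal_toReal (ENNReal.add_ne_top.2 ⟨f₁ τ, f₂ τ⟩)).symm
      conv_rhs => rw [hE]
      rw [← ENNReal.ofReal_mul (show 0 ≤ (1 + |τ|) ^ (1 / 20 : ℝ) by positivity),
        ← ENNReal.ofReal_mul (show 0 ≤ 12 * K by positivity)]
      refine ENNReal.ofReal_le_ofReal ?_
      rw [← mul_assoc (12 * K)]
      refine mul_le_mul_of_nonneg_right ?_ (by positivity)
      have e : (3 + |τ|) ^ (1 / 20 - 2 : ℝ) * (3 + |τ|) ^ 2 = (3 + |τ|) ^ (1 / 20 : ℝ) := by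
        rw [Real.rpow_sub h0, Real.rpow_two]; field_simp
      have h13 : (3 + |τ|) ^ (1 / 20 : ℝ) ≤ 3 * (1 + |τ|) ^ (1 / 20 : ℝ) := by
        calc (3 + |τ|) ^ (1 / 20 : ℝ) ≤ (3 * (1 + |τ|)) ^ (1 / 20 : ℝ) :=
              Real.rpow_le_rpow h0.le (by linarith [abs_nonneg τ]) (by norm_num)
          _ = 3 ^ (1 / 20 : ℝ) * (1 + |τ|) ^ (1 / 20 : ℝ) :=
              Real.mul_rpow (by norm_num) (by positivity)
          _ ≤ 3 ^ (1 : ℝ) * (1 + |τ|) ^ (1 / 20 : ℝ) := mul_le_mul_of_nonneg_right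
              (Real.rpow_le_rpow_of_exponent_le (by norm_num) (by norm_num)) (by positivity)
          _ = _ := by rw [Real.rpow_one]
      calc (3 + |τ|) ^ (1 / 20 - 2 : ℝ) * (4 * K * (3 + |τ|) ^ 2)
          = 4 * K * ((3 + |τ|) ^ (1 / 20 - 2 : ℝ) * (3 + |τ|) ^ 2) := by ring
        _ ≤ 4 * K * (3 * (1 + |τ|) ^ (1 / 20 : ℝ)) := by
            rw [e]; exact mul_le_mul_of_nonneg_left h13 (by positivity)
        _ = _ := by ring
    have m₁ := measurable_localMean (norm_expSum_character_le h₁)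
    have m₂ := measurable_localMean (norm_expSum_character_le h₂)
    refine ne_top_of_le_ne_top ?_ (lintegral_mono hpt)
    rw [lintegral_const_mul _ (by fun_prop), lintegral_add_left (by fun_prop)]
    exact ENNReal.mul_ne_top ENNReal.ofReal_ne_top (ENNReal.add_ne_top.2
      ⟨lintegral_rpow_mul_localMean_ne_top (fun n => ψ₁.norm_le_one _)
        (norm_expSum_character_le h₁),
      lintegral_rpow_mul_localMean_ne_top (fun n => ψ₂.norm_le_one _)
        (norm_expSum_character_le h₂)⟩)

end Majorant

section HalfPlaneBounds

theorem exists_norm_LSeries_le {σ : ℝ} (hσ : 1 < σ) : ∃ C : ℝ, 1 ≤ C ∧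
    ∀ c : ℕ → ℂ, (∀ n, ‖c n‖ ≤ 1) → ∀ s : ℂ, σ ≤ s.re → ‖LSeries c s‖ ≤ C := by
  refine ⟨1 + ∑' n : ℕ, 1 / (n : ℝ) ^ σ, ?_, fun c hc s hs => ?_⟩
  · have : 0 ≤ ∑' n : ℕ, 1 / (n : ℝ) ^ σ := tsum_nonneg fun n => by positivity
    linarith
  have hsum := Real.summable_one_div_nat_rpow.2 hσ
  have hle : ∀ n, ‖LSeries.term c s n‖ ≤ 1 / (n : ℝ) ^ σ := by
    intro n
    rcases eq_or_ne n 0 with rfl | hn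
    · simp only [LSeries.term_zero, norm_zero]; positivity
    have h1 : (1 : ℝ) ≤ n := by exact_mod_cast Nat.one_le_iff_ne_zero.2 hn
    rw [LSeries.norm_term_eq, if_neg hn]
    exact div_le_div₀ zero_le_one (hc n) (Real.rpow_pos_of_pos (by linarith) _)
      (Real.rpow_le_rpow_of_exponent_le h1 hs)
  have := tsum_of_norm_bounded hsum.hasSum hle
  exact this.trans (by linarith)

theorem exists_norm_LFunction_le {σ : ℝ} (hσ : 1 < σ) : ∃ C : ℝ, 1 ≤ C ∧
    ∀ (N : ℕ) [NeZero N] (ψ : DirichletCharacter ℂ N) (s : ℂ), σ ≤ s.re →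
      ‖ψ.LFunction s‖ ≤ C ∧ ‖(ψ.LFunction s)⁻¹‖ ≤ C := by
  obtain ⟨C, hC, h⟩ := exists_norm_LSeries_le hσ
  refine ⟨C, hC, fun N _ ψ s hs => ?_⟩
  have hs1 : 1 < s.re := hσ.trans_le hs
  rw [DirichletCharacter.LFunction_eq_LSeries ψ hs1]
  refine ⟨h _ (fun n => ψ.norm_le_one _) s hs, ?_⟩
  rw [inv_eq_of_mul_eq_one_right (DirichletCharacter.LSeries.mul_mu_eq_one ψ hs1)]
  refine h _ (fun n => ?_) s hs
  rw [Pi.mul_apply, norm_mul]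
  refine mul_le_one₀ (ψ.norm_le_one _) (norm_nonneg _) ?_
  have := ArithmeticFunction.abs_moebius_le_one (n := n)
  rw [Complex.norm_intCast]
  exact_mod_cast this

theorem one_le_log_three_add (t : ℝ) : 1 ≤ Real.log (3 + |t|) := by
  rw [Real.le_log_iff_exp_le (by positivity)]
  linarith [Real.exp_one_lt_d9, abs_nonneg t]

theorem log_mul_pow_add_one_le {A x : ℝ} {k : ℕ} (hA : 0 < A) (t : ℝ) (hx : 0 < x)
    (hxA : x ≤ A * (3 + |t|) ^ k) :
    Real.log x + 1 ≤ (|Real.log A| + k + 1) * Real.log (3 + |t|) := by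
  have h1 := one_le_log_three_add t
  have h0 : 0 < 3 + |t| := by positivity
  have h2 := Real.log_le_log hx hxA
  rw [Real.log_mul hA.ne' (by positivity), Real.log_pow] at h2
  nlinarith [le_abs_self (Real.log A), abs_nonneg (Real.log A)]

/-- Around `2 + iτ` the logarithmic derivative of a function of polynomial growth, with zeros of real
part at most `1/2`, is a short sum over zeros up to a logarithmic error. -/
theorem exists_logDeriv_expansion {g : ℂ → ℂ} (hg : Differentiable ℂ g) {m A : ℝ} {M : ℝ → ℝ}
    (hm : 0 < m) (hgm : ∀ τ : ℝ, m ≤ ‖g (2 + τ * I)‖)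
    (hM : ∀ (τ : ℝ) (z : ℂ), ‖z - (2 + τ * I)‖ ≤ 9 / 5 → ‖g z‖ ≤ M τ)
    (hMA : ∀ τ, M τ ≤ A * (3 + |τ|) ^ 2) (hz : ∀ z, g z = 0 → z.re ≤ 1 / 2) :
    ∃ K : ℝ, 0 < K ∧ ∀ τ : ℝ, ∃ (n : ℕ) (ρ : Fin n → ℂ) (h : ℂ → ℂ),
      (n : ℝ) ≤ K * Real.log (3 + |τ|) ∧ (∀ i, (ρ i).re ≤ 1 / 2) ∧
      (∀ i z, ‖z - (2 + τ * I)‖ ≤ 8 / 5 → ‖g z‖ ≤ K * M τ * ‖z - ρ i‖) ∧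
      ∀ z, ‖z - (2 + τ * I)‖ < 8 / 5 → 1 / 2 < z.re →
        ‖h z‖ ≤ K * Real.log (3 + |τ|) ∧ ‖deriv h z‖ ≤ K * Real.log (3 + |τ|) ∧
        logDeriv g z = ∑ i, 1 / (z - ρ i) + h z ∧
        deriv (logDeriv g) z = ∑ i, -1 / (z - ρ i) ^ 2 + deriv h z := by
  obtain ⟨C, hC, key⟩ := exists_local_partial_fraction
  have hMm : ∀ τ, m ≤ M τ := fun τ => (hgm τ).trans (hM τ _ (by simp; norm_num))
  have hA : 0 < A := by
    have := (hMm 0).trans (hMA 0)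
    by_contra hA
    have : A * (3 + |(0 : ℝ)|) ^ 2 ≤ 0 := mul_nonpos_of_nonpos_of_nonneg (not_lt.1 hA) (by positivity)
    linarith
  set K := C + C * (|Real.log (A / m)| + (2 : ℕ) + 1) with hK
  have hK2 : C * (|Real.log (A / m)| + (2 : ℕ) + 1) ≤ K := by linarith
  refine ⟨K, by positivity, fun τ => ?_⟩
  obtain ⟨n, ρ, h, h1, h2, h3, h4, h5⟩ := key g (2 + τ * I) m (M τ) hg (hM τ) hm (hgm τ)
  have hL : C * (Real.log (M τ / m) + 1) ≤ K * Real.log (3 + |τ|) := by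
    have hMp : 0 < M τ := hm.trans_le (hMm τ)
    have := log_mul_pow_add_one_le (A := A / m) (k := 2) (x := M τ / m) (by positivity) τ
      (by positivity) (by rw [div_mul_eq_mul_div]; exact div_le_div_of_nonneg_right (hMA τ) hm.le)
    calc _ ≤ C * ((|Real.log (A / m)| + (2 : ℕ) + 1) * Real.log (3 + |τ|)) :=
          mul_le_mul_of_nonneg_left this hC.le
      _ ≤ _ := by
          rw [← mul_assoc]
          exact mul_le_mul_of_nonneg_right hK2 (by linarith [one_le_log_three_add τ])
  refine ⟨n, ρ, h, h1.trans hL, fun i => hz _ (h2 i), fun i z hzc => ?_, fun z hzc hre => ?_⟩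
  · refine (h3 i z hzc).trans (mul_le_mul_of_nonneg_right ?_ (norm_nonneg _))
    have hCK : C ≤ K := le_add_of_nonneg_right (by positivity)
    exact mul_le_mul_of_nonneg_right hCK (hm.le.trans (hMm τ))
  have hne : ∀ w : ℂ, 1 / 2 < w.re → g w ≠ 0 := fun w hw h0 => by linarith [hz w h0]
  obtain ⟨a1, a2, a3⟩ := h4 z hzc.le
  refine ⟨a2.trans hL, a3.trans hL, h5 z hzc.le (hne z hre), ?_⟩
  have hev : logDeriv g =ᶠ[nhds z] fun w => ∑ i, 1 / (w - ρ i) + h w := by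
    have o1 : IsOpen {w : ℂ | ‖w - (2 + τ * I)‖ < 8 / 5} :=
      isOpen_lt (by fun_prop) continuous_const
    have o2 : IsOpen {w : ℂ | 1 / 2 < w.re} := isOpen_lt continuous_const continuous_re
    filter_upwards [o1.mem_nhds hzc, o2.mem_nhds hre] with w hw1 hw2
    exact h5 w (le_of_lt hw1) (hne w hw2)
  rw [hev.deriv_eq]
  refine HasDerivAt.deriv (HasDerivAt.add (HasDerivAt.fun_sum fun i _ => ?_) a1.hasDerivAt)
  have hzi : z - ρ i ≠ 0 := fun h0 => by
    have := hz _ (h2 i)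
    rw [← sub_eq_zero.1 h0] at this
    linarith
  simp only [one_div]
  exact ((hasDerivAt_id' z).sub_const (ρ i)).fun_inv hzi

end HalfPlaneBounds

section EdgeBounds

/-- The Riemann hypothesis for `ψ`, as a bound for the real parts of all zeros. -/
theorem re_le_half_of_LFunction_eq_zero {N : ℕ} [NeZero N] {ψ : DirichletCharacter ℂ N}
    (hψ : ψ ≠ 1) (hG : ∀ s : ℂ, 0 < s.re → s.re < 1 → ψ.LFunction s = 0 → s.re = 1 / 2) (s : ℂ)
    (hs : ψ.LFunction s = 0) : s.re ≤ 1 / 2 := by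
  by_contra! h
  rcases lt_or_ge s.re 1 with h1 | h1
  · linarith [hG s (by linarith) h1 hs]
  · exact DirichletCharacter.LFunction_ne_zero_of_one_le_re ψ (Or.inl hψ) h1 hs

theorem exists_norm_logDeriv_LFunction_le {N : ℕ} [NeZero N] {ψ : DirichletCharacter ℂ N}
    (hψ : ψ ≠ 1) (hz : ∀ s, ψ.LFunction s = 0 → s.re ≤ 1 / 2) :
    ∃ K : ℝ, 0 < K ∧ ∀ w : ℂ, 1 ≤ w.re → w.re ≤ 3 →
      ‖logDeriv ψ.LFunction w‖ ≤ K * Real.log (3 + |w.im|) ∧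
      ‖deriv (logDeriv ψ.LFunction) w‖ ≤ K * Real.log (3 + |w.im|) := by
  obtain ⟨B, hB, hb⟩ := exists_norm_LFunction_le (σ := 2) (by norm_num)
  obtain ⟨K, hK, key⟩ := exists_logDeriv_expansion (g := ψ.LFunction) (m := B⁻¹)
    (A := 10 * (N + 1)) (M := fun τ => 10 * (N + 1) * (3 + |τ|) ^ 2)
    (DirichletCharacter.differentiable_LFunction hψ) (by positivity) (fun τ => by
      have h := (hb N ψ (2 + τ * I) (by simp)).2
      rw [norm_inv] at h
      have h0 : 0 < ‖ψ.LFunction (2 + τ * I)‖ := norm_pos_iff.2 fun h0 => by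
        have := hz _ h0
        simp at this
        linarith
      exact inv_le_of_inv_le₀ h0 h) (fun τ z hzc => by
      have hre := (Complex.abs_re_le_norm _).trans hzc
      simp at hre
      have hz1 : 1 / 5 ≤ z.re := by linarith [(abs_le.1 hre).1]
      have hn : ‖z‖ ≤ 2 * (3 + |τ|) := by
        have := norm_add_le (z - (2 + τ * I)) (2 + τ * I)
        rw [sub_add_cancel] at this
        have h2 : ‖(2 + τ * I : ℂ)‖ ≤ 2 + |τ| := by
          refine (norm_add_le _ _).trans ?_
          simp
        linarith [abs_nonneg τ]
      refine (norm_LFunction_le hψ (by linarith)).trans ?_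
      rw [div_le_iff₀ (by linarith)]
      have h3 : (1 : ℝ) ≤ 3 + |τ| := by linarith [abs_nonneg τ]
      calc ((N : ℝ) + 1) * ‖z‖ ≤ (N + 1) * (2 * (3 + |τ|)) :=
            mul_le_mul_of_nonneg_left hn (by positivity)
        _ ≤ (N + 1) * (2 * (3 + |τ|) ^ 2) := by
            refine mul_le_mul_of_nonneg_left ?_ (by positivity)
            nlinarith
        _ = 10 * (N + 1) * (3 + |τ|) ^ 2 * (1 / 5) := by ring
        _ ≤ _ := mul_le_mul_of_nonneg_left hz1 (by positivity)) (fun τ => le_rfl) hz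
  refine ⟨5 * K, by positivity, fun w h1 h3 => ?_⟩
  obtain ⟨n, ρ, h, hn, hρ, -, hw⟩ := key w.im
  have hwc : ‖w - (2 + w.im * I)‖ < 8 / 5 := by
    have : w - (2 + w.im * I) = ((w.re - 2 : ℝ) : ℂ) := by
      apply Complex.ext <;> simp
    rw [this, Complex.norm_real, Real.norm_eq_abs]
    exact (abs_le.2 ⟨by linarith, by linarith⟩ : |w.re - 2| ≤ 1).trans_lt (by norm_num)
  obtain ⟨k1, k2, k3, k4⟩ := hw w hwc (by linarith)
  have hd : ∀ i, 1 / 2 ≤ ‖w - ρ i‖ := fun i => by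
    have := (le_abs_self _).trans (Complex.abs_re_le_norm (w - ρ i))
    rw [sub_re] at this
    linarith [hρ i]
  have hd1 : ∀ i, ‖1 / (w - ρ i)‖ ≤ 2 := fun i => by
    rw [norm_div, norm_one, div_le_iff₀ (by linarith [hd i])]
    linarith [hd i]
  have hd2 : ∀ i, ‖-1 / (w - ρ i) ^ 2‖ ≤ 4 := fun i => by
    rw [norm_div, norm_neg, norm_one, norm_pow, div_le_iff₀ (by nlinarith [hd i])]
    nlinarith [hd i]
  have hL := one_le_log_three_add w.im
  constructor
  · rw [k3]
    refine (norm_add_le _ _).trans ?_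
    have := norm_sum_le_of_le Finset.univ fun i _ => hd1 i
    simp only [Finset.sum_const, Finset.card_univ, Fintype.card_fin, nsmul_eq_mul] at this
    nlinarith
  · rw [k4]
    refine (norm_add_le _ _).trans ?_
    have := norm_sum_le_of_le Finset.univ fun i _ => hd2 i
    simp only [Finset.sum_const, Finset.card_univ, Fintype.card_fin, nsmul_eq_mul] at this
    nlinarith

/-- A function whose logarithmic derivative is bounded on a horizontal segment grows at most
exponentially to the left along it. -/
theorem norm_le_of_norm_logDeriv_le {g : ℂ → ℂ} {w : ℂ} {ℓ κ C : ℝ} (hℓ : 0 ≤ ℓ)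
    (hd : ∀ x : ℝ, 0 ≤ x → x ≤ ℓ → DifferentiableAt ℂ g (w + x) ∧ g (w + x) ≠ 0 ∧
      ‖logDeriv g (w + x)‖ ≤ κ) (hC : ‖g (w + ℓ)‖ ≤ C) : ‖g w‖ ≤ C * Real.exp (κ * ℓ) := by
  set f : ℝ → ℂ := fun x => g (w + ((ℓ - x : ℝ) : ℂ)) with hf
  have hder : ∀ x : ℝ, 0 ≤ x → x ≤ ℓ →
      HasDerivAt f (-deriv g (w + ((ℓ - x : ℝ) : ℂ))) x := by
    intro x h0 h1
    have hg := (hd (ℓ - x) (by linarith) (by linarith)).1.hasDerivAt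
    have hlin : HasDerivAt (fun x : ℝ => w + ((ℓ - x : ℝ) : ℂ)) (-1) x := by
      have := ((hasDerivAt_id' x).const_sub ℓ).ofReal_comp.const_add w
      simpa using this
    simpa [hf, Function.comp_def] using hg.comp x hlin
  have := norm_le_gronwallBound_of_norm_deriv_right_le (f := f)
    (f' := fun x => -deriv g (w + ((ℓ - x : ℝ) : ℂ))) (δ := C) (K := κ) (ε := 0) (a := 0) (b := ℓ)
    (fun x hx => (hder x hx.1 hx.2).continuousAt.continuousWithinAt)
    (fun x hx => (hder x hx.1 hx.2.le).hasDerivWithinAt) (by simpa [hf] using hC)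
    (fun x hx => by
      obtain ⟨-, h2, h3⟩ := hd (ℓ - x) (by linarith [hx.2]) (by linarith [hx.1])
      rw [logDeriv_apply, norm_div, div_le_iff₀ (norm_pos_iff.2 h2)] at h3
      simpa [hf] using h3) ℓ ⟨hℓ, le_rfl⟩
  rw [gronwallBound_ε0] at this
  simpa [hf] using this

theorem exists_norm_LFunction_le_rpow {N : ℕ} [NeZero N] {ψ : DirichletCharacter ℂ N}
    (hψ : ψ ≠ 1) (hz : ∀ s, ψ.LFunction s = 0 → s.re ≤ 1 / 2) {δ : ℝ} (hδ : 0 < δ) :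
    ∃ C : ℝ, 1 ≤ C ∧ ∀ w : ℂ, 1 < w.re →
      ‖ψ.LFunction w‖ ≤ C * (3 + |w.im|) ^ δ ∧ ‖(ψ.LFunction w)⁻¹‖ ≤ C * (3 + |w.im|) ^ δ := by
  obtain ⟨K, hK, hk⟩ := exists_norm_logDeriv_LFunction_le hψ hz
  set l := min 1 (δ / K) with hl
  have hl0 : 0 < l := lt_min one_pos (by positivity)
  have hlK : K * l ≤ δ := by
    have := min_le_right 1 (δ / K)
    rw [← hl, le_div_iff₀ hK] at this
    linarith
  obtain ⟨C, hC, hb⟩ := exists_norm_LFunction_le (σ := 1 + l) (by linarith)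
  refine ⟨C, hC, fun w hw => ?_⟩
  have h3 : 0 < 3 + |w.im| := by positivity
  have hp : 1 ≤ (3 + |w.im|) ^ δ :=
    Real.one_le_rpow (by linarith [abs_nonneg w.im]) hδ.le
  rcases le_or_gt (1 + l) w.re with h | h
  · obtain ⟨b1, b2⟩ := hb N ψ w h
    exact ⟨b1.trans (le_mul_of_one_le_right (by linarith) hp),
      b2.trans (le_mul_of_one_le_right (by linarith) hp)⟩
  obtain ⟨b1, b2⟩ := hb N ψ (w + ((1 + l - w.re : ℝ) : ℂ)) (by simp)
  have hlog := one_le_log_three_add w.im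
  have hexp : Real.exp (K * Real.log (3 + |w.im|) * (1 + l - w.re)) ≤ (3 + |w.im|) ^ δ := by
    rw [Real.rpow_def_of_pos h3]
    refine Real.exp_le_exp.2 ?_
    have : K * (1 + l - w.re) ≤ δ := by nlinarith
    nlinarith
  have hd : ∀ x : ℝ, 0 ≤ x → x ≤ 1 + l - w.re → ψ.LFunction (w + x) ≠ 0 ∧
      ‖logDeriv ψ.LFunction (w + x)‖ ≤ K * Real.log (3 + |w.im|) := by
    intro x h0 h1
    refine ⟨fun h => ?_, ?_⟩
    · have := hz _ h
      simp at this
      linarith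
    · have := (hk (w + x) (by simp; linarith) (by
        simp
        linarith [min_le_left 1 (δ / K)])).1
      simpa using this
  have hdiff := DirichletCharacter.differentiable_LFunction hψ
  constructor
  · refine (norm_le_of_norm_logDeriv_le (ℓ := 1 + l - w.re) (κ := K * Real.log (3 + |w.im|))
      (by linarith) (fun x h0 h1 => ⟨hdiff _, hd x h0 h1⟩) b1).trans ?_
    exact mul_le_mul_of_nonneg_left hexp (by linarith)
  · refine (norm_le_of_norm_logDeriv_le (g := (ψ.LFunction)⁻¹) (ℓ := 1 + l - w.re)
      (κ := K * Real.log (3 + |w.im|)) (by linarith) (fun x h0 h1 => ?_) b2).trans ?_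
    · obtain ⟨e1, e2⟩ := hd x h0 h1
      refine ⟨(hdiff _).inv e1, inv_ne_zero e1, ?_⟩
      have : logDeriv (ψ.LFunction)⁻¹ (w + x) = -logDeriv ψ.LFunction (w + x) := by
        rw [logDeriv_apply, logDeriv_apply, ((hdiff _).hasDerivAt.inv e1).deriv, Pi.inv_apply]
        field_simp
      rw [this, norm_neg]
      exact e2
    exact mul_le_mul_of_nonneg_left hexp (by linarith)

end EdgeBounds

section EulerProduct

theorem changeLevel_natCast {N M : ℕ} (h : N ∣ M) (ψ : DirichletCharacter ℂ N) {n : ℕ}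
    (hn : n.Coprime M) : DirichletCharacter.changeLevel h ψ (n : ZMod M) = ψ (n : ZMod N) := by
  have := DirichletCharacter.changeLevel_eq_cast_of_dvd' ψ h (a := n)
    (Nat.isCoprime_iff_coprime.2 hn)
  simpa using this

theorem mulChiNeg4_natCast {q : ℕ} (χ : DirichletCharacter ℂ q) (n : ℕ) :
    mulChiNeg4 χ (n : ZMod (4 * q)) = χ (n : ZMod q) * (ZMod.χ₄ (n : ZMod 4) : ℂ) := by
  by_cases h : n.Coprime (4 * q)
  · rw [mulChiNeg4, MulChar.mul_apply, changeLevel_natCast _ _ h, changeLevel_natCast _ _ h]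
    simp [chiNeg4]
  · rw [MulChar.map_nonunit _ (fun hu => h ((ZMod.isUnit_iff_coprime _ _).1 hu))]
    rw [Nat.coprime_mul_iff_right, not_and_or] at h
    rcases h with h | h
    · rw [MulChar.map_nonunit ZMod.χ₄ (fun hu => h ((ZMod.isUnit_iff_coprime _ _).1 hu))]
      simp
    · rw [MulChar.map_nonunit χ (fun hu => h ((ZMod.isUnit_iff_coprime _ _).1 hu)), zero_mul]

theorem isSum2Sq_iff {n : ℕ} :
    IsSum2Sq n ↔ ∀ p ∈ n.primeFactors, p % 4 = 3 → Even (padicValNat p n) :=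
  Nat.eq_sq_add_sq_iff

theorem isSum2Sq_mul_iff {m n : ℕ} (h : m.Coprime n) :
    IsSum2Sq (m * n) ↔ IsSum2Sq m ∧ IsSum2Sq n := by
  have left : ∀ {m n : ℕ}, m.Coprime n → IsSum2Sq (m * n) → IsSum2Sq m := by
    intro m n h hmn
    rcases eq_or_ne m 0 with rfl | hm
    · exact ⟨0, 0, by simp⟩
    rcases eq_or_ne n 0 with rfl | hn
    · rw [Nat.coprime_zero_right] at h
      exact ⟨1, 0, by simp [h]⟩
    rw [isSum2Sq_iff] at hmn ⊢
    intro p hp hp4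
    have hpp := Nat.prime_of_mem_primeFactors hp
    have := Fact.mk hpp
    have hv := hmn p (Nat.primeFactors_mono (Dvd.intro _ rfl) (mul_ne_zero hm hn) hp) hp4
    rwa [padicValNat.mul hm hn, padicValNat.eq_zero_of_not_dvd (n := n), add_zero] at hv
    exact fun hd => hpp.one_lt.ne' (Nat.eq_one_of_dvd_coprimes h
      (Nat.dvd_of_mem_primeFactors hp) hd)
  refine ⟨fun H => ⟨left h H, left h.symm (by rwa [mul_comm])⟩, ?_⟩
  rintro ⟨⟨a, b, ha⟩, ⟨c, d, hc⟩⟩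
  exact Nat.sq_add_sq_mul ha hc

theorem isSum2Sq_prime_pow_iff {p : ℕ} (hp : p.Prime) (k : ℕ) :
    IsSum2Sq (p ^ k) ↔ (p % 4 = 3 → Even k) := by
  have := Fact.mk hp
  rw [isSum2Sq_iff]
  rcases eq_or_ne k 0 with rfl | hk
  · simp
  rw [Nat.primeFactors_prime_pow hk hp]
  simp

theorem STwist_mul {q : ℕ} (χ : DirichletCharacter ℂ q) {m n : ℕ} (h : m.Coprime n) :
    STwist χ (m * n) = STwist χ m * STwist χ n := by
  unfold STwist
  rw [isSum2Sq_mul_iff h]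
  by_cases h1 : IsSum2Sq m <;> by_cases h2 : IsSum2Sq n <;> simp [h1, h2]

theorem norm_STwist_le {q : ℕ} (χ : DirichletCharacter ℂ q) (n : ℕ) : ‖STwist χ n‖ ≤ 1 := by
  unfold STwist
  split_ifs
  · exact χ.norm_le_one _
  · simp

theorem hasSum_STwist_prime_pow {q : ℕ} (χ : DirichletCharacter ℂ q) {p : ℕ} (hp : p.Prime)
    (s : ℂ) (hy : ‖χ p * (p : ℂ) ^ (-s)‖ < 1) :
    HasSum (fun k : ℕ => STwist χ (p ^ k) * ((p ^ k : ℕ) : ℂ) ^ (-s))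
      (if p % 4 = 3 then (1 - (χ p * (p : ℂ) ^ (-s)) ^ 2)⁻¹
        else (1 - χ p * (p : ℂ) ^ (-s))⁻¹) := by
  set y := χ p * (p : ℂ) ^ (-s) with hydef
  have hf : ∀ k : ℕ, STwist χ (p ^ k) * ((p ^ k : ℕ) : ℂ) ^ (-s) =
      if (p % 4 = 3 → Even k) then y ^ k else 0 := by
    intro k
    have e : ((p ^ k : ℕ) : ℂ) ^ (-s) = ((p : ℂ) ^ (-s)) ^ k := by
      induction k with
      | zero => simp
      | succ k ih =>
        rw [pow_succ, Nat.cast_mul, Complex.natCast_mul_natCast_cpow, ih, pow_succ]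
    unfold STwist
    rw [isSum2Sq_prime_pow_iff hp]
    split_ifs
    · rw [e, hydef, mul_pow]; simp
    · simp
  by_cases h3 : p % 4 = 3
  · simp only [h3, if_true, true_imp_iff] at hf ⊢
    have he : HasSum (fun k : ℕ => y ^ (2 * k)) (1 - y ^ 2)⁻¹ := by
      simp only [pow_mul]
      exact hasSum_geometric_of_norm_lt_one (by
        rw [norm_pow]; exact pow_lt_one₀ (norm_nonneg _) hy two_ne_zero)
    have := HasSum.even_add_odd (f := fun k : ℕ => STwist χ (p ^ k) * ((p ^ k : ℕ) : ℂ) ^ (-s))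
      (m := (1 - y ^ 2)⁻¹) (m' := 0) (by simp only [hf]; simpa using he)
      (by simp only [hf]; simp [hasSum_zero])
    rwa [add_zero] at this
  · simp only [h3, if_false, false_imp_iff, if_true] at hf ⊢
    simp only [hf]
    exact hasSum_geometric_of_norm_lt_one hy

end EulerProduct

section EulerFactor

/-- The logarithm of the local factor relating the twisted sum of two squares series to
`L`-functions. -/
def eulerLog {q : ℕ} (χ : DirichletCharacter ℂ q) (p : ℕ) (s : ℂ) : ℂ :=
  if p % 4 = 3 then -Complex.log (1 - (χ p * (p : ℂ) ^ (-s)) ^ 4)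
  else if p = 2 then
    Complex.log (1 + χ p * (p : ℂ) ^ (-s)) - Complex.log (1 - χ p * (p : ℂ) ^ (-s))
  else 0

theorem norm_mul_cpow_le {q : ℕ} (χ : DirichletCharacter ℂ q) {p : ℕ} (hp : p.Prime) {κ : ℝ} {s : ℂ}
    (hs : κ ≤ s.re) : ‖χ p * (p : ℂ) ^ (-s)‖ ≤ (p : ℝ) ^ (-κ) := by
  rw [norm_mul, Complex.norm_natCast_cpow_of_pos hp.pos, neg_re]
  have h1 : (1 : ℝ) ≤ p := by exact_mod_cast hp.one_le
  calc _ ≤ 1 * (p : ℝ) ^ (-s.re) :=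
        mul_le_mul_of_nonneg_right (χ.norm_le_one _) (by positivity)
    _ ≤ _ := by
        rw [one_mul]
        exact Real.rpow_le_rpow_of_exponent_le h1 (by linarith)

theorem norm_mul_cpow_lt_one {q : ℕ} (χ : DirichletCharacter ℂ q) {p : ℕ} (hp : p.Prime) {s : ℂ}
    (hs : 0 < s.re) : ‖χ p * (p : ℂ) ^ (-s)‖ < 1 :=
  (norm_mul_cpow_le χ hp le_rfl).trans_lt
    (Real.rpow_lt_one_of_one_lt_of_neg (by exact_mod_cast hp.one_lt) (by linarith))

theorem one_sub_ne_zero_of_norm_lt_one {z : ℂ} (hz : ‖z‖ < 1) : 1 - z ≠ 0 := fun h => by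
  rw [← sub_eq_zero.1 h] at hz
  simp at hz

theorem one_add_ne_zero_of_norm_lt_one {z : ℂ} (hz : ‖z‖ < 1) : 1 + z ≠ 0 := by
  simpa using one_sub_ne_zero_of_norm_lt_one (z := -z) (by simpa using hz)

theorem differentiableAt_eulerLog {q : ℕ} (χ : DirichletCharacter ℂ q) {p : ℕ} (hp : p.Prime) {s : ℂ}
    (hs : 0 < s.re) : DifferentiableAt ℂ (eulerLog χ p) s := by
  have hy := norm_mul_cpow_lt_one χ hp hs
  have hy4 : ‖-(χ p * (p : ℂ) ^ (-s)) ^ 4‖ < 1 := by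
    rw [norm_neg, norm_pow]
    exact pow_lt_one₀ (norm_nonneg _) hy (by norm_num)
  have hd : DifferentiableAt ℂ (fun s : ℂ => χ p * (p : ℂ) ^ (-s)) s :=
    (differentiableAt_id.neg.const_cpow (Or.inl (by exact_mod_cast hp.ne_zero))).const_mul _
  unfold eulerLog
  split_ifs
  · refine (((hd.pow 4).const_sub 1).clog ?_).neg
    rw [sub_eq_add_neg]
    exact mem_slitPlane_of_norm_lt_one hy4
  · refine ((hd.const_add 1).clog (mem_slitPlane_of_norm_lt_one hy)).sub ((hd.const_sub 1).clog ?_)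
    rw [sub_eq_add_neg]
    exact mem_slitPlane_of_norm_lt_one (by rwa [norm_neg])
  · exact differentiableAt_const _

theorem norm_eulerLog_le {q : ℕ} (χ : DirichletCharacter ℂ q) {p : ℕ} (hp : p.Prime) {s : ℂ}
    (hs : 3 / 8 ≤ s.re) : ‖eulerLog χ p s‖ ≤ 20 * (p : ℝ) ^ (-(3 / 2) : ℝ) := by
  have hy := norm_mul_cpow_le χ hp hs
  unfold eulerLog
  split_ifs with h3 h2
  · have hp3 : (3 : ℝ) ≤ p := by
      have : 3 ≤ p := by omega
      exact_mod_cast this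
    have h4 : ‖(χ p * (p : ℂ) ^ (-s)) ^ 4‖ ≤ (p : ℝ) ^ (-(3 / 2) : ℝ) := by
      rw [norm_pow]
      refine (pow_le_pow_left₀ (norm_nonneg _) hy 4).trans (le_of_eq ?_)
      rw [← Real.rpow_natCast, ← Real.rpow_mul (by positivity)]
      norm_num
    have hh : (p : ℝ) ^ (-(3 / 2) : ℝ) ≤ 1 / 2 := by
      calc (p : ℝ) ^ (-(3 / 2) : ℝ) ≤ (p : ℝ) ^ (-1 : ℝ) :=
            Real.rpow_le_rpow_of_exponent_le (by linarith) (by norm_num)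
        _ = (p : ℝ)⁻¹ := Real.rpow_neg_one _
        _ ≤ 1 / 2 := by
            rw [inv_le_comm₀ (by linarith) (by norm_num)]; linarith
    rw [norm_neg, sub_eq_add_neg]
    have := norm_log_one_add_half_le_self (z := -(χ p * (p : ℂ) ^ (-s)) ^ 4)
      (by rw [norm_neg]; linarith)
    rw [norm_neg] at this
    have h0 : 0 ≤ (p : ℝ) ^ (-(3 / 2) : ℝ) := by positivity
    linarith
  · subst h2
    have hr : ((2 : ℕ) : ℝ) ^ (-(3 / 8) : ℝ) ≤ 4 / 5 := by
      refine le_of_pow_le_pow_left₀ (n := 8) (by norm_num) (by norm_num) ?_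
      rw [← Real.rpow_natCast, ← Real.rpow_mul (by positivity)]
      norm_num
    have hr2 : 1 / 4 ≤ ((2 : ℕ) : ℝ) ^ (-(3 / 2) : ℝ) := by
      calc (1 / 4 : ℝ) = ((2 : ℕ) : ℝ) ^ (-2 : ℝ) := by
            rw [Real.rpow_neg (by positivity), Real.rpow_two]; norm_num
        _ ≤ _ := Real.rpow_le_rpow_of_exponent_le (by norm_num) (by norm_num)
    set y := χ ((2 : ℕ) : ZMod q) * ((2 : ℕ) : ℂ) ^ (-s)
    have hy' : ‖y‖ ≤ 4 / 5 := hy.trans hr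
    have hlog : ∀ z : ℂ, ‖z‖ ≤ 4 / 5 → ‖Complex.log (1 + z)‖ ≤ 12 / 5 := by
      intro z hz
      refine (norm_log_one_add_le (hz.trans_lt (by norm_num))).trans ?_
      have h1 : (1 - ‖z‖)⁻¹ ≤ 5 := by
        rw [inv_le_comm₀ (by linarith) (by norm_num)]; linarith
      have h2 : ‖z‖ ^ 2 ≤ 16 / 25 := by nlinarith [norm_nonneg z]
      have h3 : ‖z‖ ^ 2 * (1 - ‖z‖)⁻¹ ≤ 16 / 25 * 5 :=
        mul_le_mul h2 h1 (inv_nonneg.2 (by linarith)) (by norm_num)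
      linarith
    have e1 := hlog y hy'
    have e2 := hlog (-y) (by rwa [norm_neg])
    rw [← sub_eq_add_neg] at e2
    refine (norm_sub_le _ _).trans ?_
    linarith
  · rw [norm_zero]; positivity

theorem local_factor_identity {q : ℕ} (χ : DirichletCharacter ℂ q) {p : ℕ} (hp : p.Prime) {s : ℂ}
    (hs : 0 < s.re) :
    (if p % 4 = 3 then (1 - (χ p * (p : ℂ) ^ (-s)) ^ 2)⁻¹
        else (1 - χ p * (p : ℂ) ^ (-s))⁻¹) ^ 4 *
      (1 - mulChiNeg4 (χ ^ 2) (p : ZMod (4 * q)) * (p : ℂ) ^ (-(2 * s)))⁻¹ =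
    (1 - χ p * (p : ℂ) ^ (-s))⁻¹ ^ 2 *
      (1 - mulChiNeg4 χ (p : ZMod (4 * q)) * (p : ℂ) ^ (-s))⁻¹ ^ 2 *
      (1 - (χ ^ 2) p * (p : ℂ) ^ (-(2 * s)))⁻¹ * cexp (eulerLog χ p s) := by
  have hy := norm_mul_cpow_lt_one χ hp hs
  have e2 : (p : ℂ) ^ (-(2 * s)) = ((p : ℂ) ^ (-s)) ^ 2 := by
    rw [← Complex.cpow_nat_mul]
    congr 1
    push_cast
    ring
  rw [mulChiNeg4_natCast, mulChiNeg4_natCast, MulChar.pow_apply' χ two_ne_zero, e2]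
  unfold eulerLog
  set x := (p : ℂ) ^ (-s)
  set y := χ p * x with hydef
  have r1 : χ (p : ZMod q) ^ 2 * x ^ 2 = y ^ 2 := by rw [hydef]; ring
  have r2 : χ (p : ZMod q) ^ 2 * (ZMod.χ₄ (p : ZMod 4) : ℂ) * x ^ 2 =
    (ZMod.χ₄ (p : ZMod 4) : ℂ) * y ^ 2 := by rw [hydef]; ring
  have r3 : χ (p : ZMod q) * (ZMod.χ₄ (p : ZMod 4) : ℂ) * x =
    (ZMod.χ₄ (p : ZMod 4) : ℂ) * y := by rw [hydef]; ring
  rw [r1, r2, r3]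
  have n1 : 1 - y ≠ 0 := one_sub_ne_zero_of_norm_lt_one hy
  have n2 : 1 + y ≠ 0 := one_add_ne_zero_of_norm_lt_one hy
  have hy2 : ‖y ^ 2‖ < 1 := by
    rw [norm_pow]; exact pow_lt_one₀ (norm_nonneg _) hy (by norm_num)
  have n3 : 1 - y ^ 2 ≠ 0 := one_sub_ne_zero_of_norm_lt_one hy2
  have n4 : 1 + y ^ 2 ≠ 0 := one_add_ne_zero_of_norm_lt_one hy2
  have n5 : 1 - y ^ 4 ≠ 0 := by
    rw [show 1 - y ^ 4 = (1 - y ^ 2) * (1 + y ^ 2) by ring]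
    exact mul_ne_zero n3 n4
  by_cases h3 : p % 4 = 3
  · rw [if_pos h3, if_pos h3, ZMod.χ₄_nat_three_mod_four h3, Complex.exp_neg, Complex.exp_log n5]
    have a1 : 1 - ((-1 : ℤ) : ℂ) * y ^ 2 = 1 + y ^ 2 := by push_cast; ring
    have a2 : 1 - ((-1 : ℤ) : ℂ) * y = 1 + y := by push_cast; ring
    rw [a1, a2, show 1 - y ^ 4 = (1 - y ^ 2) * (1 + y ^ 2) by ring]
    field_simp
    ring
  rw [if_neg h3, if_neg h3]
  by_cases h2 : p = 2
  · have hχ : ZMod.χ₄ (p : ZMod 4) = 0 := by rw [h2]; decide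
    rw [if_pos h2, hχ, Complex.exp_sub, Complex.exp_log n1, Complex.exp_log n2]
    simp only [Int.cast_zero, zero_mul, sub_zero, inv_one, one_pow, mul_one]
    rw [show 1 - y ^ 2 = (1 - y) * (1 + y) by ring]
    field_simp
  · have h1 : p % 4 = 1 := by
      have := hp.eq_two_or_odd
      omega
    rw [if_neg h2, ZMod.χ₄_nat_one_mod_four h1, Complex.exp_zero]
    simp only [Int.cast_one, one_mul, mul_one]
    ring

theorem hasProd_LSeries_STwist {q : ℕ} (χ : DirichletCharacter ℂ q) {s : ℂ} (hs : 1 < s.re) :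
    HasProd (fun p : Nat.Primes => if (p : ℕ) % 4 = 3 then (1 - (χ p * (p : ℂ) ^ (-s)) ^ 2)⁻¹
        else (1 - χ p * (p : ℂ) ^ (-s))⁻¹) (LSeries (STwist χ) s) := by
  have hs0 : s ≠ 0 := ne_zero_of_one_lt_re hs
  have hprod := EulerProduct.eulerProduct_hasProd (f := fun n => STwist χ n * (n : ℂ) ^ (-s))
    (by simp [STwist, show IsSum2Sq 1 from ⟨1, 0, rfl⟩]) (fun {m n} h => by
      rw [STwist_mul χ h, Nat.cast_mul, Complex.natCast_mul_natCast_cpow]; ring)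
    ((summable_riemannZetaSummand hs).of_nonneg_of_le (fun _ => norm_nonneg _) fun n => by
      rw [norm_mul]
      exact mul_le_of_le_one_left (norm_nonneg _) (norm_STwist_le χ n)) (by simp [hs0])
  have e : ∑' n : ℕ, STwist χ n * (n : ℂ) ^ (-s) = LSeries (STwist χ) s := by
    simp only [LSeries, LSeries.term_of_ne_zero' hs0, Complex.cpow_neg, div_eq_mul_inv]
  rw [e] at hprod
  convert hprod using 2 with p
  exact (hasSum_STwist_prime_pow χ p.prop s
    (norm_mul_cpow_lt_one χ p.prop (by linarith))).tsum_eq.symm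

/-- The factorization of the fourth power of the twisted sum of two squares series. -/
theorem exists_STwist_factorization {q : ℕ} [NeZero q] (χ : DirichletCharacter ℂ q) :
    ∃ (v : ℂ → ℂ) (B : ℝ), DifferentiableOn ℂ v {s | 3 / 8 < s.re} ∧
      (∀ s : ℂ, 3 / 8 < s.re → ‖v s‖ ≤ B) ∧ ∀ s : ℂ, 1 < s.re →
        LSeries (STwist χ) s ^ 4 * (mulChiNeg4 (χ ^ 2)).LFunction (2 * s) =
          χ.LFunction s ^ 2 * (mulChiNeg4 χ).LFunction s ^ 2 * (χ ^ 2).LFunction (2 * s) *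
            cexp (v s) := by
  have hu : Summable fun p : Nat.Primes => 20 * ((p : ℕ) : ℝ) ^ (-(3 / 2) : ℝ) :=
    ((Real.summable_nat_rpow.2 (by norm_num)).comp_injective
      (i := fun p : Nat.Primes => (p : ℕ)) Subtype.val_injective).mul_left 20
  have hle : ∀ (p : Nat.Primes) (s : ℂ), s ∈ {s : ℂ | 3 / 8 < s.re} →
      ‖eulerLog χ p s‖ ≤ 20 * ((p : ℕ) : ℝ) ^ (-(3 / 2) : ℝ) :=
    fun p s hs => norm_eulerLog_le χ p.prop (le_of_lt hs)
  refine ⟨fun s => ∑' p : Nat.Primes, eulerLog χ p s,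
    ∑' p : Nat.Primes, 20 * ((p : ℕ) : ℝ) ^ (-(3 / 2) : ℝ), ?_, fun s hs => ?_, fun s hs => ?_⟩
  · refine differentiableOn_tsum_of_summable_norm hu (fun p s hs => ?_)
      (isOpen_lt continuous_const continuous_re) hle
    have hs' : 3 / 8 < s.re := hs
    exact (differentiableAt_eulerLog χ p.prop (by linarith)).differentiableWithinAt
  · exact tsum_of_norm_bounded hu.hasSum fun p => hle p s hs
  · have h2s : 1 < (2 * s).re := by simp; linarith
    have hF := hasProd_LSeries_STwist χ hs
    have h1 := DirichletCharacter.LSeries_eulerProduct_hasProd χ hs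
    have h2 := DirichletCharacter.LSeries_eulerProduct_hasProd (mulChiNeg4 χ) hs
    have h3 := DirichletCharacter.LSeries_eulerProduct_hasProd (χ ^ 2) h2s
    have h4 := DirichletCharacter.LSeries_eulerProduct_hasProd (mulChiNeg4 (χ ^ 2)) h2s
    rw [← DirichletCharacter.LFunction_eq_LSeries _ hs] at h1 h2
    rw [← DirichletCharacter.LFunction_eq_LSeries _ h2s] at h3 h4
    have hv : HasSum (fun p : Nat.Primes => eulerLog χ p s) (∑' p : Nat.Primes, eulerLog χ p s) :=
      (Summable.of_norm_bounded hu fun p => hle p s (by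
        change 3 / 8 < s.re
        linarith)).hasSum
    have hL := ((hF.mul hF).mul (hF.mul hF)).mul h4
    have hR := (((h1.mul h1).mul (h2.mul h2)).mul h3).mul hv.cexp
    have key := hL.unique (by
      convert hR using 2 with p
      have := local_factor_identity χ p.prop (s := s) (by linarith)
      simp only [Function.comp_apply]
      linear_combination this)
    linear_combination key

end EulerFactor

section FourthRoot
open Topology

theorem hasDerivAt_of_pow_four_eq {f G : ℂ → ℂ} {z : ℂ} (hf : ContinuousAt f z)
    (hG : DifferentiableAt ℂ G z) (h0 : G z ≠ 0) (h : ∀ᶠ w in 𝓝 z, f w ^ 4 = G w) :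
    DifferentiableAt ℂ f z := by
  have hfz : f z ≠ 0 := fun hz => h0 (by rw [← h.self_of_nhds, hz]; simp)
  set D : ℂ → ℂ := fun w => f w ^ 3 + f w ^ 2 * f z + f w * f z ^ 2 + f z ^ 3 with hD
  have hDc : ContinuousAt D z := by fun_prop
  have hDz : D z ≠ 0 := by
    rw [show D z = 4 * f z ^ 3 by simp only [hD]; ring]
    exact mul_ne_zero (by norm_num) (pow_ne_zero 3 hfz)
  have hs := (hasDerivAt_iff_tendsto_slope.1 hG.hasDerivAt).div
    (hDc.tendsto.mono_left nhdsWithin_le_nhds) hDz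
  refine (hasDerivAt_iff_tendsto_slope.2 (hs.congr' ?_)).differentiableAt
  filter_upwards [nhdsWithin_le_nhds h, nhdsWithin_le_nhds (hDc.eventually_ne hDz),
    self_mem_nhdsWithin] with w hw hDw hwz
  have hwz' : w - z ≠ 0 := sub_ne_zero.2 hwz
  rw [Pi.div_apply, slope_def_field, slope_def_field, ← hw, ← h.self_of_nhds]
  rw [div_div, div_eq_div_iff (mul_ne_zero hwz' hDw) hwz']
  simp only [hD]
  ring

theorem exists_fourth_root_extension {F G : ℂ → ℂ}
    (hG : DifferentiableOn ℂ G {s | 1 / 2 < s.re}) (h0 : ∀ s : ℂ, 1 / 2 < s.re → G s ≠ 0)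
    (hF : ContinuousOn F {s | 1 < s.re}) (hFG : ∀ s : ℂ, 1 < s.re → F s ^ 4 = G s) :
    ∃ Φ : ℂ → ℂ, (∀ s : ℂ, 1 / 2 < s.re → DifferentiableAt ℂ Φ s ∧ Φ s ^ 4 = G s) ∧
      ∀ s : ℂ, 1 < s.re → Φ s = F s := by
  set U : Set ℂ := {s | 1 / 2 < s.re} with hUdef
  have hU : IsOpen U := isOpen_lt continuous_const continuous_re
  have hUc : Convex ℝ U := convex_halfSpace_re_gt _
  have hVc : Convex ℝ {s : ℂ | 1 < s.re} := convex_halfSpace_re_gt _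
  have hUs : IsSimplyConnected U := by
    have := hUc.contractibleSpace ⟨1, by simp [hUdef]; norm_num⟩
    exact (inferInstance : SimplyConnectedSpace U)
  obtain ⟨f, hfc, hf⟩ := exists_continuousOn_pow_eq hUs hU hG.continuousOn
    (fun ⟨z, hz, h⟩ => h0 z hz h) (n := 4) (by norm_num)
  have hfd : ∀ s ∈ U, DifferentiableAt ℂ f s := fun s hs =>
    hasDerivAt_of_pow_four_eq (hfc.continuousAt (hU.mem_nhds hs))
      (hG.differentiableAt (hU.mem_nhds hs)) (h0 s hs) (Eventually.of_forall hf)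
  have hf0 : ∀ s ∈ U, f s ≠ 0 := fun s hs h => h0 s hs (by rw [← hf, h]; simp)
  have hVU : ∀ s : ℂ, 1 < s.re → s ∈ U := fun s hs => by
    change 1 / 2 < s.re
    linarith
  have hT : IsDiscrete {z : ℂ | z ^ 4 = 1} := by
    refine Set.Finite.isDiscrete ?_
    refine (Polynomial.nthRoots 4 (1 : ℂ)).toFinset.finite_toSet.subset fun z hz => ?_
    simpa [Polynomial.mem_nthRoots] using hz
  have hconst : ∀ s : ℂ, 1 < s.re → F s / f s = F 2 / f 2 := fun s hs =>
    hVc.isPreconnected.constant_of_mapsTo hT (f := fun s => F s / f s)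
      (hF.div (hfc.mono hVU) fun s hs => hf0 s (hVU s hs)) (fun s hs => by
        have hs' : 1 < s.re := hs
        change (F s / f s) ^ 4 = 1
        rw [div_pow, hFG s hs', hf, div_self (h0 s (hVU s hs))]) hs (by simp)
  have h2 : (F 2 / f 2) ^ 4 = 1 := by
    rw [div_pow, hFG 2 (by simp), hf, div_self (h0 2 (hVU 2 (by simp)))]
  refine ⟨fun s => F 2 / f 2 * f s, fun s hs => ⟨(hfd s hs).const_mul _, ?_⟩, fun s hs => ?_⟩
  · rw [mul_pow, h2, one_mul, hf]
  · change F 2 / f 2 * f s = F s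
    rw [← hconst s hs, div_mul_cancel₀ _ (hf0 s (hVU s hs))]

end FourthRoot

section RatioBounds
open Topology

theorem norm_deriv_le_of_norm_le_halfPlane {v : ℂ → ℂ} {a b B : ℝ} (hab : a < b)
    (hv : DifferentiableOn ℂ v {s | a < s.re}) (hB : ∀ s : ℂ, a < s.re → ‖v s‖ ≤ B) :
    ∀ s : ℂ, b < s.re → ‖deriv v s‖ ≤ B / (b - a) := by
  intro s hs
  have hsub : Metric.closedBall s (b - a) ⊆ {s : ℂ | a < s.re} := by
    intro z hz
    have h1 := Complex.abs_re_le_norm (z - s)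
    have h2 : ‖z - s‖ ≤ b - a := by simpa [dist_eq_norm] using hz
    rw [sub_re] at h1
    change a < z.re
    linarith [(abs_le.1 (h1.trans h2)).1]
  refine norm_deriv_le_of_forall_mem_sphere_norm_le (by linarith) ?_ fun z hz =>
    hB z (hsub (Metric.sphere_subset_closedBall hz))
  rw [← closure_ball s (by linarith : b - a ≠ 0)] at hsub
  exact (hv.mono hsub).diffContOnCl

theorem log_three_add_two_mul_le (t : ℝ) : Real.log (3 + |2 * t|) ≤ 2 * Real.log (3 + |t|) := by
  rw [abs_mul, abs_two, ← Real.log_rpow (by positivity), Real.rpow_two]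
  refine Real.log_le_log (by positivity) ?_
  nlinarith [abs_nonneg t]

theorem rpow_three_add_two_mul_le (t : ℝ) {δ : ℝ} (hδ : 0 ≤ δ) :
    (3 + |2 * t|) ^ δ ≤ (3 + |t|) ^ (2 * δ) := by
  rw [Real.rpow_mul (by positivity), Real.rpow_two, abs_mul, abs_two]
  refine Real.rpow_le_rpow (by positivity) ?_ hδ
  nlinarith [abs_nonneg t]

/-- The ratio of two `L`-functions at `2s`, times the exponential of a bounded function. -/
def ratioFactor {N₃ N₄ : ℕ} [NeZero N₃] [NeZero N₄] (ψ₃ : DirichletCharacter ℂ N₃)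
    (ψ₄ : DirichletCharacter ℂ N₄) (v : ℂ → ℂ) (s : ℂ) : ℂ :=
  ψ₃.LFunction (2 * s) * cexp (v s) / ψ₄.LFunction (2 * s)

theorem exists_ratioFactor_bounds {N₃ N₄ : ℕ} [NeZero N₃] [NeZero N₄]
    {ψ₃ : DirichletCharacter ℂ N₃} {ψ₄ : DirichletCharacter ℂ N₄} (h₃ : ψ₃ ≠ 1) (h₄ : ψ₄ ≠ 1)
    (z₃ : ∀ s, ψ₃.LFunction s = 0 → s.re ≤ 1 / 2) (z₄ : ∀ s, ψ₄.LFunction s = 0 → s.re ≤ 1 / 2)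
    {v : ℂ → ℂ} {B : ℝ} (hv : DifferentiableOn ℂ v {s | 3 / 8 < s.re})
    (hB : ∀ s : ℂ, 3 / 8 < s.re → ‖v s‖ ≤ B) {δ : ℝ} (hδ : 0 < δ) :
    ∃ K : ℝ, 0 < K ∧ ∀ s : ℂ, 1 / 2 < s.re →
      DifferentiableAt ℂ (ratioFactor ψ₃ ψ₄ v) s ∧ ratioFactor ψ₃ ψ₄ v s ≠ 0 ∧
      ‖ratioFactor ψ₃ ψ₄ v s‖ ≤ K * (3 + |s.im|) ^ δ ∧
      (s.re ≤ 3 / 2 → DifferentiableAt ℂ (logDeriv (ratioFactor ψ₃ ψ₄ v)) s ∧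
        ‖logDeriv (ratioFactor ψ₃ ψ₄ v) s‖ ≤ K * Real.log (3 + |s.im|) ∧
        ‖deriv (logDeriv (ratioFactor ψ₃ ψ₄ v)) s‖ ≤ K * Real.log (3 + |s.im|)) := by
  obtain ⟨K₃, hK₃, k₃⟩ := exists_norm_logDeriv_LFunction_le h₃ z₃
  obtain ⟨K₄, hK₄, k₄⟩ := exists_norm_logDeriv_LFunction_le h₄ z₄
  obtain ⟨C₃, hC₃, c₃⟩ := exists_norm_LFunction_le_rpow h₃ z₃ (δ := δ / 4) (by linarith)
  obtain ⟨C₄, hC₄, c₄⟩ := exists_norm_LFunction_le_rpow h₄ z₄ (δ := δ / 4) (by linarith)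
  have hB0 : 0 ≤ B := (norm_nonneg _).trans (hB 1 (by norm_num))
  have hV : IsOpen {s : ℂ | 3 / 8 < s.re} := isOpen_lt continuous_const continuous_re
  have hU : IsOpen {s : ℂ | 1 / 2 < s.re} := isOpen_lt continuous_const continuous_re
  have hv1 : ∀ s : ℂ, 7 / 16 < s.re → ‖deriv v s‖ ≤ 16 * B := fun s hs => by
    have := norm_deriv_le_of_norm_le_halfPlane (a := 3 / 8) (b := 7 / 16) (by norm_num) hv hB s hs
    convert this using 1
    ring
  have hdv : DifferentiableOn ℂ (deriv v) {s | 3 / 8 < s.re} := hv.deriv hV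
  have hv2 : ∀ s : ℂ, 1 / 2 < s.re → ‖deriv (deriv v) s‖ ≤ 256 * B := fun s hs => by
    have := norm_deriv_le_of_norm_le_halfPlane (a := 7 / 16) (b := 1 / 2) (by norm_num)
      (hdv.mono fun z (hz : 7 / 16 < z.re) => by change 3 / 8 < z.re; linarith) hv1 s hs
    convert this using 1
    ring
  have d₃ := DirichletCharacter.differentiable_LFunction h₃
  have d₄ := DirichletCharacter.differentiable_LFunction h₄
  have hne : ∀ (N : ℕ) [NeZero N] (ψ : DirichletCharacter ℂ N),
      (∀ s, ψ.LFunction s = 0 → s.re ≤ 1 / 2) → ∀ s : ℂ, 1 / 2 < s.re → ψ.LFunction (2 * s) ≠ 0 := by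
    intro N _ ψ hz s hs h
    have := hz _ h
    simp at this
    linarith
  have hlin : ∀ s : ℂ, HasDerivAt (fun s : ℂ => 2 * s) 2 s := fun s => by
    simpa using (hasDerivAt_id s).const_mul 2
  have hlog : ∀ s : ℂ, 1 / 2 < s.re → HasDerivAt (ratioFactor ψ₃ ψ₄ v)
      (ratioFactor ψ₃ ψ₄ v s * (2 * logDeriv ψ₃.LFunction (2 * s) -
        2 * logDeriv ψ₄.LFunction (2 * s) + deriv v s)) s := by
    intro s hs
    have n₃ := hne _ ψ₃ z₃ s hs
    have n₄ := hne _ ψ₄ z₄ s hs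
    have e₃ := (d₃ (2 * s)).hasDerivAt.comp s (hlin s)
    have e₄ := (d₄ (2 * s)).hasDerivAt.comp s (hlin s)
    have ev := (hv.differentiableAt (hV.mem_nhds
      (by change 3 / 8 < s.re; linarith))).hasDerivAt.cexp
    refine ((e₃.mul ev).div e₄ n₄).congr_deriv ?_
    simp only [ratioFactor, logDeriv_apply, Function.comp_apply, Pi.mul_apply]
    field_simp
    ring
  have hR0 : ∀ s : ℂ, 1 / 2 < s.re → ratioFactor ψ₃ ψ₄ v s ≠ 0 := fun s hs =>
    div_ne_zero (mul_ne_zero (hne _ ψ₃ z₃ s hs) (Complex.exp_ne_zero _)) (hne _ ψ₄ z₄ s hs)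
  have hlog' : ∀ s : ℂ, 1 / 2 < s.re → logDeriv (ratioFactor ψ₃ ψ₄ v) s =
      2 * logDeriv ψ₃.LFunction (2 * s) - 2 * logDeriv ψ₄.LFunction (2 * s) + deriv v s := by
    intro s hs
    rw [logDeriv_apply, (hlog s hs).deriv, mul_div_cancel_left₀ _ (hR0 s hs)]
  have hdl : ∀ (N : ℕ) [NeZero N] (ψ : DirichletCharacter ℂ N), Differentiable ℂ ψ.LFunction →
      (∀ s, ψ.LFunction s = 0 → s.re ≤ 1 / 2) → ∀ s : ℂ, 1 / 2 < s.re →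
      HasDerivAt (fun s => 2 * logDeriv ψ.LFunction (2 * s))
        (2 * (deriv (logDeriv ψ.LFunction) (2 * s) * 2)) s := by
    intro N _ ψ d hz s hs
    have h1 : DifferentiableAt ℂ (logDeriv ψ.LFunction) (2 * s) :=
      (d.deriv _).div (d _) (hne N ψ hz s hs)
    exact (h1.hasDerivAt.comp s (hlin s)).const_mul 2
  have hlog2 : ∀ s : ℂ, 1 / 2 < s.re → HasDerivAt (logDeriv (ratioFactor ψ₃ ψ₄ v))
      (2 * (deriv (logDeriv ψ₃.LFunction) (2 * s) * 2) -
        2 * (deriv (logDeriv ψ₄.LFunction) (2 * s) * 2) + deriv (deriv v) s) s := by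
    intro s hs
    refine HasDerivAt.congr_of_eventuallyEq (((hdl _ ψ₃ d₃ z₃ s hs).sub (hdl _ ψ₄ d₄ z₄ s hs)).add
      (hdv.differentiableAt (hV.mem_nhds (by change 3 / 8 < s.re; linarith))).hasDerivAt) ?_
    filter_upwards [hU.mem_nhds hs] with w hw
    exact hlog' w hw
  refine ⟨C₃ * C₄ * Real.exp B + 8 * K₃ + 8 * K₄ + 256 * B, by positivity, fun s hs =>
    ⟨(hlog s hs).differentiableAt, hR0 s hs, ?_, fun hs3 =>
    ⟨(hlog2 s hs).differentiableAt, ?_, ?_⟩⟩⟩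
  · have h2 : 1 < (2 * s).re := by simp; linarith
    have im2 : (2 * s).im = 2 * s.im := by simp
    have hp := rpow_three_add_two_mul_le s.im (δ := δ / 4) (by linarith)
    have b₃ := (c₃ _ h2).1
    have b₄ := (c₄ _ h2).2
    rw [im2] at b₃ b₄
    have hx : 0 < 3 + |s.im| := by positivity
    have e : (3 + |s.im|) ^ (2 * (δ / 4)) * (3 + |s.im|) ^ (2 * (δ / 4)) = (3 + |s.im|) ^ δ := by
      rw [← Real.rpow_add hx]; congr 1; ring
    have hE : ‖cexp (v s)‖ ≤ Real.exp B := by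
      rw [Complex.norm_exp]
      exact Real.exp_le_exp.2 ((le_abs_self _).trans ((Complex.abs_re_le_norm _).trans
        (hB s (by linarith))))
    rw [ratioFactor, div_eq_mul_inv, norm_mul, norm_mul]
    calc _ ≤ C₃ * (3 + |s.im|) ^ (2 * (δ / 4)) * Real.exp B *
          (C₄ * (3 + |s.im|) ^ (2 * (δ / 4))) := by
          refine mul_le_mul (mul_le_mul (b₃.trans ?_) hE (norm_nonneg _) (by positivity))
            (b₄.trans ?_) (norm_nonneg _) (by positivity)
          · exact mul_le_mul_of_nonneg_left hp (by linarith)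
          · exact mul_le_mul_of_nonneg_left hp (by linarith)
      _ = C₃ * C₄ * Real.exp B * (3 + |s.im|) ^ δ := by rw [← e]; ring
      _ ≤ _ := mul_le_mul_of_nonneg_right (by linarith) (by positivity)
  all_goals
    have r1 : 1 ≤ (2 * s).re := by simp; linarith
    have r2 : (2 * s).re ≤ 3 := by simp; linarith
    have im2 : (2 * s).im = 2 * s.im := by simp
    obtain ⟨a₃, b₃⟩ := k₃ _ r1 r2
    obtain ⟨a₄, b₄⟩ := k₄ _ r1 r2
    rw [im2] at a₃ b₃ a₄ b₄
    have hl2 := log_three_add_two_mul_le s.im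
    have hl := one_le_log_three_add s.im
    have l₃ := mul_le_mul_of_nonneg_left hl2 hK₃.le
    have l₄ := mul_le_mul_of_nonneg_left hl2 hK₄.le
    have hCC : 0 ≤ C₃ * C₄ * Real.exp B * Real.log (3 + |s.im|) := by positivity
    have hBl : B ≤ B * Real.log (3 + |s.im|) := le_mul_of_one_le_right hB0 hl
    have p₃ : 0 ≤ K₃ * Real.log (3 + |s.im|) := by positivity
    have p₄ : 0 ≤ K₄ * Real.log (3 + |s.im|) := by positivity
  · rw [hlog' s hs]
    refine (norm_add_le _ _).trans ((add_le_add_left (norm_sub_le _ _) _).trans ?_)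
    rw [norm_mul, norm_mul, Complex.norm_two]
    linarith [hv1 s (by linarith)]
  · rw [(hlog2 s hs).deriv]
    refine (norm_add_le _ _).trans ((add_le_add_left (norm_sub_le _ _) _).trans ?_)
    rw [norm_mul, norm_mul, norm_mul, norm_mul, Complex.norm_two]
    linarith [hv2 s hs]

end RatioBounds

section SecondDerivative
open Topology

theorem deriv_deriv_div_id {Φ : ℂ → ℂ}
    (hd : ∀ s : ℂ, 1 / 2 < s.re → DifferentiableAt ℂ Φ s) (h0 : ∀ s : ℂ, 1 / 2 < s.re → Φ s ≠ 0)
    {s : ℂ} (hs : 1 / 2 < s.re) :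
    deriv (deriv fun s => Φ s / s) s =
      Φ s / s * ((logDeriv Φ s - s⁻¹) ^ 2 + (deriv (logDeriv Φ) s + (s ^ 2)⁻¹)) := by
  have hne : ∀ s : ℂ, 1 / 2 < s.re → s ≠ 0 := fun s hs h => by
    rw [h, zero_re] at hs; linarith
  have h1 : ∀ s : ℂ, 1 / 2 < s.re →
      HasDerivAt (fun s => Φ s / s) (Φ s / s * (logDeriv Φ s - s⁻¹)) s := by
    intro s hs
    have n0 := h0 s hs
    have n1 := hne s hs
    refine ((hd s hs).hasDerivAt.div (hasDerivAt_id' s) n1).congr_deriv ?_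
    rw [logDeriv_apply]
    field_simp
  have hev : (deriv fun s => Φ s / s) =ᶠ[𝓝 s] fun s => Φ s / s * (logDeriv Φ s - s⁻¹) := by
    filter_upwards [(Complex.isOpen_re_gt (1 / 2)).mem_nhds hs] with w hw using (h1 w hw).deriv
  have hdd : DifferentiableAt ℂ (deriv Φ) s :=
    (DifferentiableOn.deriv (fun z hz => (hd z hz).differentiableWithinAt)
      (Complex.isOpen_re_gt (1 / 2))).differentiableAt ((Complex.isOpen_re_gt (1 / 2)).mem_nhds hs)
  have hlog : DifferentiableAt ℂ (logDeriv Φ) s := hdd.div (hd s hs) (h0 s hs)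
  rw [hev.deriv_eq]
  refine ((h1 s hs).fun_mul (hlog.hasDerivAt.fun_sub (hasDerivAt_inv (hne s hs)))).deriv.trans ?_
  ring

theorem logDeriv_eq_of_pow_four_eq {Φ g R : ℂ → ℂ} {s : ℂ} (hΦ : DifferentiableAt ℂ Φ s)
    (hg : DifferentiableAt ℂ g s) (hR : DifferentiableAt ℂ R s) (g0 : g s ≠ 0) (R0 : R s ≠ 0)
    (h : ∀ᶠ w in 𝓝 s, Φ w ^ 4 = g w ^ 2 * R w) :
    logDeriv Φ s = 1 / 2 * logDeriv g s + 1 / 4 * logDeriv R s := by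
  have hs := h.self_of_nhds
  have Φ0 : Φ s ≠ 0 := fun h0 => by
    rw [h0] at hs
    exact mul_ne_zero (pow_ne_zero 2 g0) R0 (by rw [← hs]; simp)
  have e : deriv (fun w => Φ w ^ 4) s = deriv (fun w => g w ^ 2 * R w) s :=
    EventuallyEq.deriv_eq h
  rw [(hΦ.hasDerivAt.fun_pow 4).deriv, ((hg.hasDerivAt.fun_pow 2).fun_mul hR.hasDerivAt).deriv] at e
  simp only [logDeriv_apply]
  have e2 : deriv Φ s / Φ s = (4 * Φ s ^ 3 * deriv Φ s) / (4 * Φ s ^ 4) := by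
    field_simp
  rw [e2]
  have e3 : 4 * Φ s ^ 3 * deriv Φ s = 2 * g s * deriv g s * R s + g s ^ 2 * deriv R s := by
    norm_num at e
    linear_combination e
  rw [e3, hs]
  field_simp
  ring

theorem norm_deriv_deriv_div_id_le {Φ g R : ℂ → ℂ}
    (hd : ∀ s : ℂ, 1 / 2 < s.re → DifferentiableAt ℂ Φ s) (hg : Differentiable ℂ g)
    (hR : ∀ s : ℂ, 1 / 2 < s.re → DifferentiableAt ℂ R s)
    (g0 : ∀ s : ℂ, 1 / 2 < s.re → g s ≠ 0) (R0 : ∀ s : ℂ, 1 / 2 < s.re → R s ≠ 0)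
    (h : ∀ s : ℂ, 1 / 2 < s.re → Φ s ^ 4 = g s ^ 2 * R s) {s : ℂ} (hs : 1 / 2 < s.re) :
    ‖deriv (deriv fun s => Φ s / s) s‖ ≤ ‖Φ s‖ / ‖s‖ *
      (‖logDeriv g s‖ ^ 2 + ‖logDeriv R s‖ ^ 2 + ‖deriv (logDeriv g) s‖ +
        ‖deriv (logDeriv R) s‖ + 12) := by
  have Φ0 : ∀ s : ℂ, 1 / 2 < s.re → Φ s ≠ 0 := fun s hs h0 => by
    have := h s hs
    rw [h0] at this
    exact mul_ne_zero (pow_ne_zero 2 (g0 s hs)) (R0 s hs) (by rw [← this]; simp)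
  have hmem := (Complex.isOpen_re_gt (1 / 2)).mem_nhds hs
  have hl : ∀ w : ℂ, 1 / 2 < w.re →
      logDeriv Φ w = 1 / 2 * logDeriv g w + 1 / 4 * logDeriv R w := fun w hw =>
    logDeriv_eq_of_pow_four_eq (hd w hw) (hg w) (hR w hw) (g0 w hw) (R0 w hw)
      (by filter_upwards [(Complex.isOpen_re_gt (1 / 2)).mem_nhds hw] with z hz using h z hz)
  have dlR : DifferentiableAt ℂ (logDeriv R) s :=
    ((DifferentiableOn.deriv (fun z hz => (hR z hz).differentiableWithinAt)
      (Complex.isOpen_re_gt (1 / 2))).differentiableAt hmem).div (hR s hs) (R0 s hs)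
  have dlg : DifferentiableAt ℂ (logDeriv g) s := (hg.deriv s).div (hg s) (g0 s hs)
  have hl' : deriv (logDeriv Φ) s = 1 / 2 * deriv (logDeriv g) s + 1 / 4 * deriv (logDeriv R) s := by
    have : logDeriv Φ =ᶠ[𝓝 s] fun w => 1 / 2 * logDeriv g w + 1 / 4 * logDeriv R w := by
      filter_upwards [hmem] with w hw using hl w hw
    rw [this.deriv_eq]
    exact ((dlg.hasDerivAt.const_mul _).fun_add (dlR.hasDerivAt.const_mul _)).deriv
  have hsn : 1 / 2 ≤ ‖s‖ := hs.le.trans ((le_abs_self _).trans (Complex.abs_re_le_norm s))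
  have hinv : ‖s⁻¹‖ ≤ 2 := by
    rw [norm_inv, inv_le_comm₀ (by linarith) (by norm_num)]; linarith
  rw [deriv_deriv_div_id hd Φ0 hs, norm_mul, norm_div]
  refine mul_le_mul_of_nonneg_left ?_ (by positivity)
  have i2 : ‖(s ^ 2)⁻¹‖ ≤ 4 := by
    rw [← inv_pow, norm_pow]
    nlinarith [norm_nonneg s⁻¹]
  have n1 : ‖logDeriv Φ s - s⁻¹‖ ≤ 1 / 2 * ‖logDeriv g s‖ + 1 / 4 * ‖logDeriv R s‖ + 2 := by
    rw [hl s hs]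
    refine (norm_sub_le _ _).trans (add_le_add ((norm_add_le _ _).trans ?_) hinv)
    rw [norm_mul, norm_mul]
    norm_num
  have n2 : ‖deriv (logDeriv Φ) s‖ ≤
      1 / 2 * ‖deriv (logDeriv g) s‖ + 1 / 4 * ‖deriv (logDeriv R) s‖ := by
    rw [hl']
    refine (norm_add_le _ _).trans ?_
    rw [norm_mul, norm_mul]
    norm_num
  refine (norm_add_le _ _).trans ?_
  have n3 := norm_add_le (deriv (logDeriv Φ) s) (s ^ 2)⁻¹
  rw [norm_pow]
  have n4 := pow_le_pow_left₀ (norm_nonneg _) n1 2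
  nlinarith [norm_nonneg (deriv (logDeriv g) s), norm_nonneg (deriv (logDeriv R) s),
    sq_nonneg (‖logDeriv g s‖ - 2 * ‖logDeriv R s‖), sq_nonneg (‖logDeriv g s‖ - 4),
    sq_nonneg (‖logDeriv R s‖), sq_nonneg (4 * ‖logDeriv R s‖ - 8), sq_nonneg (2 * ‖logDeriv R s‖ - 4),
    sq_nonneg (4 * ‖logDeriv R s‖ - 2)]

end SecondDerivative

section KernelBounds
open MeasureTheory

theorem exists_lintegral_rpow_kernel_le : ∃ C : ℝ, 0 < C ∧ ∀ η : ℝ, 0 < η → ∀ γ : ℝ,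
    ∫⁻ y : ℝ, ENNReal.ofReal ((η ^ 2 + (y - γ) ^ 2) ^ (-(3 / 4) : ℝ)) ≤
      ENNReal.ofReal (C * η ^ (-(1 / 2) : ℝ)) := by
  have hF : Integrable (fun x : ℝ => (1 + x ^ 2) ^ (-(3 / 4) : ℝ)) := by
    have := integrable_rpow_neg_one_add_norm_sq (E := ℝ) (μ := volume) (r := 3 / 2)
      (by simp; norm_num)
    refine this.congr (Eventually.of_forall fun x => ?_)
    simp only [Real.norm_eq_abs, sq_abs]
    norm_num
  refine ⟨|∫ x : ℝ, (1 + x ^ 2) ^ (-(3 / 4) : ℝ)| + 1, by positivity, fun η hη γ => ?_⟩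
  have hk : ∀ x : ℝ, (η ^ 2 + x ^ 2) ^ (-(3 / 4) : ℝ) =
      η ^ (-(3 / 2) : ℝ) * (1 + (x / η) ^ 2) ^ (-(3 / 4) : ℝ) := by
    intro x
    have : η ^ 2 + x ^ 2 = η ^ 2 * (1 + (x / η) ^ 2) := by field_simp
    rw [this, Real.mul_rpow (by positivity) (by positivity), ← Real.rpow_natCast η 2,
      ← Real.rpow_mul hη.le]
    norm_num
  rw [lintegral_sub_right_eq_self (fun y : ℝ => ENNReal.ofReal ((η ^ 2 + y ^ 2) ^ (-(3 / 4) : ℝ))) γ]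
  have hint : Integrable (fun x : ℝ => (η ^ 2 + x ^ 2) ^ (-(3 / 4) : ℝ)) := by
    simp_rw [hk]
    exact (hF.comp_div hη.ne').const_mul _
  rw [← ofReal_integral_eq_lintegral_ofReal hint (Eventually.of_forall fun x => by positivity)]
  refine ENNReal.ofReal_le_ofReal ?_
  simp_rw [hk]
  rw [integral_const_mul, Measure.integral_comp_div (fun x : ℝ => (1 + x ^ 2) ^ (-(3 / 4) : ℝ)) η,
    smul_eq_mul, abs_of_pos hη]
  have e : η ^ (-(3 / 2) : ℝ) * η = η ^ (-(1 / 2) : ℝ) := by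
    rw [← Real.rpow_add_one hη.ne']; norm_num
  calc _ = (∫ x : ℝ, (1 + x ^ 2) ^ (-(3 / 4) : ℝ)) * η ^ (-(1 / 2) : ℝ) := by rw [← e]; ring
    _ ≤ _ := mul_le_mul_of_nonneg_right
      ((le_abs_self _).trans (le_add_of_nonneg_right zero_le_one)) (by positivity)

theorem mul_sum_inv_sq_add_one_le {n : ℕ} {d : Fin n → ℝ} {r m K : ℝ} (hd : ∀ i, 0 < d i)
    (hK : 0 ≤ K) (hm : 0 ≤ m) (h1 : r ^ 2 ≤ m) (h2 : ∀ i, r ^ 2 ≤ K * m * d i) :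
    r * (∑ i, 1 / d i ^ 2 + 1) ≤ √m * (1 + √K * ∑ i, (d i ^ 2) ^ (-(3 / 4) : ℝ)) := by
  have a1 : r ≤ √m := Real.le_sqrt_of_sq_le h1
  have a2 : ∀ i, r * (1 / d i ^ 2) ≤ √m * (√K * (d i ^ 2) ^ (-(3 / 4) : ℝ)) := by
    intro i
    have hr2 : r ≤ √K * √m * √(d i) := by
      rw [← Real.sqrt_mul hK, ← Real.sqrt_mul (mul_nonneg hK hm)]
      exact Real.le_sqrt_of_sq_le (h2 i)
    have e : √(d i) * (1 / d i ^ 2) = (d i ^ 2) ^ (-(3 / 4) : ℝ) := by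
      rw [Real.sqrt_eq_rpow, ← Real.rpow_natCast (d i) 2, ← Real.rpow_mul (hd i).le,
        one_div (d i ^ _), ← Real.rpow_neg (hd i).le, ← Real.rpow_add (hd i)]
      norm_num
    calc r * (1 / d i ^ 2) ≤ √K * √m * √(d i) * (1 / d i ^ 2) :=
          mul_le_mul_of_nonneg_right hr2 (by positivity)
      _ = √m * (√K * (√(d i) * (1 / d i ^ 2))) := by ring
      _ = _ := by rw [e]
  have : r * (∑ i, 1 / d i ^ 2 + 1) = ∑ i, r * (1 / d i ^ 2) + r := by
    rw [mul_add, Finset.mul_sum, mul_one]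
  rw [this, mul_add, mul_one, Finset.mul_sum, Finset.mul_sum, add_comm]
  exact add_le_add a1 (Finset.sum_le_sum fun i _ => a2 i)

theorem lintegral_one_add_kernel_sum_le {C : ℝ} (hC : 0 < C)
    (hker : ∀ η : ℝ, 0 < η → ∀ γ : ℝ,
      ∫⁻ y : ℝ, ENNReal.ofReal ((η ^ 2 + (y - γ) ^ 2) ^ (-(3 / 4) : ℝ)) ≤
        ENNReal.ofReal (C * η ^ (-(1 / 2) : ℝ)))
    {n : ℕ} (γ : Fin n → ℝ) {η B A : ℝ} (hη : 0 < η) (hB : 0 ≤ B) (hA : 0 ≤ A) (τ : ℝ) :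
    ∫⁻ y in Set.Icc (τ - 1 / 2) (τ + 1 / 2), ENNReal.ofReal
        (B * (1 + A * ∑ i, (η ^ 2 + (y - γ i) ^ 2) ^ (-(3 / 4) : ℝ))) ≤
      ENNReal.ofReal (B * (1 + A * (n * (C * η ^ (-(1 / 2) : ℝ))))) := by
  have hmeas : ∀ i : Fin n, Measurable fun y : ℝ =>
      ENNReal.ofReal ((η ^ 2 + (y - γ i) ^ 2) ^ (-(3 / 4) : ℝ)) := fun i =>
    ENNReal.measurable_ofReal.comp (by fun_prop)
  have e : ∀ y : ℝ, ENNReal.ofReal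
      (B * (1 + A * ∑ i, (η ^ 2 + (y - γ i) ^ 2) ^ (-(3 / 4) : ℝ))) =
      ENNReal.ofReal B * (1 + ENNReal.ofReal A *
        ∑ i, ENNReal.ofReal ((η ^ 2 + (y - γ i) ^ 2) ^ (-(3 / 4) : ℝ))) := by
    intro y
    have h0 : ∀ i, 0 ≤ (η ^ 2 + (y - γ i) ^ 2) ^ (-(3 / 4) : ℝ) := fun i => by positivity
    rw [ENNReal.ofReal_mul hB, ENNReal.ofReal_add zero_le_one
      (mul_nonneg hA (Finset.sum_nonneg fun i _ => h0 i)), ENNReal.ofReal_one, ENNReal.ofReal_mul hA,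
      ENNReal.ofReal_sum_of_nonneg fun i _ => h0 i]
  simp_rw [e]
  have ms : Measurable fun y : ℝ => ∑ i : Fin n,
      ENNReal.ofReal ((η ^ 2 + (y - γ i) ^ 2) ^ (-(3 / 4) : ℝ)) :=
    Finset.measurable_fun_sum _ fun i _ => hmeas i
  rw [lintegral_const_mul _ ((ms.const_mul _).const_add 1),
    lintegral_add_left measurable_const, lintegral_const_mul _ ms,
    lintegral_finsetSum _ fun i _ => hmeas i, setLIntegral_const, Real.volume_Icc]
  have hη' : 0 ≤ C * η ^ (-(1 / 2) : ℝ) := by positivity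
  rw [ENNReal.ofReal_mul hB, ENNReal.ofReal_add zero_le_one (by positivity), ENNReal.ofReal_one,
    ENNReal.ofReal_mul hA, ENNReal.ofReal_mul (by positivity), ENNReal.ofReal_natCast]
  refine mul_le_mul_right (add_le_add ?_ (mul_le_mul_right ?_ _)) _
  · rw [show τ + 1 / 2 - (τ - 1 / 2) = 1 by ring]; simp
  · calc ∑ i, ∫⁻ y in Set.Icc (τ - 1 / 2) (τ + 1 / 2),
          ENNReal.ofReal ((η ^ 2 + (y - γ i) ^ 2) ^ (-(3 / 4) : ℝ))
        ≤ ∑ _i : Fin n, ENNReal.ofReal (C * η ^ (-(1 / 2) : ℝ)) :=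
          Finset.sum_le_sum fun i _ => (setLIntegral_le_lintegral _ _).trans (hker η hη (γ i))
      _ = _ := by simp

end KernelBounds

section InnerBound
open MeasureTheory

theorem sq_add_sq_add_le {a b c d S₁ S₂ K K₂ L n : ℝ} (ha0 : 0 ≤ a) (hb0 : 0 ≤ b) (hK : 0 < K)
    (hK₂ : 0 < K₂) (hL : 1 ≤ L) (hS₂ : 0 ≤ S₂) (ha : a ≤ S₁ + K * L) (hS : S₁ ^ 2 ≤ n * S₂)
    (hn : n ≤ K * L) (hb : b ≤ 2 * K₂ * L) (hc : c ≤ S₂ + K * L) (hd : d ≤ 2 * K₂ * L) :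
    a ^ 2 + b ^ 2 + c + d + 12 ≤
      (2 * K ^ 2 + 4 * K₂ ^ 2 + 3 * K + 2 * K₂ + 13) * L ^ 2 * (S₂ + 1) := by
  have hLL : L ≤ L ^ 2 := by nlinarith
  have h1L : 1 ≤ L ^ 2 := by nlinarith
  have h1 : a ^ 2 ≤ 2 * S₁ ^ 2 + 2 * (K * L) ^ 2 := by
    have := pow_le_pow_left₀ ha0 ha 2
    nlinarith [sq_nonneg (S₁ - K * L)]
  have h2 : S₁ ^ 2 ≤ K * L ^ 2 * S₂ := hS.trans (mul_le_mul_of_nonneg_right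
    (hn.trans (mul_le_mul_of_nonneg_left hLL hK.le)) hS₂)
  have h3 : b ^ 2 ≤ 4 * K₂ ^ 2 * L ^ 2 := (pow_le_pow_left₀ hb0 hb 2).trans_eq (by ring)
  have h4 : K * L ≤ K * L ^ 2 := mul_le_mul_of_nonneg_left hLL hK.le
  have h5 : K₂ * L ≤ K₂ * L ^ 2 := mul_le_mul_of_nonneg_left hLL hK₂.le
  have h6 : S₂ ≤ L ^ 2 * S₂ := le_mul_of_one_le_left hS₂ h1L
  have p1 : 0 ≤ K ^ 2 * L ^ 2 * S₂ := by positivity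
  have p2 : 0 ≤ K₂ ^ 2 * L ^ 2 * S₂ := by positivity
  have p3 : 0 ≤ K * L ^ 2 * S₂ := by positivity
  have p4 : 0 ≤ K₂ * L ^ 2 * S₂ := by positivity
  have p5 : 0 ≤ L ^ 2 * S₂ := by positivity
  have p6 : 0 ≤ K * L ^ 2 := by positivity
  nlinarith

theorem norm_le_of_pow_four_eq {φ g r : ℂ} (h : φ ^ 4 = g ^ 2 * r) :
    ‖φ‖ ≤ √‖g‖ * (1 + ‖r‖) := by
  refine (pow_le_pow_iff_left₀ (norm_nonneg _) (by positivity) (by norm_num : (4 : ℕ) ≠ 0)).mp ?_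
  have e : √‖g‖ ^ 4 = ‖g‖ ^ 2 := by
    rw [show (4 : ℕ) = 2 * 2 from rfl, pow_mul, Real.sq_sqrt (norm_nonneg _)]
  rw [← norm_pow, h, mul_pow, e, norm_mul, norm_pow]
  refine mul_le_mul_of_nonneg_left ?_ (by positivity)
  exact (by linarith [norm_nonneg r] : ‖r‖ ≤ 1 + ‖r‖).trans
    (le_self_pow₀ (by linarith [norm_nonneg r]) (by norm_num))

theorem norm_sum_sq_le {n : ℕ} (x : Fin n → ℂ) :
    (∑ i, ‖x i‖) ^ 2 ≤ n * ∑ i, ‖x i‖ ^ 2 := by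
  simpa using sq_sum_le_card_mul_sum_sq (s := Finset.univ) (f := fun i => ‖x i‖)

theorem three_add_abs_le_norm {s : ℂ} {τ : ℝ} (hs : 1 / 2 < s.re) (hτ : |s.im - τ| ≤ 1 / 2) :
    3 + |τ| ≤ 8 * ‖s‖ := by
  have h1 := (le_abs_self _).trans (Complex.abs_re_le_norm s)
  have h2 := Complex.abs_im_le_norm s
  have h3 : |τ| ≤ |s.im| + 1 / 2 := by
    have := abs_sub_abs_le_abs_sub τ s.im
    rw [abs_sub_comm] at this
    linarith
  linarith

theorem norm_deriv_deriv_le_kernel_sum {Φ g R : ℂ → ℂ} {M : ℝ → ℝ} {K K₂ : ℝ} (hK : 0 < K)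
    (hK₂ : 0 < K₂) (hd : ∀ s : ℂ, 1 / 2 < s.re → DifferentiableAt ℂ Φ s) (hg : Differentiable ℂ g)
    (g0 : ∀ s : ℂ, 1 / 2 < s.re → g s ≠ 0)
    (h4 : ∀ s : ℂ, 1 / 2 < s.re → Φ s ^ 4 = g s ^ 2 * R s)
    (hM0 : ∀ τ, 0 ≤ M τ)
    (hM : ∀ (τ : ℝ) (z : ℂ), ‖z - (2 + τ * I)‖ ≤ 9 / 5 → ‖g z‖ ≤ M τ)
    (hR : ∀ s : ℂ, 1 / 2 < s.re → DifferentiableAt ℂ R s ∧ R s ≠ 0 ∧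
      ‖R s‖ ≤ K₂ * (3 + |s.im|) ^ (1 / 120 : ℝ) ∧ (s.re ≤ 3 / 2 →
        DifferentiableAt ℂ (logDeriv R) s ∧ ‖logDeriv R s‖ ≤ K₂ * Real.log (3 + |s.im|) ∧
        ‖deriv (logDeriv R) s‖ ≤ K₂ * Real.log (3 + |s.im|)))
    (τ : ℝ) {n : ℕ} {ρ : Fin n → ℂ} {h : ℂ → ℂ} (hn : (n : ℝ) ≤ K * Real.log (3 + |τ|))
    (hρ : ∀ i, (ρ i).re ≤ 1 / 2)
    (hρM : ∀ i z, ‖z - (2 + τ * I)‖ ≤ 8 / 5 → ‖g z‖ ≤ K * M τ * ‖z - ρ i‖)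
    (hexp : ∀ z : ℂ, ‖z - (2 + τ * I)‖ < 8 / 5 → 1 / 2 < z.re →
      ‖h z‖ ≤ K * Real.log (3 + |τ|) ∧ ‖deriv h z‖ ≤ K * Real.log (3 + |τ|) ∧
      logDeriv g z = ∑ i, 1 / (z - ρ i) + h z ∧
      deriv (logDeriv g) z = ∑ i, -1 / (z - ρ i) ^ 2 + deriv h z)
    {η y : ℝ} (hη : 0 < η) (hη' : η ≤ 1 / 2) (hy : |y - τ| ≤ 1 / 2) :
    ‖deriv (deriv fun s => Φ s / s) ((1 / 2 + η : ℝ) + y * I)‖ ≤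
      8 / (3 + |τ|) * ((1 + 2 * K₂) * (3 + |τ|) ^ (1 / 120 : ℝ)) *
        ((2 * K ^ 2 + 4 * K₂ ^ 2 + 3 * K + 2 * K₂ + 13) * Real.log (3 + |τ|) ^ 2) * √(M τ) *
        (1 + √K * ∑ i, (η ^ 2 + (y - (ρ i).im) ^ 2) ^ (-(3 / 4) : ℝ)) := by
  set s : ℂ := (1 / 2 + η : ℝ) + y * I with hsdef
  have sre : s.re = 1 / 2 + η := by simp [hsdef]
  have sim : s.im = y := by simp [hsdef]
  have hs : 1 / 2 < s.re := by rw [sre]; linarith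
  have hsc : ‖s - (2 + τ * I)‖ < 8 / 5 := by
    have hsq : ‖s - (2 + τ * I)‖ ^ 2 = (3 / 2 - η) ^ 2 + (y - τ) ^ 2 := by
      rw [← Complex.normSq_eq_norm_sq, Complex.normSq_apply]
      simp [sre, sim]; ring
    have := abs_le.mp hy
    refine lt_of_pow_lt_pow_left₀ 2 (by norm_num) ?_
    rw [hsq]
    nlinarith
  have hsM : ‖s - (2 + τ * I)‖ ≤ 9 / 5 := by linarith
  obtain ⟨b1, b2, b3, b4⟩ := hexp s hsc hs
  obtain ⟨-, R0, r1, r2⟩ := hR s hs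
  obtain ⟨-, r3, r4⟩ := r2 (by rw [sre]; linarith)
  set T := 3 + |τ| with hT
  have hT3 : 3 ≤ T := by rw [hT]; linarith [abs_nonneg τ]
  have hL : 1 ≤ Real.log T := one_le_log_three_add τ
  have hyT : 3 + |s.im| ≤ 2 * T := by
    have := abs_sub_abs_le_abs_sub y τ
    rw [sim]; linarith
  have h3y : 0 < 3 + |s.im| := by positivity
  have hlogy : Real.log (3 + |s.im|) ≤ 2 * Real.log T := by
    refine (Real.log_le_log h3y hyT).trans ?_
    rw [Real.log_mul (by norm_num) (by positivity)]
    linarith [Real.log_two_lt_d9]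
  have hRn : 1 + ‖R s‖ ≤ (1 + 2 * K₂) * T ^ (1 / 120 : ℝ) := by
    have t1 : (1 : ℝ) ≤ T ^ (1 / 120 : ℝ) := Real.one_le_rpow (by linarith) (by norm_num)
    have t2 : (3 + |s.im|) ^ (1 / 120 : ℝ) ≤ 2 * T ^ (1 / 120 : ℝ) := by
      refine (Real.rpow_le_rpow h3y.le hyT (by norm_num)).trans ?_
      rw [Real.mul_rpow (by norm_num) (by positivity)]
      refine mul_le_mul_of_nonneg_right ?_ (by positivity)
      exact (Real.rpow_le_rpow_of_exponent_le (by norm_num) (by norm_num : (1 / 120 : ℝ) ≤ 1)).trans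
        (by norm_num)
    nlinarith [mul_le_mul_of_nonneg_left t2 hK₂.le]
  have hdpos : ∀ i, 0 < ‖s - ρ i‖ := fun i => norm_pos_iff.mpr fun h0 => by
    have := hρ i
    rw [← sub_eq_zero.mp h0] at this
    linarith
  have hdlow : ∀ i, η ^ 2 + (y - (ρ i).im) ^ 2 ≤ ‖s - ρ i‖ ^ 2 := by
    intro i
    rw [← Complex.normSq_eq_norm_sq, Complex.normSq_apply, sub_re, sub_im, sre, sim]
    nlinarith [hρ i]
  have hS2 : 0 ≤ ∑ i, 1 / ‖s - ρ i‖ ^ 2 := Finset.sum_nonneg fun i _ => by positivity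
  have hQ := sq_add_sq_add_le (a := ‖logDeriv g s‖) (b := ‖logDeriv R s‖)
    (c := ‖deriv (logDeriv g) s‖) (d := ‖deriv (logDeriv R) s‖) (S₁ := ∑ i, ‖1 / (s - ρ i)‖)
    (norm_nonneg _) (norm_nonneg _) hK hK₂ hL hS2
    (by rw [b3]; exact (norm_add_le _ _).trans (add_le_add (norm_sum_le _ _) b1))
    (by simpa using norm_sum_sq_le fun i => 1 / (s - ρ i)) hn
    (r3.trans (by nlinarith))
    (by
      rw [b4]
      refine (norm_add_le _ _).trans (add_le_add ((norm_sum_le _ _).trans_eq ?_) b2)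
      simp)
    (r4.trans (by nlinarith))
  have hsum := mul_sum_inv_sq_add_one_le (r := √‖g s‖) (m := M τ) (K := K) hdpos hK.le (hM0 τ)
    (by rw [Real.sq_sqrt (norm_nonneg _)]; exact hM τ s hsM)
    (fun i => by rw [Real.sq_sqrt (norm_nonneg _)]; exact hρM i s hsc.le)
  have hker : ∑ i, (‖s - ρ i‖ ^ 2) ^ (-(3 / 4) : ℝ) ≤
      ∑ i, (η ^ 2 + (y - (ρ i).im) ^ 2) ^ (-(3 / 4) : ℝ) :=
    Finset.sum_le_sum fun i _ =>
      Real.rpow_le_rpow_of_nonpos (by positivity) (hdlow i) (by norm_num)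
  have hnorm : 1 / ‖s‖ ≤ 8 / T := by
    have := three_add_abs_le_norm hs (τ := τ) (by rwa [sim])
    have hs0 : 0 < ‖s‖ := by linarith
    rw [div_le_div_iff₀ hs0 (by linarith)]
    linarith
  refine (norm_deriv_deriv_div_id_le hd hg (fun s hs => (hR s hs).1) g0
    (fun s hs => (hR s hs).2.1) h4 hs).trans ?_
  set P := (1 + 2 * K₂) * T ^ (1 / 120 : ℝ)
  set Q := (2 * K ^ 2 + 4 * K₂ ^ 2 + 3 * K + 2 * K₂ + 13) * Real.log T ^ 2 with hQdef
  have hP : 0 ≤ P := by positivity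
  have hQ0 : 0 ≤ Q := by positivity
  calc _ ≤ ‖Φ s‖ / ‖s‖ * (Q * (∑ i, 1 / ‖s - ρ i‖ ^ 2 + 1)) :=
        mul_le_mul_of_nonneg_left hQ (by positivity)
    _ = 1 / ‖s‖ * ‖Φ s‖ * (Q * (∑ i, 1 / ‖s - ρ i‖ ^ 2 + 1)) := by ring
    _ ≤ 8 / T * (√‖g s‖ * P) * (Q * (∑ i, 1 / ‖s - ρ i‖ ^ 2 + 1)) := by
        refine mul_le_mul_of_nonneg_right (mul_le_mul hnorm ?_ (norm_nonneg _) (by positivity))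
          (by positivity)
        exact (norm_le_of_pow_four_eq (h4 s hs)).trans
          (mul_le_mul_of_nonneg_left hRn (Real.sqrt_nonneg _))
    _ = 8 / T * P * Q * (√‖g s‖ * (∑ i, 1 / ‖s - ρ i‖ ^ 2 + 1)) := by ring
    _ ≤ 8 / T * P * Q * (√(M τ) * (1 + √K * ∑ i, (η ^ 2 + (y - (ρ i).im) ^ 2) ^ (-(3 / 4) : ℝ))) :=
        mul_le_mul_of_nonneg_left (hsum.trans (mul_le_mul_of_nonneg_left (add_le_add le_rfl
          (mul_le_mul_of_nonneg_left hker (Real.sqrt_nonneg _))) (Real.sqrt_nonneg _)))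
          (by positivity)
    _ = _ := by ring

end InnerBound

section MeanSquareLine
open MeasureTheory

theorem edge_bound_le {T L n K K₂ K₃ m C U : ℝ} (hT : 3 ≤ T) (hL : L = Real.log T) (hK : 0 < K)
    (hK₂ : 0 < K₂) (hK₃ : 0 < K₃) (hC : 0 < C) (hn : n ≤ K * L) (hU : 1 ≤ U) :
    8 / T * ((1 + 2 * K₂) * T ^ (1 / 120 : ℝ)) * (K₃ * L ^ 2) * √m *
        (1 + √K * (n * (C * (1 / U) ^ (-(1 / 2) : ℝ)))) ≤
      8 * (1 + 2 * K₂) * K₃ * 240 ^ 2 * (1 + √K * K * 120 * C) *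
        (T ^ (1 / 40 - 1 : ℝ) * √m * √U) := by
  have hT0 : 0 < T := by linarith
  have hL0 : 0 ≤ L := by rw [hL]; exact Real.log_nonneg (by linarith)
  have l1 : L ≤ 120 * T ^ (1 / 120 : ℝ) := by
    have := Real.log_le_rpow_div hT0.le (by norm_num : (0 : ℝ) < 1 / 120)
    rw [hL]; linarith
  have l2 : L ^ 2 ≤ 240 ^ 2 * T ^ (1 / 120 : ℝ) := by
    have := Real.log_le_rpow_div hT0.le (by norm_num : (0 : ℝ) < 1 / 240)
    have l3 : L ≤ 240 * T ^ (1 / 240 : ℝ) := by rw [hL]; linarith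
    refine (pow_le_pow_left₀ hL0 l3 2).trans_eq ?_
    rw [mul_pow, ← Real.rpow_natCast (T ^ _) 2, ← Real.rpow_mul hT0.le]
    norm_num
  have hUe : (1 / U) ^ (-(1 / 2) : ℝ) = √U := by
    rw [one_div, Real.inv_rpow (by linarith), ← Real.rpow_neg (by linarith), neg_neg,
      Real.sqrt_eq_rpow]
  have hU1 : 1 ≤ √U := by rw [← Real.sqrt_one]; exact Real.sqrt_le_sqrt hU
  have t1 : (1 : ℝ) ≤ T ^ (1 / 120 : ℝ) := Real.one_le_rpow (by linarith) (by norm_num)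
  have hTT : 8 / T * (T ^ (1 / 120 : ℝ) * T ^ (1 / 120 : ℝ) * T ^ (1 / 120 : ℝ)) =
      8 * T ^ (1 / 40 - 1 : ℝ) := by
    rw [← Real.rpow_add hT0, ← Real.rpow_add hT0, Real.rpow_sub_one hT0.ne']
    norm_num
    ring
  rw [hUe]
  have f1 : 1 + √K * (n * (C * √U)) ≤ (1 + √K * K * 120 * C) * (T ^ (1 / 120 : ℝ) * √U) := by
    have g1 : 1 ≤ T ^ (1 / 120 : ℝ) * √U := one_le_mul_of_one_le_of_one_le t1 hU1
    have g2 : √K * (n * (C * √U)) ≤ √K * (K * (120 * T ^ (1 / 120 : ℝ)) * (C * √U)) :=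
      mul_le_mul_of_nonneg_left (mul_le_mul_of_nonneg_right
        (hn.trans (mul_le_mul_of_nonneg_left l1 hK.le)) (by positivity)) (Real.sqrt_nonneg _)
    calc _ ≤ T ^ (1 / 120 : ℝ) * √U + √K * (K * (120 * T ^ (1 / 120 : ℝ)) * (C * √U)) :=
          add_le_add g1 g2
      _ = _ := by ring
  calc _ ≤ 8 / T * ((1 + 2 * K₂) * T ^ (1 / 120 : ℝ)) * (K₃ * L ^ 2) * √m *
        ((1 + √K * K * 120 * C) * (T ^ (1 / 120 : ℝ) * √U)) :=
        mul_le_mul_of_nonneg_left f1 (by positivity)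
    _ ≤ 8 / T * ((1 + 2 * K₂) * T ^ (1 / 120 : ℝ)) * (K₃ * (240 ^ 2 * T ^ (1 / 120 : ℝ))) * √m *
        ((1 + √K * K * 120 * C) * (T ^ (1 / 120 : ℝ) * √U)) :=
        mul_le_mul_of_nonneg_right (mul_le_mul_of_nonneg_right (mul_le_mul_of_nonneg_left
          (mul_le_mul_of_nonneg_left l2 hK₃.le) (by positivity)) (Real.sqrt_nonneg _))
          (by positivity)
    _ = (8 / T * (T ^ (1 / 120 : ℝ) * T ^ (1 / 120 : ℝ) * T ^ (1 / 120 : ℝ))) *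
        ((1 + 2 * K₂) * K₃ * 240 ^ 2 * (1 + √K * K * 120 * C) * (√m * √U)) := by ring
    _ = _ := by rw [hTT]; ring

theorem exists_lintegral_sq_deriv_deriv_le {Φ g R : ℂ → ℂ} {M : ℝ → ℝ} {m A K₂ : ℝ}
    (hK₂ : 0 < K₂) (hd : ∀ s : ℂ, 1 / 2 < s.re → DifferentiableAt ℂ Φ s) (hg : Differentiable ℂ g)
    (h4 : ∀ s : ℂ, 1 / 2 < s.re → Φ s ^ 4 = g s ^ 2 * R s)
    (hm : 0 < m) (hgm : ∀ τ : ℝ, m ≤ ‖g (2 + τ * I)‖)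
    (hM0 : ∀ τ, 0 ≤ M τ)
    (hM : ∀ (τ : ℝ) (z : ℂ), ‖z - (2 + τ * I)‖ ≤ 9 / 5 → ‖g z‖ ≤ M τ)
    (hMA : ∀ τ, M τ ≤ A * (3 + |τ|) ^ 2)
    (hMI : ∫⁻ τ : ℝ, ENNReal.ofReal ((3 + |τ|) ^ (1 / 20 - 2 : ℝ) * M τ) ≠ ⊤)
    (hz : ∀ z, g z = 0 → z.re ≤ 1 / 2)
    (hR : ∀ s : ℂ, 1 / 2 < s.re → DifferentiableAt ℂ R s ∧ R s ≠ 0 ∧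
      ‖R s‖ ≤ K₂ * (3 + |s.im|) ^ (1 / 120 : ℝ) ∧ (s.re ≤ 3 / 2 →
        DifferentiableAt ℂ (logDeriv R) s ∧ ‖logDeriv R s‖ ≤ K₂ * Real.log (3 + |s.im|) ∧
        ‖deriv (logDeriv R) s‖ ≤ K₂ * Real.log (3 + |s.im|))) :
    ∃ J : ENNReal, J ≠ ⊤ ∧ ∀ U : ℝ, 2 ≤ U →
      ∫⁻ τ : ℝ, (∫⁻ y in Set.Icc (τ - 1 / 2) (τ + 1 / 2),
        ‖deriv (deriv fun s => Φ s / s) ((1 / 2 + 1 / U : ℝ) + y * I)‖ₑ) ^ 2 ≤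
      J * ENNReal.ofReal U := by
  obtain ⟨K, hK, hKτ⟩ := exists_logDeriv_expansion hg hm hgm hM hMA hz
  obtain ⟨C, hC, hker⟩ := exists_lintegral_rpow_kernel_le
  have g0 : ∀ s : ℂ, 1 / 2 < s.re → g s ≠ 0 := fun s hs h => (hz s h).not_gt hs
  set K₃ := 2 * K ^ 2 + 4 * K₂ ^ 2 + 3 * K + 2 * K₂ + 13 with hK₃
  have hK₃0 : 0 < K₃ := by positivity
  set D := 8 * (1 + 2 * K₂) * K₃ * 240 ^ 2 * (1 + √K * K * 120 * C) with hD
  have hD0 : 0 < D := by positivity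
  refine ⟨ENNReal.ofReal (D ^ 2) * ∫⁻ τ : ℝ, ENNReal.ofReal ((3 + |τ|) ^ (1 / 20 - 2 : ℝ) * M τ),
    ENNReal.mul_ne_top ENNReal.ofReal_ne_top hMI, fun U hU => ?_⟩
  have hη : 0 < 1 / U := by positivity
  have hη' : 1 / U ≤ 1 / 2 := one_div_le_one_div_of_le (by norm_num) hU
  have inner : ∀ τ : ℝ, ∫⁻ y in Set.Icc (τ - 1 / 2) (τ + 1 / 2),
      ‖deriv (deriv fun s => Φ s / s) ((1 / 2 + 1 / U : ℝ) + y * I)‖ₑ ≤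
      ENNReal.ofReal (D * ((3 + |τ|) ^ (1 / 40 - 1 : ℝ) * √(M τ) * √U)) := by
    intro τ
    obtain ⟨n, ρ, h, hn, hρ, hρM, hexp⟩ := hKτ τ
    refine (setLIntegral_mono' measurableSet_Icc fun y hy => ?_).trans
      ((lintegral_one_add_kernel_sum_le hC hker (fun i => (ρ i).im) hη
        (B := 8 / (3 + |τ|) * ((1 + 2 * K₂) * (3 + |τ|) ^ (1 / 120 : ℝ)) *
          (K₃ * Real.log (3 + |τ|) ^ 2) * √(M τ)) (A := √K) (by positivity)
        (Real.sqrt_nonneg _) τ).trans (ENNReal.ofReal_le_ofReal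
        (edge_bound_le (by linarith [abs_nonneg τ]) rfl hK hK₂ hK₃0 hC hn (by linarith))))
    rw [← ofReal_norm]
    exact ENNReal.ofReal_le_ofReal (norm_deriv_deriv_le_kernel_sum hK hK₂ hd hg g0 h4 hM0 hM hR τ hn
      hρ hρM hexp hη hη' (abs_le.mpr ⟨by linarith [hy.1], by linarith [hy.2]⟩))
  have sq : ∀ τ : ℝ, (∫⁻ y in Set.Icc (τ - 1 / 2) (τ + 1 / 2),
      ‖deriv (deriv fun s => Φ s / s) ((1 / 2 + 1 / U : ℝ) + y * I)‖ₑ) ^ 2 ≤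
      ENNReal.ofReal (D ^ 2 * U) * ENNReal.ofReal ((3 + |τ|) ^ (1 / 20 - 2 : ℝ) * M τ) := by
    intro τ
    have hT : 0 < 3 + |τ| := by positivity
    refine (pow_le_pow_left' (inner τ) 2).trans_eq ?_
    rw [← ENNReal.ofReal_pow (by positivity), ← ENNReal.ofReal_mul (by positivity)]
    congr 1
    have e : ((3 + |τ|) ^ (1 / 40 - 1 : ℝ)) ^ 2 = (3 + |τ|) ^ (1 / 20 - 2 : ℝ) := by
      rw [← Real.rpow_natCast (_ ^ _) 2, ← Real.rpow_mul hT.le]; norm_num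
    calc _ = D ^ 2 * (((3 + |τ|) ^ (1 / 40 - 1 : ℝ)) ^ 2 * √(M τ) ^ 2 * √U ^ 2) := by ring
      _ = _ := by rw [e, Real.sq_sqrt (hM0 τ), Real.sq_sqrt (by linarith)]; ring
  refine (lintegral_mono sq).trans_eq ?_
  rw [lintegral_const_mul' _ _ ENNReal.ofReal_ne_top, ENNReal.ofReal_mul (by positivity)]
  ring

end MeanSquareLine

section PolynomialGrowth

/-- Polynomial growth in the imaginary direction on every closed vertical strip contained in the
half-plane `1 / 2 < re s`. -/
def HasPolyGrowth (f : ℂ → ℂ) : Prop :=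
  ∀ σ b : ℝ, 1 / 2 < σ → ∃ (C : ℝ) (k : ℕ), 0 ≤ C ∧
    ∀ s : ℂ, σ ≤ s.re → s.re ≤ b → ‖f s‖ ≤ C * (1 + |s.im|) ^ k

theorem HasPolyGrowth.mul {f g : ℂ → ℂ} (hf : HasPolyGrowth f) (hg : HasPolyGrowth g) :
    HasPolyGrowth fun s => f s * g s := by
  intro σ b hσ
  obtain ⟨C, k, hC, h⟩ := hf σ b hσ
  obtain ⟨D, l, hD, h'⟩ := hg σ b hσ
  refine ⟨C * D, k + l, by positivity, fun s h1 h2 => ?_⟩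
  rw [norm_mul]
  calc ‖f s‖ * ‖g s‖ ≤ (C * (1 + |s.im|) ^ k) * (D * (1 + |s.im|) ^ l) :=
        mul_le_mul (h s h1 h2) (h' s h1 h2) (norm_nonneg _) (by positivity)
    _ = _ := by ring

theorem HasPolyGrowth.deriv {f : ℂ → ℂ} (hf : HasPolyGrowth f)
    (hd : DifferentiableOn ℂ f {s | 1 / 2 < s.re}) : HasPolyGrowth (deriv f) := by
  intro σ b hσ
  set r := (σ - 1 / 2) / 2 with hr
  have hr0 : 0 < r := by rw [hr]; linarith
  obtain ⟨C, k, hC, h⟩ := hf (σ - r) (b + r) (by rw [hr]; linarith)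
  refine ⟨C * (1 + r) ^ k / r, k, by positivity, fun s h1 h2 => ?_⟩
  have hball : ∀ z ∈ Metric.closedBall s r, σ - r ≤ z.re ∧ z.re ≤ b + r ∧
      |z.im| ≤ |s.im| + r := by
    intro z hz
    rw [Metric.mem_closedBall, dist_eq_norm] at hz
    have e1 := abs_le.mp ((Complex.abs_re_le_norm (z - s)).trans hz)
    have e2 := (Complex.abs_im_le_norm (z - s)).trans hz
    rw [sub_re] at e1
    rw [sub_im] at e2
    exact ⟨by linarith, by linarith, by linarith [abs_sub_abs_le_abs_sub z.im s.im]⟩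
  have hsub : Metric.closedBall s r ⊆ {s | 1 / 2 < s.re} := fun z hz => by
    have := (hball z hz).1
    change 1 / 2 < z.re
    rw [hr] at this
    linarith
  refine (Complex.norm_deriv_le_of_forall_mem_sphere_norm_le hr0
    ((hd.mono (Metric.closure_ball_subset_closedBall.trans hsub)).diffContOnCl)
    (fun z hz => ?_)).trans_eq (div_mul_eq_mul_div _ _ _).symm
  obtain ⟨z1, z2, z3⟩ := hball z (Metric.sphere_subset_closedBall hz)
  refine (h z z1 z2).trans ?_
  rw [mul_assoc, ← mul_pow]
  refine mul_le_mul_of_nonneg_left (pow_le_pow_left₀ (by positivity) ?_ k) hC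
  nlinarith [abs_nonneg s.im]

theorem hasPolyGrowth_LFunction {N : ℕ} [NeZero N] {ψ : DirichletCharacter ℂ N} (hψ : ψ ≠ 1) :
    HasPolyGrowth ψ.LFunction := by
  intro σ b hσ
  refine ⟨(N + 1) * (2 * (|b| + 1)), 1, by positivity, fun s h1 h2 => ?_⟩
  have hs : 1 / 2 < s.re := by linarith
  refine (norm_LFunction_le hψ (by linarith)).trans ?_
  have hn : ‖s‖ ≤ (|b| + 1) * (1 + |s.im|) := by
    refine (Complex.norm_le_abs_re_add_abs_im s).trans ?_
    rw [abs_of_pos (by linarith : 0 < s.re)]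
    nlinarith [le_abs_self b, abs_nonneg b, abs_nonneg s.im]
  rw [div_le_iff₀ (by linarith), pow_one]
  calc (N + 1 : ℝ) * ‖s‖ ≤ (N + 1) * ((|b| + 1) * (1 + |s.im|)) :=
        mul_le_mul_of_nonneg_left hn (by positivity)
    _ = (N + 1) * (2 * (|b| + 1)) * (1 + |s.im|) * (1 / 2) := by ring
    _ ≤ _ := mul_le_mul_of_nonneg_left hs.le (by positivity)

theorem HasPolyGrowth.div_id_of_pow_four_eq {Φ g R : ℂ → ℂ} {K : ℝ} (hg : HasPolyGrowth g)
    (hK : 0 < K) (hR : ∀ s : ℂ, 1 / 2 < s.re → ‖R s‖ ≤ K * (3 + |s.im|) ^ (1 / 120 : ℝ))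
    (h4 : ∀ s : ℂ, 1 / 2 < s.re → Φ s ^ 4 = g s ^ 2 * R s) :
    HasPolyGrowth fun s => Φ s / s := by
  intro σ b hσ
  obtain ⟨C, k, hC, h⟩ := hg σ b hσ
  refine ⟨2 * (1 + C) * (1 + 3 * K), k + 1, by positivity, fun s h1 h2 => ?_⟩
  have hs : 1 / 2 < s.re := by linarith
  have hsn : 1 / 2 < ‖s‖ := hs.trans_le ((le_abs_self _).trans (Complex.abs_re_le_norm s))
  have t1 : 1 ≤ 1 + |s.im| := by linarith [abs_nonneg s.im]
  have hRs : ‖R s‖ ≤ 3 * K * (1 + |s.im|) := by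
    refine (hR s hs).trans ?_
    have : (3 + |s.im|) ^ (1 / 120 : ℝ) ≤ 3 + |s.im| := by
      refine (Real.rpow_le_rpow_of_exponent_le (by linarith) (by norm_num :
        (1 / 120 : ℝ) ≤ 1)).trans_eq (Real.rpow_one _)
    nlinarith [abs_nonneg s.im]
  have hgs : √‖g s‖ ≤ (1 + C) * (1 + |s.im|) ^ k := by
    have e1 : √‖g s‖ ≤ 1 + ‖g s‖ := by
      rw [Real.sqrt_le_iff]
      constructor
      · positivity
      · nlinarith [norm_nonneg (g s)]
    have := h s h1 h2
    have := one_le_pow₀ t1 (n := k)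
    linarith
  have hRs' : 1 + ‖R s‖ ≤ (1 + 3 * K) * (1 + |s.im|) := by linarith
  rw [norm_div, div_le_iff₀ (by linarith)]
  calc ‖Φ s‖ ≤ √‖g s‖ * (1 + ‖R s‖) := norm_le_of_pow_four_eq (h4 s hs)
    _ ≤ ((1 + C) * (1 + |s.im|) ^ k) * ((1 + 3 * K) * (1 + |s.im|)) :=
        mul_le_mul hgs hRs' (by positivity) (by positivity)
    _ = 2 * (1 + C) * (1 + 3 * K) * (1 + |s.im|) ^ (k + 1) * (1 / 2) := by ring
    _ ≤ _ := mul_le_mul_of_nonneg_left hsn.le (by positivity)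

end PolynomialGrowth

section LaplaceSecondDerivative
open Topology

theorem deriv_deriv_laplace {a : ℝ → ℂ} (ha : Measurable a) (hle : ∀ u, ‖a u‖ ≤ Real.exp u)
    (h0 : ∀ u < 0, a u = 0) {f : ℂ → ℂ}
    (hf : ∀ s : ℂ, 1 < s.re → f s = ∫ u : ℝ, a u * cexp (-s * u)) {s : ℂ} (hs : 1 < s.re) :
    deriv (deriv f) s = ∫ u : ℝ, (u ^ 2 * a u) * cexp (-s * u) := by
  have hle' : ∀ u, ‖a u‖ ≤ 1 * Real.exp (1 * u) := fun u => by simpa using hle u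
  have e1 : ∀ w : ℂ, 1 < w.re → deriv f w = ∫ u : ℝ, (-(u : ℂ)) * a u * cexp (-w * u) := by
    intro w hw
    have : f =ᶠ[𝓝 w] fun s : ℂ => ∫ u : ℝ, a u * cexp (-s * u) := by
      filter_upwards [(Complex.isOpen_re_gt 1).mem_nhds hw] with z hz using hf z hz
    rw [this.deriv_eq]
    exact (hasDerivAt_laplace ha hle' h0 hw).deriv
  have e2 : deriv f =ᶠ[𝓝 s] fun s : ℂ => ∫ u : ℝ, (-(u : ℂ)) * a u * cexp (-s * u) := by
    filter_upwards [(Complex.isOpen_re_gt 1).mem_nhds hs] with z hz using e1 z hz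
  have hb := norm_mul_le_exp_of_le (κ' := (1 + s.re) / 2) (by linarith) hle' h0
  rw [e2.deriv_eq, (hasDerivAt_laplace (by fun_prop) hb
    (fun u hu => by rw [h0 u hu, mul_zero]) (by linarith)).deriv]
  refine MeasureTheory.integral_congr_ae (Eventually.of_forall fun u => ?_)
  ring_nf

theorem continuousOn_LSeries {c : ℕ → ℂ} (hc : ∀ n, ‖c n‖ ≤ 1) :
    ContinuousOn (LSeries c) {s : ℂ | 1 < s.re} := by
  intro s hs
  have hd := hasDerivAt_laplace (measurable_expSum c) (C := 1) (κ := 1)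
    (fun u => by simpa using norm_expSum_le hc u) (fun u hu => expSum_of_neg c hu) hs
  have : ContinuousAt (LSeries c) s := by
    refine (continuousAt_id.mul hd.continuousAt).congr ?_
    filter_upwards [(Complex.isOpen_re_gt 1).mem_nhds hs] with z hz
    exact (LSeries_eq_mul_laplace hc hz).symm
  exact this.continuousWithinAt

end LaplaceSecondDerivative

section SumsOfTwoSquares
open MeasureTheory

theorem mulChiNeg4_ne_one {q : ℕ} [NeZero q] {χ : DirichletCharacter ℂ q} (hχ : χ ^ 2 ≠ 1) :
    mulChiNeg4 χ ≠ 1 := by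
  intro h
  have h4 : chiNeg4 ^ 2 = 1 := (ZMod.isQuadratic_χ₄.comp (Int.castRingHom ℂ)).sq_eq_one
  refine hχ ((DirichletCharacter.changeLevel_eq_one_iff (dvd_mul_left q 4)).mp ?_)
  have h2 : mulChiNeg4 χ ^ 2 = 1 := by rw [h, one_pow]
  rwa [mulChiNeg4, mul_pow, ← map_pow, ← map_pow, h4, map_one, mul_one] at h2

theorem mulChiNeg4_sq_ne_one {q : ℕ} [NeZero q] (χ : DirichletCharacter ℂ q) :
    mulChiNeg4 (χ ^ 2) ≠ 1 := by
  intro h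
  have hq : 1 ≤ 4 * q := by have := NeZero.pos q; omega
  have e : ∀ N : ℕ, N ∣ 4 * q → ((4 * q - 1 : ℕ) : ZMod N) = -1 := by
    intro N hN
    rw [Nat.cast_sub hq, (ZMod.natCast_eq_zero_iff _ _).mpr hN]
    simp
  have := mulChiNeg4_natCast (χ ^ 2) (4 * q - 1)
  rw [h, e _ dvd_rfl, e _ (dvd_mul_left q 4), e 4 (dvd_mul_right 4 q), MulChar.pow_apply' _ two_ne_zero,
    ← map_pow, neg_one_sq, map_one, MulChar.one_apply isUnit_one.neg] at this
  have h4 : ZMod.χ₄ (-1) = -1 := by decide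
  rw [h4] at this
  norm_num at this

theorem GRH.re_le_half {N : ℕ} [NeZero N] {ψ : DirichletCharacter ℂ N} (hG : GRH ψ) (hψ : ψ ≠ 1)
    (s : ℂ) (hs : ψ.LFunction s = 0) : s.re ≤ 1 / 2 :=
  re_le_half_of_LFunction_eq_zero hψ
    (fun s h0 h1 h => hG s h0 h1 (by rw [LVal, dif_neg (NeZero.ne N)]; exact h)) s hs

theorem exists_lintegral_sq_expSum_STwist_le {q : ℕ} [NeZero q] {χ : DirichletCharacter ℂ q}
    (hχ : χ ≠ 1) (hχ2 : χ ^ 2 ≠ 1) (h1 : GRH χ) (h2 : GRH (mulChiNeg4 χ)) (h3 : GRH (χ ^ 2))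
    (h4 : GRH (mulChiNeg4 (χ ^ 2))) :
    ∃ J : ENNReal, J ≠ ⊤ ∧ ∀ U : ℝ, 2 ≤ U →
      ∫⁻ u in Set.Icc U (U + 1), ENNReal.ofReal (U ^ 4) *
        (ENNReal.ofReal (Real.exp (-u)) * ‖expSum (STwist χ) u‖ₑ ^ 2) ≤ J * ENNReal.ofReal U := by
  have n2 := mulChiNeg4_ne_one hχ2
  have n4 := mulChiNeg4_sq_ne_one χ
  have z1 := h1.re_le_half hχ
  have z2 := h2.re_le_half n2
  have z3 := h3.re_le_half hχ2
  have z4 := h4.re_le_half n4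
  have hc := norm_STwist_le χ
  obtain ⟨v, B, hv, hB, hfac⟩ := exists_STwist_factorization χ
  obtain ⟨K₂, hK₂, hR⟩ := exists_ratioFactor_bounds hχ2 n4 z3 z4 hv hB (δ := 1 / 120) (by norm_num)
  set R := ratioFactor (χ ^ 2) (mulChiNeg4 (χ ^ 2)) v with hRdef
  set g : ℂ → ℂ := fun s => χ.LFunction s * (mulChiNeg4 χ).LFunction s with hgdef
  have hg : Differentiable ℂ g := (DirichletCharacter.differentiable_LFunction hχ).mul
    (DirichletCharacter.differentiable_LFunction n2)
  have hz : ∀ z, g z = 0 → z.re ≤ 1 / 2 := fun z h => by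
    rcases mul_eq_zero.mp h with h | h
    exacts [z1 z h, z2 z h]
  have g0 : ∀ s : ℂ, 1 / 2 < s.re → g s ≠ 0 := fun s hs h => (hz s h).not_gt hs
  obtain ⟨Φ, hΦ, hΦF⟩ := exists_fourth_root_extension (F := LSeries (STwist χ))
    (G := fun s => g s ^ 2 * R s)
    (fun s hs => (((hg s).pow 2).mul (hR s hs).1).differentiableWithinAt)
    (fun s hs => mul_ne_zero (pow_ne_zero 2 (g0 s hs)) (hR s hs).2.1) (continuousOn_LSeries hc)
    (fun s hs => by
      have hne : (mulChiNeg4 (χ ^ 2)).LFunction (2 * s) ≠ 0 := fun h => by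
        have := z4 _ h
        simp at this
        linarith
      have := hfac s hs
      simp only [hgdef, hRdef, ratioFactor]
      field_simp
      linear_combination this)
  have hd : ∀ s : ℂ, 1 / 2 < s.re → DifferentiableAt ℂ Φ s := fun s hs => (hΦ s hs).1
  have hΦ4 : ∀ s : ℂ, 1 / 2 < s.re → Φ s ^ 4 = g s ^ 2 * R s := fun s hs => (hΦ s hs).2
  obtain ⟨M, A, hMA, hM, hMI⟩ := exists_majorant hχ n2
  obtain ⟨b, hb, hbL⟩ := exists_norm_LFunction_le (σ := 2) one_lt_two
  have hgm : ∀ τ : ℝ, (b * b)⁻¹ ≤ ‖g (2 + τ * I)‖ := by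
    intro τ
    have hτ : (2 : ℝ) ≤ (2 + τ * I : ℂ).re := by simp
    have e1 := (hbL q χ _ hτ).2
    have e2 := (hbL _ (mulChiNeg4 χ) _ hτ).2
    have hg2 : g (2 + τ * I) ≠ 0 := g0 _ (by linarith)
    rw [inv_le_comm₀ (by positivity) (norm_pos_iff.mpr hg2), ← norm_inv, hgdef, mul_inv, norm_mul]
    exact mul_le_mul e1 e2 (norm_nonneg _) (by linarith)
  obtain ⟨J₁, hJ₁, hJ₁U⟩ := exists_lintegral_sq_deriv_deriv_le hK₂ hd hg hΦ4 (by positivity) hgm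
    (fun τ => (hMA τ).1) hM (fun τ => (hMA τ).2) hMI hz hR
  have hdiv : DifferentiableOn ℂ (fun s => Φ s / s) {s | 1 / 2 < s.re} := fun s hs =>
    ((hd s hs).div differentiableAt_id (fun h : s = 0 => by
      rw [Set.mem_ofPred_eq, h, zero_re] at hs; linarith)).differentiableWithinAt
  have hdiv' := hdiv.deriv (Complex.isOpen_re_gt _)
  have hpoly : HasPolyGrowth (deriv (deriv fun s => Φ s / s)) :=
    ((((hasPolyGrowth_LFunction hχ).mul (hasPolyGrowth_LFunction n2)).div_id_of_pow_four_eq hK₂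
      (fun s hs => (hR s hs).2.2.1) hΦ4).deriv hdiv).deriv hdiv'
  obtain ⟨K, hK, hT⟩ := exists_tauberian
  refine ⟨K * J₁, ENNReal.mul_ne_top hK hJ₁, fun U hU => ?_⟩
  refine (hT (expSum (STwist χ)) (deriv (deriv fun s => Φ s / s)) 1 (measurable_expSum _)
    (fun u => by simpa using norm_expSum_le hc u) (fun u hu => expSum_of_neg _ hu)
    (hdiv'.deriv (Complex.isOpen_re_gt _)) (fun s hs => ?_) (fun σ hσ => ?_) U hU).trans ?_
  · refine deriv_deriv_laplace (measurable_expSum _) (norm_expSum_le hc)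
      (fun u hu => expSum_of_neg _ hu) (fun w hw => ?_) hs
    have hw0 : w ≠ 0 := fun h => by rw [h, zero_re] at hw; linarith
    rw [hΦF w hw, LSeries_eq_mul_laplace hc hw, mul_div_cancel_left₀ _ hw0]
  · obtain ⟨C, k, -, h⟩ := hpoly σ 2 hσ
    exact ⟨C, k, h⟩
  · rw [mul_assoc]
    exact mul_le_mul_right (hJ₁U U hU) K

end SumsOfTwoSquares

section DyadicInterval
open MeasureTheory

theorem measurable_SSum {q : ℕ} (χ : DirichletCharacter ℂ q) : Measurable (SSum χ) :=
  (measurable_from_nat (f := fun m => ∑ n ∈ Finset.Icc 1 m, STwist χ n)).comp Nat.measurable_floor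

theorem lintegral_sq_SSum_le {q : ℕ} (χ : DirichletCharacter ℂ q) {X : ℝ} (hX : 0 < X) :
    ∫⁻ x in Set.Icc X (2 * X), ‖SSum χ x‖ₑ ^ 2 ≤
      ENNReal.ofReal (4 * X ^ 2) * ∫⁻ u in Set.Icc (Real.log X) (Real.log X + 1),
        ENNReal.ofReal (Real.exp (-u)) * ‖expSum (STwist χ) u‖ₑ ^ 2 := by
  have h2X : Real.log (2 * X) = Real.log X + Real.log 2 := by
    rw [Real.log_mul two_ne_zero hX.ne', add_comm]
  have himg : Set.Icc X (2 * X) = Real.exp '' Set.Icc (Real.log X) (Real.log (2 * X)) := by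
    ext x
    constructor
    · intro hx
      have hx0 : 0 < x := hX.trans_le hx.1
      exact ⟨Real.log x, ⟨Real.log_le_log hX hx.1, Real.log_le_log hx0 hx.2⟩, Real.exp_log hx0⟩
    · rintro ⟨u, hu, rfl⟩
      exact ⟨(Real.log_le_iff_le_exp hX).mp hu.1, (Real.le_log_iff_exp_le (by positivity)).mp hu.2⟩
  rw [himg, lintegral_image_eq_lintegral_abs_deriv_mul measurableSet_Icc
    (fun u _ => (Real.hasDerivAt_exp u).hasDerivWithinAt) Real.exp_injective.injOn,
    ← lintegral_const_mul' _ _ ENNReal.ofReal_ne_top]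
  refine (setLIntegral_mono' measurableSet_Icc fun u hu => ?_).trans
    (lintegral_mono_set (Set.Icc_subset_Icc_right (by rw [h2X]; linarith [Real.log_two_lt_d9])))
  have hle : Real.exp u ≤ 2 * X := (Real.le_log_iff_exp_le (by positivity)).mp hu.2
  rw [← mul_assoc, ← ENNReal.ofReal_mul (by positivity)]
  refine mul_le_mul_left (ENNReal.ofReal_le_ofReal ?_) _
  rw [Real.abs_exp, Real.exp_neg, ← div_eq_mul_inv, le_div_iff₀ (Real.exp_pos u)]
  nlinarith [Real.exp_pos u]

theorem integral_sq_SSum_eq_toReal {q : ℕ} (χ : DirichletCharacter ℂ q) {X : ℝ} (hX : 0 < X) :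
    ∫ x in X..(2 * X), ‖SSum χ x‖ ^ 2 =
      (∫⁻ x in Set.Icc X (2 * X), ‖SSum χ x‖ₑ ^ 2).toReal := by
  rw [intervalIntegral.integral_of_le (by linarith), ← integral_Icc_eq_integral_Ioc,
    integral_eq_lintegral_of_nonneg_ae (Eventually.of_forall fun x => by positivity)
      ((measurable_SSum χ).norm.pow_const 2).aestronglyMeasurable]
  congr 1
  refine lintegral_congr fun x => ?_
  rw [ENNReal.ofReal_pow (norm_nonneg _), ofReal_norm]

theorem norm_SSum_le {q : ℕ} (χ : DirichletCharacter ℂ q) {x : ℝ} (hx : 0 ≤ x) :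
    ‖SSum χ x‖ ≤ x :=
  (norm_sum_Icc_le (norm_STwist_le χ) _).trans (Nat.floor_le hx)

theorem integral_sq_SSum_le_pow_three {q : ℕ} (χ : DirichletCharacter ℂ q) {X : ℝ} (hX : 0 < X) :
    ∫ x in X..(2 * X), ‖SSum χ x‖ ^ 2 ≤ 4 * X ^ 3 := by
  refine (Real.le_norm_self _).trans ((intervalIntegral.norm_integral_le_of_norm_le_const
    (C := 4 * X ^ 2) fun x hx => ?_).trans_eq ?_)
  · rw [Set.uIoc_of_le (by linarith)] at hx
    have hx0 : 0 ≤ x := by linarith [hx.1]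
    rw [norm_pow, norm_norm]
    nlinarith [norm_SSum_le χ hx0, norm_nonneg (SSum χ x), hx.2]
  · rw [show 2 * X - X = X by ring, abs_of_pos hX]; ring

end DyadicInterval

/-- **Proposition 5.1, first part:** mean-square bound for the twisted sum over sums of
two squares, `χ²` non-principal. -/
theorem mean_square_nonreal_character
    (q : ℕ) (hq : 0 < q) (χ : DirichletCharacter ℂ q) (hχ : χ ≠ 1) (hχ2 : χ ^ 2 ≠ 1)
    (h1 : GRH χ) (h2 : GRH (mulChiNeg4 χ)) (h3 : GRH (χ ^ 2)) (h4 : GRH (mulChiNeg4 (χ ^ 2))) :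
    ∃ C : ℝ, ∀ X : ℝ, 2 ≤ X →
      (1 / X) * (∫ x in X..(2 * X), ‖SSum χ x‖ ^ 2) ≤ C * X / Real.log X ^ (3 : ℕ) := by
  have : NeZero q := ⟨hq.ne'⟩
  obtain ⟨J, hJ, hJU⟩ := exists_lintegral_sq_expSum_STwist_le hχ hχ2 h1 h2 h3 h4
  refine ⟨4 * J.toReal + 256, fun X hX => ?_⟩
  have hX0 : 0 < X := by linarith
  set L := Real.log X with hL
  have hL0 : 0 < L := Real.log_pos (by linarith)
  have hJ0 : 0 ≤ J.toReal := ENNReal.toReal_nonneg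
  rw [one_div, inv_mul_le_iff₀ hX0]
  rcases lt_or_ge L 2 with hL2 | hL2
  · have hX8 : X ≤ 8 := by
      have e1 : X < Real.exp 2 := (Real.log_lt_iff_lt_exp hX0).mp hL2
      have e2 : Real.exp 2 = Real.exp 1 ^ 2 := by rw [← Real.exp_nat_mul]; norm_num
      nlinarith [Real.exp_one_lt_d9, Real.exp_pos 1]
    refine (integral_sq_SSum_le_pow_three χ hX0).trans ?_
    have hL8 : L ^ 3 ≤ 8 := (pow_le_pow_left₀ hL0.le hL2.le 3).trans_eq (by norm_num)
    rw [← mul_div_assoc, le_div_iff₀ (by positivity)]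
    have h5 : X * L ^ 3 ≤ 64 := by
      calc X * L ^ 3 ≤ 8 * 8 := mul_le_mul hX8 hL8 (by positivity) (by norm_num)
        _ = 64 := by norm_num
    calc 4 * X ^ 3 * L ^ 3 = 4 * X ^ 2 * (X * L ^ 3) := by ring
      _ ≤ 4 * X ^ 2 * 64 := mul_le_mul_of_nonneg_left h5 (by positivity)
      _ ≤ X * ((4 * J.toReal + 256) * X) := by nlinarith [mul_nonneg hJ0 (sq_nonneg X)]
  · rw [integral_sq_SSum_eq_toReal χ hX0]
    set E := ∫⁻ u in Set.Icc L (L + 1),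
      ENNReal.ofReal (Real.exp (-u)) * ‖expSum (STwist χ) u‖ₑ ^ 2 with hE
    have hEL : ENNReal.ofReal (L ^ 4) * E ≤ J * ENNReal.ofReal L := by
      rw [hE, ← MeasureTheory.lintegral_const_mul' _ _ ENNReal.ofReal_ne_top]
      exact hJU L hL2
    have hEtop : E ≠ ⊤ := fun h => by
      rw [h, ENNReal.mul_top (by simpa using by positivity)] at hEL
      exact ENNReal.mul_ne_top hJ ENNReal.ofReal_ne_top (top_le_iff.mp hEL)
    have hEr : L ^ 4 * E.toReal ≤ J.toReal * L := by
      have := ENNReal.toReal_mono (ENNReal.mul_ne_top hJ ENNReal.ofReal_ne_top) hEL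
      rwa [ENNReal.toReal_mul, ENNReal.toReal_mul, ENNReal.toReal_ofReal (by positivity),
        ENNReal.toReal_ofReal hL0.le] at this
    have hEr' : L ^ 3 * E.toReal ≤ J.toReal := by
      refine le_of_mul_le_mul_right ?_ hL0
      calc _ = L ^ 4 * E.toReal := by ring
        _ ≤ _ := hEr
    have hS := ENNReal.toReal_mono (ENNReal.mul_ne_top ENNReal.ofReal_ne_top hEtop)
      (lintegral_sq_SSum_le χ hX0)
    rw [ENNReal.toReal_mul, ENNReal.toReal_ofReal (by positivity)] at hS
    refine hS.trans ?_
    rw [← mul_div_assoc, le_div_iff₀ (by positivity)]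
    calc 4 * X ^ 2 * E.toReal * L ^ 3 = 4 * X ^ 2 * (L ^ 3 * E.toReal) := by ring
      _ ≤ 4 * X ^ 2 * J.toReal := mul_le_mul_of_nonneg_left hEr' (by positivity)
      _ ≤ X * ((4 * J.toReal + 256) * X) := by nlinarith [sq_nonneg X]

end
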